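/- Suppose that for all sufficiently large T, every nontrivial zero ρ = β + iγ of the Riemann zeta function with T < γ ≤ 2T satisfies |β − 1/2| < 0.001/(2 log T). Then, as T → ∞, the number of simple nontrivial zeros ρ = β + iγ of ζ with T < γ ≤ 2T (counted with multiplicity) is at least (0.67250064 + o(1)) · (T/(2π)) log T, and the same lower bound holds for the number of nontrivial zeros with T < γ ≤ 2T and β = 1/2. -/

import Mathlib

open Filter Topology MeasureTheory Set

/-- The multiplicity of `ρ` as a zero of the Riemann zeta function:
the least `n` such that the `n`-th iterated derivative of `ζ` is nonzero at `ρ`. -/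
noncomputable def zetaMult (ρ : ℂ) : ℕ :=
  sInf {n : ℕ | iteratedDeriv n riemannZeta ρ ≠ 0}

/-- `ρ` is a nontrivial zero of the Riemann zeta function. -/
def IsNontrivialZero (ρ : ℂ) : Prop :=
  riemannZeta ρ = 0 ∧ 0 < ρ.re ∧ ρ.re < 1

/-- The set of nontrivial zeros `ρ = β + iγ` with `T < γ ≤ 2T`. -/
def zeroBand (T : ℝ) : Set ℂ :=
  {ρ | IsNontrivialZero ρ ∧ T < ρ.im ∧ ρ.im ≤ 2 * T}

/-- Number of nontrivial zeros with `T < γ ≤ 2T`, counted with multiplicity. -/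
noncomputable def Ntot (T : ℝ) : ℝ :=
  ∑ᶠ ρ ∈ zeroBand T, (zetaMult ρ : ℝ)

/-- Number of simple nontrivial zeros with `T < γ ≤ 2T`. -/
noncomputable def Nsimple (T : ℝ) : ℝ :=
  ∑ᶠ ρ ∈ {ρ ∈ zeroBand T | zetaMult ρ = 1}, (1 : ℝ)

/-- Number of nontrivial zeros with `T < γ ≤ 2T` on the critical line, with multiplicity. -/
noncomputable def Nline (T : ℝ) : ℝ :=
  ∑ᶠ ρ ∈ {ρ ∈ zeroBand T | ρ.re = 1/2}, (zetaMult ρ : ℝ)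

/-- Number of simple critical-line nontrivial zeros with `T < γ ≤ 2T`. -/
noncomputable def NlineSimple (T : ℝ) : ℝ :=
  ∑ᶠ ρ ∈ {ρ ∈ zeroBand T | ρ.re = 1/2 ∧ zetaMult ρ = 1}, (1 : ℝ)

local notation "neA" => (-(5/4) : ℝ)
local notation "eA" => (5/4 : ℝ)
local notation "eB" => (19/20 : ℝ)
local notation "neC" => (-(4/5) : ℝ)
local notation "eC" => (4/5 : ℝ)
local notation "neD" => (-(1/4) : ℝ)
local notation "neE" => (-(9/10) : ℝ)
local notation "eE" => (9/10 : ℝ)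
local notation "neF" => (-(3/4) : ℝ)
local notation "eF" => (3/4 : ℝ)
local notation "neG" => (-(1/2) : ℝ)
local notation "eG" => (1/2 : ℝ)
local notation "neH" => (-(11/10) : ℝ)
local notation "eH" => (11/10 : ℝ)
local notation "lg" => Real.log
local notation "cs" => Real.cos
local notation "sn" => Real.sin
local notation "ep" => Real.exp
local notation "pI" => Real.pi
local notation "kc" => Real.cosh
local notation "Gm" => Complex.Gamma
local notation "cE" => Complex.exp
local notation "cI" => Complex.I
local notation "aon" => analyticOrderNatAt

lemma ci {E : Type*} [NormedAddCommGroup E] {f : ℝ → E} {a b : ℝ} (h : Continuous f := by fun_prop) : IntervalIntegrable f volume a b := h.intervalIntegrable a b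

lemma entire_order_ne_top {f : ℂ → ℂ} (hf : Differentiable ℂ f) (h0 : f 0 ≠ 0) (a : ℂ) :
    analyticOrderAt f a ≠ ⊤ := by
  have hA : AnalyticOnNhd ℂ f univ := fun z _ => hf.analyticAt z
  refine hA.analyticOrderAt_ne_top_of_isPreconnected isPreconnected_univ (mem_univ 0) (mem_univ a) ?_
  rw [(hf.analyticAt 0).analyticOrderAt_eq_zero.2 h0]; simp

lemma entire_divide {f : ℂ → ℂ} (hf : Differentiable ℂ f) (h0 : f 0 ≠ 0) (a : ℂ) :
    ∃ g : ℂ → ℂ, Differentiable ℂ g ∧ (∀ z, f z = (z - a) ^ (aon f a) * g z) ∧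
      g a ≠ 0 := by
  obtain ⟨k, hk, hka, hfk⟩ := (hf.analyticAt a).analyticOrderAt_ne_top.1 (entire_order_ne_top hf h0 a)
  set n := aon f a
  classical
  let g : ℂ → ℂ := fun z => if z = a then k a else f z / (z - a) ^ n
  have hfk' : ∀ᶠ z in 𝓝 a, g z = k z := by
    filter_upwards [hfk] with z hz
    by_cases h : z = a
    · simp [g, h]
    · simp only [g, h, if_false, hz, smul_eq_mul]
      have : (z - a) ^ n ≠ 0 := pow_ne_zero _ (sub_ne_zero.2 h)
      field_simp
  refine ⟨g, ?_, ?_, ?_⟩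
  · intro z
    by_cases h : z = a
    · subst h
      exact (hk.differentiableAt).congr_of_eventuallyEq hfk'
    · have : g =ᶠ[𝓝 z] fun w => f w / (w - a) ^ n := by
        filter_upwards [isOpen_ne.mem_nhds h] with w hw
        have : w ≠ a := hw
        simp [g, this]
      refine DifferentiableAt.congr_of_eventuallyEq ?_ this
      have := pow_ne_zero n (sub_ne_zero.2 h)
      fun_prop (disch := assumption)
  · intro z
    by_cases h : z = a
    · have := hfk.self_of_nhds
      rw [h, this]; simp [g]
    · have : (z - a) ^ n ≠ 0 := pow_ne_zero _ (sub_ne_zero.2 h)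
      simp only [g, h, if_false]; field_simp
  · simpa [g] using hka

lemma entire_divide_fin {f : ℂ → ℂ} (hf : Differentiable ℂ f) (h0 : f 0 ≠ 0) (Z : Finset ℂ) :
    ∃ g : ℂ → ℂ, Differentiable ℂ g ∧
      (∀ z, f z = (∏ ρ ∈ Z, (z - ρ) ^ (aon f ρ)) * g z) ∧
      ∀ ρ ∈ Z, g ρ ≠ 0 := by
  classical
  induction Z using Finset.induction_on with
  | empty => exact ⟨f, hf, by simp, by simp⟩
  | insert a Z ha ih =>
    obtain ⟨g, hg, hfg, hgZ⟩ := ih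
    have hg0 : g 0 ≠ 0 := by
      intro h; apply h0; rw [hfg 0, h, mul_zero]
    obtain ⟨g', hg', hgg', hga⟩ := entire_divide hg hg0 a
    have hord : aon f a = aon g a := by
      have hP : Differentiable ℂ (fun z => ∏ ρ ∈ Z, (z - ρ) ^ (aon f ρ)) := by
        fun_prop
      have hPa : (∏ ρ ∈ Z, (a - ρ) ^ (aon f ρ)) ≠ 0 := by
        rw [Finset.prod_ne_zero_iff]
        intro ρ hρ
        exact pow_ne_zero _ (sub_ne_zero.2 (fun h => ha (h ▸ hρ)))
      have e : analyticOrderAt f a = analyticOrderAt g a := by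
        have : f = (fun z => ∏ ρ ∈ Z, (z - ρ) ^ (aon f ρ)) * g := by
          ext z; exact hfg z
        conv_lhs => rw [this]
        rw [analyticOrderAt_mul (hP.analyticAt a) (hg.analyticAt a),
          (hP.analyticAt a).analyticOrderAt_eq_zero.2 hPa, zero_add]
      simp [analyticOrderNatAt, e]
    refine ⟨g', hg', ?_, ?_⟩
    · intro z
      rw [Finset.prod_insert ha, hord, mul_right_comm, ← hgg' z, mul_comm, ← hfg z]
    · intro ρ hρ
      rcases Finset.mem_insert.1 hρ with rfl | h
      · exact hga
      · intro h'; apply hgZ ρ h; rw [hgg' ρ, h', mul_zero]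

/-- counting and growth of the quotient -/
lemma entire_count {f : ℂ → ℂ} (h0 : f 0 = 1) {R M : ℝ} (hR : 0 < R)
    (hM : ∀ z, ‖z‖ ≤ 4 * R → ‖f z‖ ≤ M) (Z : Finset ℂ) (hZ : ∀ ρ ∈ Z, ‖ρ‖ ≤ R)
    {g : ℂ → ℂ} (hg : Differentiable ℂ g) (m : ℂ → ℕ)
    (hfg : ∀ z, f z = (∏ ρ ∈ Z, (z - ρ) ^ (m ρ)) * g z) :
    (3 : ℝ) ^ (∑ ρ ∈ Z, m ρ) ≤ M ∧ ∀ z, ‖z‖ ≤ 4 * R → ‖g z‖ ≤ M * ‖g 0‖ := by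
  set n := ∑ ρ ∈ Z, m ρ with hn
  have hg0 : 1 ≤ R ^ n * ‖g 0‖ := by
    have h1 : ‖f 0‖ = 1 := by simp [h0]
    rw [hfg 0, norm_mul, norm_prod] at h1
    have : ∏ ρ ∈ Z, ‖(0 - ρ) ^ m ρ‖ ≤ R ^ n := by
      rw [hn, ← Finset.prod_pow_eq_pow_sum]
      refine Finset.prod_le_prod (fun _ _ => norm_nonneg _) fun ρ hρ => ?_
      rw [norm_pow]; gcongr; simpa using hZ ρ hρ
    calc (1:ℝ) = _ := h1.symm
      _ ≤ _ := by gcongr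
  have hM0 : 0 ≤ M := (norm_nonneg _).trans (hM 0 (by simp; positivity))
  have hsph : ∀ z ∈ frontier (Metric.ball (0:ℂ) (4 * R)), ‖g z‖ ≤ M / (3 * R) ^ n := by
    intro z hz
    rw [frontier_ball _ (by positivity)] at hz
    have hz' : ‖z‖ = 4 * R := by simpa using hz
    rw [le_div_iff₀ (by positivity)]
    have : (3 * R) ^ n ≤ ∏ ρ ∈ Z, ‖(z - ρ) ^ m ρ‖ := by
      rw [hn, ← Finset.prod_pow_eq_pow_sum]
      refine Finset.prod_le_prod (fun _ _ => by positivity) fun ρ hρ => ?_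
      rw [norm_pow]; gcongr
      have := norm_sub_norm_le z ρ
      have := hZ ρ hρ
      linarith
    calc ‖g z‖ * (3 * R) ^ n ≤ ‖g z‖ * ∏ ρ ∈ Z, ‖(z - ρ) ^ m ρ‖ := by gcongr
      _ = ‖f z‖ := by rw [hfg z, norm_mul, norm_prod]; ring
      _ ≤ M := hM z hz'.le
  have hall : ∀ z, ‖z‖ ≤ 4 * R → ‖g z‖ ≤ M / (3 * R) ^ n := by
    intro z hz
    refine Complex.norm_le_of_forall_mem_frontier_norm_le Metric.isBounded_ball hg.diffContOnCl hsph ?_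
    rw [closure_ball _ (by positivity)]; simpa using hz
  have h00 := hall 0 (by simp; positivity)
  constructor
  · rw [le_div_iff₀ (by positivity), mul_pow] at h00
    nlinarith [pow_pos hR n, pow_pos (show (0:ℝ) < 3 by norm_num) n]
  · intro z hz
    refine (hall z hz).trans ?_
    rw [div_le_iff₀ (by positivity), mul_pow]
    have : (1:ℝ) ≤ 3 ^ n := one_le_pow₀ (by norm_num)
    calc M = M * 1 * 1 := by ring
      _ ≤ M * (R ^ n * ‖g 0‖) * 3 ^ n := by gcongr
      _ = _ := by ring

/-- derivative of log-derivative control -/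
lemma logDeriv_close {g : ℂ → ℂ} (hg : Differentiable ℂ g) {R B : ℝ} (hR : 0 < R) (hB : 0 < B)
    (hne : ∀ z, ‖z‖ ≤ R → g z ≠ 0) (hgB : ∀ z, ‖z‖ ≤ R → ‖g z‖ ≤ ep B * ‖g 0‖)
    {s t : ℂ} (hs : ‖s‖ ≤ R / 8) (ht : ‖t‖ ≤ R / 8) :
    ‖logDeriv g s - logDeriv g t‖ ≤ 64 * B / R ^ 2 * ‖s - t‖ := by
  have hd : DifferentiableOn ℂ (logDeriv g) (Metric.ball 0 R) := by
    intro z hz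
    have hz' : ‖z‖ ≤ R := (by simpa using hz : ‖z‖ < R).le
    have h1 : DifferentiableAt ℂ (deriv g) z := (hg.analyticAt z).deriv.differentiableAt
    exact (h1.div (hg z) (hne z hz')).differentiableWithinAt
  obtain ⟨φ, hφ0, hφ⟩ := (hd.isExactOn_ball).with_val_at 0 0
  have hexp : ∀ z ∈ Metric.ball (0:ℂ) R, g z = g 0 * cE (φ z) := by
    have hder : ∀ z ∈ Metric.ball (0:ℂ) R,
        HasDerivAt (fun z => g z * cE (-φ z)) 0 z := by
      intro z hz
      have hz' : ‖z‖ ≤ R := (by simpa using hz : ‖z‖ < R).le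
      have h1 := (hg z).hasDerivAt.mul ((hφ z hz).neg.cexp)
      refine h1.congr_deriv ?_
      have := hne z hz'
      simp only [logDeriv_apply]
      field_simp; ring
    intro z hz
    have hc : (fun z => g z * cE (-φ z)) z = (fun z => g z * cE (-φ z)) 0 := by
      refine IsOpen.is_const_of_deriv_eq_zero Metric.isOpen_ball
        (convex_ball 0 R).isPreconnected (fun w hw => (hder w hw).differentiableAt.differentiableWithinAt)
        (fun w hw => (hder w hw).deriv) hz (by simpa using hR)
    simp only [hφ0, neg_zero, Complex.exp_zero, mul_one] at hc
    rw [← hc, mul_assoc, ← Complex.exp_add]; simp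
  have hφd : DifferentiableOn ℂ φ (Metric.ball 0 R) :=
    fun z hz => (hφ z hz).differentiableAt.differentiableWithinAt
  have hre : MapsTo φ (Metric.ball 0 R) {z | z.re ≤ B} := by
    intro z hz
    have hz' : ‖z‖ ≤ R := (by simpa using hz : ‖z‖ < R).le
    have h1 := hgB z hz'
    rw [hexp z hz, norm_mul, Complex.norm_exp, mul_comm] at h1
    have h2 : 0 < ‖g 0‖ := norm_pos_iff.2 (hne 0 (by simp [hR.le]))
    exact Real.exp_le_exp.1 (le_of_mul_le_mul_right h1 h2)
  have hb1 : ∀ z, ‖z‖ ≤ R / 2 → ‖φ z‖ ≤ 2 * B := by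
    intro z hz
    have h := Complex.borelCaratheodory_zero hB hφd hre hR (z := z) (by simp; linarith) hφ0
    refine h.trans ?_
    rw [div_le_iff₀ (by linarith)]
    nlinarith
  have sub : ∀ {z : ℂ} {r q : ℝ}, ‖z‖ ≤ q → r + q < R → Metric.closedBall z r ⊆ Metric.ball 0 R := by
    intro z r q hz hrq w hw
    have h1 : ‖w - z‖ ≤ r := by simpa [dist_eq_norm] using hw
    have := norm_sub_norm_le w z
    simp; linarith
  have hb2 : ∀ z, ‖z‖ ≤ R / 4 → ‖logDeriv g z‖ ≤ 8 * B / R := by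
    intro z hz
    have hz' : z ∈ Metric.ball (0:ℂ) R := by simp; linarith
    rw [← (hφ z hz').deriv]
    have h := Complex.norm_deriv_le_of_forall_mem_sphere_norm_le (f := φ) (c := z) (R := R / 4)
      (C := 2 * B) (by positivity)
      ((hφd.mono (sub hz (by linarith))).diffContOnCl_ball subset_rfl) (by
        intro w hw
        apply hb1
        have h1 : ‖w - z‖ = R / 4 := by simpa [dist_eq_norm] using hw
        have := norm_sub_norm_le w z
        linarith)
    refine h.trans (le_of_eq ?_)
    field_simp; norm_num
  have hb3 : ∀ z, ‖z‖ ≤ R / 8 → ‖deriv (logDeriv g) z‖ ≤ 64 * B / R ^ 2 := by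
    intro z hz
    have h := Complex.norm_deriv_le_of_forall_mem_sphere_norm_le (f := logDeriv g) (c := z)
      (R := R / 8) (C := 8 * B / R) (by positivity)
      ((hd.mono (sub hz (by linarith))).diffContOnCl_ball subset_rfl) (by
        intro w hw
        apply hb2
        have h1 : ‖w - z‖ = R / 8 := by simpa [dist_eq_norm] using hw
        have := norm_sub_norm_le w z
        linarith)
    refine h.trans (le_of_eq ?_)
    field_simp; norm_num
  refine Convex.norm_image_sub_le_of_norm_deriv_le (s := Metric.closedBall 0 (R/8)) (f := logDeriv g)
    ?_ ?_ (convex_closedBall 0 (R / 8)) (by simpa using ht) (by simpa using hs)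
  · intro z hz
    have : ‖z‖ ≤ R / 8 := by simpa using hz
    exact hd.differentiableAt (Metric.isOpen_ball.mem_nhds (by simp; linarith))
  · intro z hz
    exact hb3 z (by simpa using hz)

/-- growth hypothesis -/
def Gro (f : ℂ → ℂ) (A : ℝ) : Prop := ∀ (j : ℕ) (z : ℂ), ‖z‖ ≤ 4 ^ j → ‖f z‖ ≤ ep (A * 5 ^ j)

lemma order_zero_of_ne {f : ℂ → ℂ} {z : ℂ} (h : f z ≠ 0) : aon f z = 0 := by
  by_contra h'
  exact h (apply_eq_zero_of_analyticOrderNatAt_ne_zero h')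

lemma order_pos_of_zero {f : ℂ → ℂ} (hf : Differentiable ℂ f) (h0 : f 0 = 1) {z : ℂ} (h : f z = 0) :
    1 ≤ aon f z := by
  have h1 := entire_order_ne_top hf (by simp [h0]) z
  have h2 := (hf.analyticAt z).analyticOrderAt_ne_zero.2 h
  rw [Nat.one_le_iff_ne_zero]
  intro h3
  rw [← Nat.cast_analyticOrderNatAt h1, h3] at h2
  simp at h2

lemma H_count {f : ℂ → ℂ} (hf : Differentiable ℂ f) (h0 : f 0 = 1) {A : ℝ} (hG : Gro f A)
    (j : ℕ) (Z : Finset ℂ) (hZ : ∀ ρ ∈ Z, ‖ρ‖ ≤ 4 ^ j) :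
    (∑ ρ ∈ Z, (aon f ρ : ℝ)) ≤ A * 5 ^ (j + 1) := by
  obtain ⟨g, hg, hfg, -⟩ := entire_divide_fin hf (by simp [h0]) Z
  have h := (entire_count h0 (R := 4 ^ j) (M := ep (A * 5 ^ (j + 1))) (by positivity)
    (fun z hz => hG (j + 1) z (by rw [pow_succ]; linarith)) Z hZ hg _ hfg).1
  rw [← Nat.cast_sum]
  set n := ∑ ρ ∈ Z, aon f ρ
  have : ep n ≤ 3 ^ n := by
    have h3 : ep 1 ≤ 3 := by have := Real.exp_one_lt_d9; linarith
    calc ep n = ep 1 ^ n := by rw [← Real.exp_nat_mul, mul_one]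
      _ ≤ _ := by gcongr
  exact Real.exp_le_exp.1 (this.trans h)

lemma H_finite {f : ℂ → ℂ} (hf : Differentiable ℂ f) (h0 : f 0 = 1) {A : ℝ} (hG : Gro f A)
    (R : ℝ) : {ρ : ℂ | f ρ = 0 ∧ ‖ρ‖ ≤ R}.Finite := by
  obtain ⟨j, hj⟩ := pow_unbounded_of_one_lt R (show (1:ℝ) < 4 by norm_num)
  by_contra hinf
  obtain ⟨N, hN⟩ := exists_nat_gt (A * 5 ^ (j + 1))
  obtain ⟨Z, hZ, hcard⟩ := Set.Infinite.exists_subset_card_eq hinf N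
  have h1 := H_count hf h0 hG j Z (fun ρ hρ => (hZ hρ).2.trans hj.le)
  have h2 : (N : ℝ) ≤ ∑ ρ ∈ Z, (aon f ρ : ℝ) := by
    rw [← hcard, Finset.card_eq_sum_ones]
    push_cast
    refine Finset.sum_le_sum fun ρ hρ => ?_
    exact_mod_cast order_pos_of_zero hf h0 (hZ hρ).1
  linarith

lemma H_summable {f : ℂ → ℂ} (hf : Differentiable ℂ f) (h0 : f 0 = 1) {A : ℝ} (hA : 0 ≤ A)
    (hG : Gro f A) :
    Summable fun ρ : ℂ => (aon f ρ : ℝ) * (1 + ‖ρ‖) ^ neA := by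
  set m : ℂ → ℝ := fun ρ => (aon f ρ : ℝ) with hm
  set c : ℝ := (4:ℝ) ^ neA with hc
  have hcpos : 0 < c := by positivity
  have hc5 : 5 * c < 1 := by
    have h4 : (5 * c) ^ 4 < 1 ^ 4 := by
      have e : c ^ 4 = (4:ℝ) ^ (-5 : ℝ) := by
        rw [hc, ← Real.rpow_natCast, ← Real.rpow_mul (by norm_num)]; norm_num
      rw [mul_pow, e, Real.rpow_neg (by norm_num)]
      norm_num
    exact lt_of_pow_lt_pow_left₀ 4 (by norm_num) h4
  have key : ∀ (J : ℕ) (ρ : ℂ), ‖ρ‖ ≤ 4 ^ J → (1 + ‖ρ‖) ^ neA ≤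
      c⁻¹ * ∑ j ∈ Finset.range (J + 1), if ‖ρ‖ ≤ 4 ^ j then c ^ j else 0 := by
    intro J ρ hρ
    have hex : ∃ j, ‖ρ‖ ≤ (4:ℝ) ^ j := ⟨J, hρ⟩
    classical
    set j := Nat.find hex with hj
    have hj1 : ‖ρ‖ ≤ (4:ℝ) ^ j := Nat.find_spec hex
    have hj2 : j ≤ J := Nat.find_min' hex hρ
    have h1 : c ^ j ≤ ∑ j ∈ Finset.range (J + 1), if ‖ρ‖ ≤ 4 ^ j then c ^ j else 0 := by
      have := Finset.single_le_sum (f := fun j => if ‖ρ‖ ≤ (4:ℝ) ^ j then c ^ j else 0)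
        (s := Finset.range (J + 1)) (fun i _ => by positivity) (Finset.mem_range.2 (Nat.lt_succ_of_le hj2))
      simpa [hj1] using this
    refine le_trans ?_ (mul_le_mul_of_nonneg_left h1 (by positivity))
    rcases Nat.eq_zero_or_pos j with hj0 | hj0
    · rw [hj0, pow_zero, mul_one]
      have h2 : (1 + ‖ρ‖) ^ neA ≤ 1 :=
        Real.rpow_le_one_of_one_le_of_nonpos (by linarith [norm_nonneg ρ]) (by norm_num)
      have h3 : 1 ≤ c⁻¹ := by
        rw [one_le_inv₀ hcpos]; linarith
      linarith
    · obtain ⟨i, hi⟩ : ∃ i, j = i + 1 := ⟨j - 1, by omega⟩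
      have h2 : (4:ℝ) ^ i < ‖ρ‖ := by
        have := Nat.find_min hex (m := i) (by omega)
        exact not_le.1 this
      have h3 : c⁻¹ * c ^ j = c ^ i := by
        rw [hi, pow_succ]; field_simp
      rw [h3]
      have h4 : c ^ i = ((4:ℝ) ^ i) ^ neA := by
        rw [hc, ← Real.rpow_natCast, ← Real.rpow_natCast, ← Real.rpow_mul (by norm_num),
          ← Real.rpow_mul (by norm_num)]; ring_nf
      rw [h4]
      exact Real.rpow_le_rpow_of_nonpos (by positivity) (by linarith) (by norm_num)
  refine summable_of_sum_le (c := c⁻¹ * (5 * A * (1 - 5 * c)⁻¹)) (fun ρ => by positivity) ?_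
  intro Z
  obtain ⟨J, hJ⟩ : ∃ J : ℕ, ∀ ρ ∈ Z, ‖ρ‖ ≤ (4:ℝ) ^ J := by
    obtain ⟨J, hJ⟩ := pow_unbounded_of_one_lt (∑ ρ ∈ Z, ‖ρ‖) (show (1:ℝ) < 4 by norm_num)
    exact ⟨J, fun ρ hρ => (Finset.single_le_sum (f := fun ρ : ℂ => ‖ρ‖) (fun _ _ => norm_nonneg _) hρ).trans hJ.le⟩
  calc ∑ ρ ∈ Z, m ρ * (1 + ‖ρ‖) ^ neA
      ≤ ∑ ρ ∈ Z, m ρ * (c⁻¹ * ∑ j ∈ Finset.range (J + 1), if ‖ρ‖ ≤ 4 ^ j then c ^ j else 0) := by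
        refine Finset.sum_le_sum fun ρ hρ => ?_
        exact mul_le_mul_of_nonneg_left (key J ρ (hJ ρ hρ)) (by positivity)
    _ = c⁻¹ * ∑ j ∈ Finset.range (J + 1), c ^ j * ∑ ρ ∈ Z with ‖ρ‖ ≤ (4:ℝ) ^ j, m ρ := by
        simp_rw [Finset.mul_sum]
        rw [Finset.sum_comm]
        refine Finset.sum_congr rfl fun j _ => ?_
        rw [Finset.sum_filter]
        refine Finset.sum_congr rfl fun ρ _ => ?_
        split_ifs <;> ring
    _ ≤ c⁻¹ * ∑ j ∈ Finset.range (J + 1), (5 * A) * (5 * c) ^ j := by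
        refine mul_le_mul_of_nonneg_left (Finset.sum_le_sum fun j hj => ?_) (by positivity)
        have := H_count hf h0 hG j (Z.filter fun ρ => ‖ρ‖ ≤ (4:ℝ) ^ j) (by simp)
        refine (mul_le_mul_of_nonneg_left this (by positivity : 0 ≤ c ^ j)).trans (le_of_eq ?_)
        rw [mul_pow, pow_succ]; ring
    _ ≤ _ := by
        rw [← Finset.mul_sum]
        gcongr
        exact geom_sum_le_inv hcpos hc5
where
  geom_sum_le_inv {c : ℝ} {J : ℕ} (hc : 0 < c) (h : 5 * c < 1) :
      ∑ j ∈ Finset.range (J + 1), (5 * c) ^ j ≤ (1 - 5 * c)⁻¹ := by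
    rw [← tsum_geometric_of_lt_one (by positivity) h]
    exact Summable.sum_le_tsum _ (fun _ _ => by positivity) (summable_geometric_of_lt_one (by positivity) h)

lemma H_term_bound {f : ℂ → ℂ} (hf : Differentiable ℂ f) (h0 : f 0 = 1) {A : ℝ} (hA : 0 ≤ A)
    (hG : Gro f A) (s t : ℂ) :
    Summable fun ρ : ℂ => (aon f ρ : ℂ) * (1 / (s - ρ) - 1 / (t - ρ)) := by
  have hS := (H_summable hf h0 hA hG).mul_left (16 * ‖t - s‖ )
  refine Summable.of_norm_bounded_eventually hS ?_
  set R := 2 * (‖s‖ + ‖t‖) + 1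
  have hfin := H_finite hf h0 hG R
  rw [Filter.eventually_cofinite]
  refine hfin.subset ?_
  intro ρ hρ
  simp only [Set.mem_ofPred_eq, not_le] at hρ
  by_contra hcon
  have hm : f ρ = 0 := by
    by_contra hne
    rw [order_zero_of_ne hne] at hρ; simp at hρ
  have hR : R < ‖ρ‖ := by
    by_contra h; exact hcon ⟨hm, not_lt.1 h⟩
  revert hρ
  rw [imp_false, not_lt]
  have hs : ‖ρ‖ / 2 ≤ ‖s - ρ‖ := by
    have := norm_sub_norm_le ρ s
    rw [norm_sub_rev] at this
    simp only [R] at hR; linarith [norm_nonneg s, norm_nonneg t]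
  have ht : ‖ρ‖ / 2 ≤ ‖t - ρ‖ := by
    have := norm_sub_norm_le ρ t
    rw [norm_sub_rev] at this
    simp only [R] at hR; linarith [norm_nonneg s, norm_nonneg t]
  have hρ1 : 1 ≤ ‖ρ‖ := by simp only [R] at hR; linarith [norm_nonneg s, norm_nonneg t]
  have hsne : s - ρ ≠ 0 := norm_pos_iff.1 (by linarith)
  have htne : t - ρ ≠ 0 := norm_pos_iff.1 (by linarith)
  rw [norm_mul, Complex.norm_natCast]
  have e : 1 / (s - ρ) - 1 / (t - ρ) = (t - s) / ((s - ρ) * (t - ρ)) := by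
    field_simp; ring
  rw [e, norm_div, norm_mul]
  have h1 : ‖t - s‖ / (‖s - ρ‖ * ‖t - ρ‖) ≤ ‖t - s‖ * (16 * (1 + ‖ρ‖) ^ neA) := by
    rw [div_eq_mul_inv]
    gcongr
    calc (‖s - ρ‖ * ‖t - ρ‖)⁻¹ ≤ ((‖ρ‖ / 2) * (‖ρ‖ / 2))⁻¹ := by gcongr
      _ ≤ (((1 + ‖ρ‖) / 4) * ((1 + ‖ρ‖) / 4))⁻¹ := by
          have : (1 + ‖ρ‖) / 4 ≤ ‖ρ‖ / 2 := by linarith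
          gcongr
      _ = 16 * (1 + ‖ρ‖) ^ (-2 : ℝ) := by
          rw [Real.rpow_neg (by positivity)]; norm_num; field_simp; norm_num
      _ ≤ _ := by
          gcongr
          · linarith
          · norm_num
  calc _ ≤ (aon f ρ : ℝ) * (‖t - s‖ * (16 * (1 + ‖ρ‖) ^ neA)) := by gcongr
    _ = _ := by ring

theorem H_main {f : ℂ → ℂ} (hf : Differentiable ℂ f) (h0 : f 0 = 1) {A : ℝ} (hA : 0 < A)
    (hG : Gro f A) {s t : ℂ} (hs : f s ≠ 0) (ht : f t ≠ 0) :
    HasSum (fun ρ : ℂ => (aon f ρ : ℂ) * (1 / (s - ρ) - 1 / (t - ρ)))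
      (logDeriv f s - logDeriv f t) := by
  have hsum := (H_term_bound hf h0 hA.le hG s t).hasSum
  set Z : ℕ → Finset ℂ := fun j => (H_finite hf h0 hG (4 ^ j)).toFinset with hZ
  have hmono : Tendsto (fun j => ∑ ρ ∈ Z j, (aon f ρ : ℂ) * (1 / (s - ρ) - 1 / (t - ρ)))
      atTop (𝓝 (∑' ρ : ℂ, (aon f ρ : ℂ) * (1 / (s - ρ) - 1 / (t - ρ)))) := by
    have hsum' : Tendsto (fun F : Finset ℂ => ∑ ρ ∈ F, (aon f ρ : ℂ) * (1 / (s - ρ) - 1 / (t - ρ)))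
      atTop (𝓝 (∑' ρ : ℂ, (aon f ρ : ℂ) * (1 / (s - ρ) - 1 / (t - ρ)))) := by
      simpa only [HasSum, SummationFilter.unconditional_filter] using hsum
    rw [Metric.tendsto_atTop]
    intro ε hε
    obtain ⟨F, hF⟩ := eventually_atTop.1 (Metric.tendsto_nhds.1 hsum' ε hε)
    obtain ⟨J, hJ⟩ := pow_unbounded_of_one_lt (∑ ρ ∈ F, ‖ρ‖) (show (1:ℝ) < 4 by norm_num)
    refine ⟨J, fun j hj => ?_⟩
    classical
    have := hF (F ∪ Z j) Finset.subset_union_left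
    convert this using 2
    refine Finset.sum_subset Finset.subset_union_right ?_
    intro ρ hρ hρ'
    have : f ρ ≠ 0 := by
      intro hfρ
      apply hρ'
      rcases Finset.mem_union.1 hρ with h | h
      · simp only [hZ, Set.Finite.mem_toFinset, Set.mem_ofPred_eq]
        refine ⟨hfρ, ?_⟩
        calc ‖ρ‖ ≤ ∑ ρ ∈ F, ‖ρ‖ := Finset.single_le_sum (f := fun ρ : ℂ => ‖ρ‖) (fun _ _ => norm_nonneg _) h
          _ ≤ 4 ^ J := hJ.le
          _ ≤ 4 ^ j := pow_le_pow_right₀ (by norm_num) hj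
      · exact h
    simp [order_zero_of_ne this]
  have hlim : Tendsto (fun j => ∑ ρ ∈ Z j, (aon f ρ : ℂ) * (1 / (s - ρ) - 1 / (t - ρ)))
      atTop (𝓝 (logDeriv f s - logDeriv f t)) := by
    rw [tendsto_iff_norm_sub_tendsto_zero]
    have hz : Tendsto (fun j : ℕ => 320 * A * ‖s - t‖ * (5 / 16 : ℝ) ^ j) atTop (𝓝 0) := by
      have := (tendsto_pow_atTop_nhds_zero_of_lt_one (r := (5/16:ℝ)) (by norm_num) (by norm_num)).const_mul
        (320 * A * ‖s - t‖)
      simpa using this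
    refine squeeze_zero' (Eventually.of_forall fun _ => norm_nonneg _) ?_ hz
    obtain ⟨J, hJ⟩ := pow_unbounded_of_one_lt (8 * (‖s‖ + ‖t‖)) (show (1:ℝ) < 4 by norm_num)
    filter_upwards [eventually_ge_atTop J] with j hj
    have hj' : 8 * (‖s‖ + ‖t‖) ≤ 4 ^ j := hJ.le.trans (pow_le_pow_right₀ (by norm_num) hj)
    obtain ⟨g, hg, hfg, hgZ⟩ := entire_divide_fin hf (by simp [h0]) (Z j)
    have hb := (entire_count h0 (R := 4 ^ j) (M := ep (A * 5 ^ (j + 1))) (by positivity)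
      (fun z hz => hG (j + 1) z (by rw [pow_succ]; linarith)) (Z j) (by simp [hZ]) hg _ hfg).2
    have hne : ∀ z, ‖z‖ ≤ (4:ℝ) ^ j → g z ≠ 0 := by
      intro z hz hgz
      have hfz : f z = 0 := by rw [hfg z, hgz, mul_zero]
      exact hgZ z (by simp [hZ, hfz, hz]) hgz
    have hcl := logDeriv_close hg (R := 4 ^ j) (B := A * 5 ^ (j + 1)) (s := s) (t := t) (by positivity)
      (by positivity) hne (fun z hz => hb z (by linarith [norm_nonneg z]))
      (by linarith [norm_nonneg s, norm_nonneg t]) (by linarith [norm_nonneg s, norm_nonneg t])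
    have hld : ∀ z, f z ≠ 0 → logDeriv f z =
        ∑ ρ ∈ Z j, (aon f ρ : ℂ) * (1 / (z - ρ)) + logDeriv g z := by
      intro z hz
      have hgz : g z ≠ 0 := by intro h; apply hz; rw [hfg z, h, mul_zero]
      have hPz : ∏ ρ ∈ Z j, (z - ρ) ^ (aon f ρ) ≠ 0 := by
        intro h; apply hz; rw [hfg z, h, zero_mul]
      have hfe : f = fun z => (∏ ρ ∈ Z j, (z - ρ) ^ (aon f ρ)) * g z := funext hfg
      have hPd : DifferentiableAt ℂ (fun z => ∏ ρ ∈ Z j, (z - ρ) ^ (aon f ρ)) z := by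
        fun_prop
      have h1 := logDeriv_mul (f := fun z => ∏ ρ ∈ Z j, (z - ρ) ^ (aon f ρ)) z hPz hgz
        hPd (hg z)
      rw [← hfe] at h1
      rw [h1]
      congr 1
      rw [logDeriv_prod (fun ρ hρ => Finset.prod_ne_zero_iff.1 hPz ρ hρ) (fun ρ _ => by fun_prop)]
      refine Finset.sum_congr rfl fun ρ hρ => ?_
      rw [logDeriv_fun_pow (by fun_prop)]
      simp [logDeriv_apply]
    rw [hld s hs, hld t ht]
    simp_rw [mul_sub, Finset.sum_sub_distrib]
    calc _ = ‖logDeriv g s - logDeriv g t‖ := by rw [← norm_neg]; congr 1; ring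
      _ ≤ _ := hcl
      _ = _ := by
        have e : ((4:ℝ) ^ j) ^ 2 = 16 ^ j := by rw [← pow_mul, mul_comm, pow_mul]; norm_num
        rw [e, div_pow, pow_succ]; ring
  rwa [tendsto_nhds_unique hmono hlim] at hsum

/-- the entire function `s(s-1)Λ(s)` -/
noncomputable def XX (s : ℂ) : ℂ := s * (s - 1) * completedRiemannZeta₀ s + 1

lemma XX_diff : Differentiable ℂ XX := by
  unfold XX
  have := differentiable_completedZeta₀
  fun_prop

lemma XX_one_sub (s : ℂ) : XX (1 - s) = XX s := by
  unfold XX; rw [completedRiemannZeta₀_one_sub]; ring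

lemma XX_zero : XX 0 = 1 := by simp [XX]

lemma XX_one : XX 1 = 1 := by simp [XX]

lemma XX_eq {s : ℂ} (h0 : s ≠ 0) (h1 : s ≠ 1) : XX s = s * (s - 1) * completedRiemannZeta s := by
  have : 1 - s ≠ 0 := sub_ne_zero.2 h1.symm
  rw [completedRiemannZeta_eq, XX]; field_simp; ring

lemma XX_eq_zeta {s : ℂ} (h0 : 0 < s.re) (h1 : s ≠ 1) :
    XX s = s * (s - 1) * (Complex.Gammaℝ s * riemannZeta s) := by
  have hs : s ≠ 0 := by rintro rfl; simp at h0
  rw [XX_eq hs h1, riemannZeta_def_of_ne_zero hs]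
  have := Complex.Gammaℝ_ne_zero_of_re_pos h0
  field_simp

lemma XX_ne_zero_of_one_le {s : ℂ} (h : 1 ≤ s.re) : XX s ≠ 0 := by
  by_cases h1 : s = 1
  · simp [h1, XX_one]
  · have hs : s ≠ 0 := by rintro rfl; simp at h; linarith
    rw [XX_eq_zeta (by linarith) h1]
    have h2 := Complex.Gammaℝ_ne_zero_of_re_pos (s := s) (by linarith)
    have h3 := riemannZeta_ne_zero_of_one_le_re h
    have := sub_ne_zero.2 h1
    positivity

lemma XX_zero_iff (s : ℂ) : XX s = 0 ↔ IsNontrivialZero s := by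
  constructor
  · intro h
    have h1 : s.re < 1 := by
      by_contra h'; exact XX_ne_zero_of_one_le (not_lt.1 h') h
    have h2 : 0 < s.re := by
      by_contra h'
      refine XX_ne_zero_of_one_le (s := 1 - s) ?_ (by rw [XX_one_sub, h])
      simp; linarith
    have hs1 : s ≠ 1 := by rintro rfl; simp at h1
    have hs0 : s ≠ 0 := by rintro rfl; simp at h2
    rw [XX_eq_zeta h2 hs1] at h
    have h3 := Complex.Gammaℝ_ne_zero_of_re_pos h2
    have := sub_ne_zero.2 hs1
    refine ⟨by simpa [hs0, this, h3] using h, h2, h1⟩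
  · rintro ⟨h, h2, h1⟩
    have hs1 : s ≠ 1 := by rintro rfl; simp at h1
    rw [XX_eq_zeta h2 hs1, h]; simp

lemma Gammaℝ_conj (s : ℂ) : Complex.Gammaℝ (starRingEnd ℂ s) = starRingEnd ℂ (Complex.Gammaℝ s) := by
  rw [Complex.Gammaℝ_def, Complex.Gammaℝ_def, map_mul, ← Complex.Gamma_conj]
  congr 1
  · have := Complex.cpow_conj (pI : ℂ) (-s/2) (by rw [Complex.arg_ofReal_of_nonneg Real.pi_pos.le]; exact Real.pi_pos.ne)
    rw [Complex.conj_ofReal] at this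
    rw [← this]; simp [map_ofNat]
  · simp [map_ofNat]

lemma XX_conj {s : ℂ} (h0 : 0 < s.re) : XX (starRingEnd ℂ s) = starRingEnd ℂ (XX s) := by
  by_cases h1 : s = 1
  · simp [h1, XX_one]
  have h1' : starRingEnd ℂ s ≠ 1 := by
    intro h; apply h1; have := congrArg (starRingEnd ℂ) h; simpa using this
  rw [XX_eq_zeta h0 h1, XX_eq_zeta (by simpa using h0) h1', Gammaℝ_conj, riemannZeta_conj]
  simp

lemma XX_reflect {ρ : ℂ} (h : XX ρ = 0) : XX (1 - starRingEnd ℂ ρ) = 0 := by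
  rw [XX_one_sub, XX_conj ((XX_zero_iff ρ).1 h).2.1, h, map_zero]

lemma zetaMult_one_of_order {ρ : ℂ} (h : XX ρ = 0) (hm : aon XX ρ = 1) :
    zetaMult ρ = 1 := by
  obtain ⟨hz, h2, h1⟩ := (XX_zero_iff ρ).1 h
  have hs1 : ρ ≠ 1 := by rintro rfl; simp at h1
  have hd : deriv riemannZeta ρ ≠ 0 := by
    intro hd
    obtain ⟨g, hg, hXg, hgρ⟩ := entire_divide XX_diff (by simp [XX_zero]) ρ
    rw [hm] at hXg
    have hX' : HasDerivAt XX (g ρ) ρ := by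
      have : XX = fun z => (z - ρ) ^ 1 * g z := funext hXg
      rw [this]
      have h3 := (((hasDerivAt_id ρ).sub_const ρ).pow 1).mul (hg ρ).hasDerivAt
      refine (h3.congr_deriv (by simp)).congr_of_eventuallyEq (Eventually.of_forall fun z => by simp)
    have hloc : XX =ᶠ[𝓝 ρ] fun s => (s * (s - 1) * Complex.Gammaℝ s) * riemannZeta s := by
      filter_upwards [(isOpen_lt continuous_const Complex.continuous_re).mem_nhds h2,
        isOpen_ne.mem_nhds hs1] with s hs hs'
      rw [XX_eq_zeta hs hs']; ring
    have hG : DifferentiableAt ℂ (fun s => s * (s - 1) * Complex.Gammaℝ s) ρ := by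
      have : DifferentiableAt ℂ Complex.Gammaℝ ρ := by
        unfold Complex.Gammaℝ
        refine DifferentiableAt.mul ?_ ?_
        · have : (pI : ℂ) ≠ 0 := by exact_mod_cast Real.pi_ne_zero
          exact DifferentiableAt.const_cpow (by fun_prop) (Or.inl this)
        · refine DifferentiableAt.comp ρ (Complex.differentiableAt_Gamma _ ?_) (by fun_prop)
          intro m hm
          have := congrArg Complex.re hm
          have e : (ρ / 2).re = ρ.re / 2 := by simp
          rw [e] at this
          simp at this
          have : (0:ℝ) ≤ m := by positivity
          linarith
      fun_prop
    have hX'' := (hG.hasDerivAt.mul (differentiableAt_riemannZeta hs1).hasDerivAt).congr_of_eventuallyEq hloc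
    rw [hd, hz] at hX''
    apply hgρ
    rw [hX'.unique hX'']; ring
  unfold zetaMult
  apply le_antisymm
  · apply Nat.sInf_le; simpa [iteratedDeriv_one] using hd
  · apply le_csInf ⟨1, by simpa [iteratedDeriv_one] using hd⟩
    intro n hn
    rw [Nat.one_le_iff_ne_zero]; rintro rfl
    simp [hz] at hn

/-- Gamma bound -/
lemma norm_Gamma_le {s : ℂ} (h : 0 < s.re) : ‖Gm s‖ ≤ Real.Gamma s.re := by
  rw [Complex.Gamma_eq_integral h, Real.Gamma_eq_integral h, Complex.GammaIntegral]
  refine (norm_integral_le_integral_norm _).trans (le_of_eq ?_)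
  refine setIntegral_congr_fun measurableSet_Ioi fun x hx => ?_
  have hx' : 0 < x := hx
  simp only [norm_mul]
  rw [Complex.norm_cpow_eq_rpow_re_of_pos hx', Complex.norm_real, Real.norm_of_nonneg (Real.exp_pos _).le]
  simp

/-- strip bound -/
lemma mellin_strip {g : ℝ → ℂ} (h : ∀ s : ℂ, MellinConvergent g s) (a b : ℝ) :
    ∃ C, ∀ s : ℂ, a ≤ s.re → s.re ≤ b → ‖mellin g s‖ ≤ C := by
  have hI : ∀ c : ℝ, IntegrableOn (fun t : ℝ => t ^ (c - 1) * ‖g t‖) (Ioi 0) := by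
    intro c
    have h1 := (h (c : ℂ)).norm
    refine IntegrableOn.congr_fun h1 (fun x hx => ?_) measurableSet_Ioi
    have hx' : 0 < x := hx
    simp only [norm_smul]
    rw [Complex.norm_cpow_eq_rpow_re_of_pos hx']; simp
  refine ⟨∫ t in Ioi 0, (t ^ (a - 1) * ‖g t‖ + t ^ (b - 1) * ‖g t‖), fun s ha hb => ?_⟩
  unfold mellin
  refine (norm_integral_le_integral_norm _).trans ?_
  refine setIntegral_mono_on (h s).norm ((hI a).add (hI b)) measurableSet_Ioi fun x hx => ?_
  have hx' : 0 < x := hx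
  rw [norm_smul, Complex.norm_cpow_eq_rpow_re_of_pos hx', ← add_mul]
  gcongr
  simp only [Complex.sub_re, Complex.one_re]
  rcases le_total x 1 with h1 | h1
  · have := Real.rpow_le_rpow_of_exponent_ge hx' h1 (show a - 1 ≤ s.re - 1 by linarith)
    have := Real.rpow_nonneg hx'.le (b - 1)
    linarith
  · have := Real.rpow_le_rpow_of_exponent_le h1 (show s.re - 1 ≤ b - 1 by linarith)
    have := Real.rpow_nonneg hx'.le (a - 1)
    linarith

lemma Lambda0_strip (a b : ℝ) :
    ∃ C, ∀ s : ℂ, a ≤ s.re → s.re ≤ b → ‖completedRiemannZeta₀ s‖ ≤ C := by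
  obtain ⟨C, hC⟩ := mellin_strip (g := (HurwitzZeta.hurwitzEvenFEPair 0).f_modif)
    (fun s => ((HurwitzZeta.hurwitzEvenFEPair 0).isStrongFEPair_toStrongFEPair.hasMellin s).1) (a/2) (b/2)
  refine ⟨C / 2, fun s ha hb => ?_⟩
  have : completedRiemannZeta₀ s = mellin (HurwitzZeta.hurwitzEvenFEPair 0).f_modif (s / 2) / 2 := rfl
  rw [this, norm_div]
  have e : (s / 2).re = s.re / 2 := by simp
  have := hC (s / 2) (by rw [e]; linarith) (by rw [e]; linarith)
  simp only [Complex.norm_ofNat]; linarith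

lemma zeta_bound {s : ℂ} (h : 2 ≤ s.re) : ‖riemannZeta s‖ ≤ ∑' n : ℕ, 1 / (n : ℝ) ^ 2 := by
  rw [zeta_eq_tsum_one_div_nat_cpow (by linarith)]
  have hs : Summable fun n : ℕ => 1 / (n : ℝ) ^ 2 := Real.summable_one_div_nat_pow.2 (by norm_num)
  refine tsum_of_norm_bounded hs.hasSum fun n => ?_
  rcases Nat.eq_zero_or_pos n with rfl | hn
  · have : s ≠ 0 := by rintro rfl; simp at h; linarith
    simp [this]
  · rw [norm_div, norm_one, Complex.norm_natCast_cpow_of_pos hn, ← Real.rpow_natCast]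
    gcongr
    · exact_mod_cast hn
    · exact_mod_cast h

lemma XX_right_bound : ∃ K, ∀ (j : ℕ) (w : ℂ), 5 ≤ w.re → ‖w‖ ≤ 4 ^ j + 1 →
    ‖XX w‖ ≤ K * ((4:ℝ) ^ j + 2) ^ 2 * (4 ^ j).factorial := by
  refine ⟨∑' n : ℕ, 1 / (n : ℝ) ^ 2, fun j w hw hn => ?_⟩
  have h1 : w ≠ 1 := by rintro rfl; norm_num at hw
  rw [XX_eq_zeta (by linarith) h1, norm_mul, norm_mul, norm_mul]
  have e : (w / 2).re = w.re / 2 := by simp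
  have hre : w.re ≤ 4 ^ j + 1 := (Complex.re_le_norm w).trans hn
  have h4 : (1:ℝ) ≤ 4 ^ j := one_le_pow₀ (by norm_num)
  have hG : ‖Complex.Gammaℝ w‖ ≤ (4 ^ j).factorial := by
    rw [Complex.Gammaℝ_def, norm_mul, Complex.norm_cpow_eq_rpow_re_of_pos Real.pi_pos]
    have h2 : pI ^ (-w / 2).re ≤ 1 := by
      apply Real.rpow_le_one_of_one_le_of_nonpos
      · linarith [Real.pi_gt_three]
      · have : (-w / 2).re = - w.re / 2 := by simp
        rw [this]; linarith
    have h3 : ‖Gm (w / 2)‖ ≤ (4 ^ j).factorial := by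
      refine (norm_Gamma_le (by rw [e]; linarith)).trans ?_
      rw [e, ← Real.Gamma_nat_eq_factorial]
      apply Real.Gamma_strictMonoOn_Ici.monotoneOn
      · simp; linarith
      · simp only [Set.mem_Ici]; push_cast; linarith
      · push_cast; linarith
    refine (mul_le_mul h2 h3 (norm_nonneg _) zero_le_one).trans (le_of_eq (one_mul _))
  have hz := zeta_bound (s := w) (by linarith)
  have hw1 : ‖w - 1‖ ≤ 4 ^ j + 2 := (norm_sub_le _ _).trans (by simp; linarith)
  have hw0 : ‖w‖ ≤ 4 ^ j + 2 := by linarith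
  calc _ ≤ ((4:ℝ) ^ j + 2) * (4 ^ j + 2) * ((4 ^ j).factorial * ∑' n : ℕ, 1 / (n : ℝ) ^ 2) := by gcongr
    _ = _ := by ring

lemma XX_Gro : ∃ A, 0 < A ∧ Gro XX A := by
  obtain ⟨K, hK⟩ := XX_right_bound
  obtain ⟨C, hC⟩ := Lambda0_strip (-4) 5
  set D := |K| + |C| + 1 with hD
  have hD0 : 0 < D := by positivity
  refine ⟨9 * D + 3 + 8, by positivity, fun j z hz => ?_⟩
  have h4 : (1:ℝ) ≤ 4 ^ j := one_le_pow₀ (by norm_num)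
  have hfac : (1:ℝ) ≤ (4 ^ j).factorial := by exact_mod_cast Nat.one_le_iff_ne_zero.2 (Nat.factorial_ne_zero _)
  have main : ‖XX z‖ ≤ D * ((4:ℝ) ^ j + 2) ^ 2 * (4 ^ j).factorial := by
    have hKD : ∀ w : ℂ, 5 ≤ w.re → ‖w‖ ≤ 4 ^ j + 1 →
        ‖XX w‖ ≤ D * ((4:ℝ) ^ j + 2) ^ 2 * (4 ^ j).factorial := by
      intro w h1 h2
      refine (hK j w h1 h2).trans ?_
      have : K ≤ D := by rw [hD]; linarith [le_abs_self K, abs_nonneg C]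
      gcongr
    by_cases h5 : 5 ≤ z.re
    · exact hKD z h5 (by linarith)
    by_cases h6 : z.re < -4
    · rw [← XX_one_sub]
      refine hKD _ (by simp; linarith) ((norm_sub_le _ _).trans ?_)
      simp; linarith
    · have h7 := hC z (not_lt.1 h6) (not_le.1 h5).le
      unfold XX
      have h8 : ‖z - 1‖ ≤ 4 ^ j + 2 := (norm_sub_le _ _).trans (by simp; linarith)
      have h9 : ‖z‖ ≤ 4 ^ j + 2 := by linarith
      have h7' : ‖completedRiemannZeta₀ z‖ ≤ |C| := h7.trans (le_abs_self C)
      calc ‖z * (z - 1) * completedRiemannZeta₀ z + 1‖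
          ≤ ‖z‖ * ‖z - 1‖ * ‖completedRiemannZeta₀ z‖ + 1 := by
            refine (norm_add_le _ _).trans ?_
            simp [norm_mul]
        _ ≤ (4 ^ j + 2) * (4 ^ j + 2) * |C| + 1 := by gcongr
        _ ≤ D * ((4:ℝ) ^ j + 2) ^ 2 * 1 := by
            rw [hD]
            nlinarith [abs_nonneg K, abs_nonneg C, mul_nonneg (abs_nonneg K) (sq_nonneg ((4:ℝ)^j+2))]
        _ ≤ _ := by gcongr
  refine main.trans ?_
  have h5 : (1:ℝ) ≤ 5 ^ j := one_le_pow₀ (by norm_num)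
  have hj : (j:ℝ) * 4 ^ j ≤ 4 * 5 ^ j := by
    have := one_add_mul_le_pow (show (-2:ℝ) ≤ 1/4 by norm_num) j
    have e : (5:ℝ) ^ j = (1 + 1/4) ^ j * 4 ^ j := by rw [← mul_pow]; norm_num
    rw [e]
    nlinarith
  have hj' : (j:ℝ) ≤ 5 ^ j := by
    exact_mod_cast (Nat.lt_pow_self (show 1 < 5 by norm_num)).le
  have b1 : 9 * D ≤ ep (9 * D * 5 ^ j) := by
    have := Real.add_one_le_exp (9 * D * 5 ^ j)
    nlinarith
  have hl4 : lg 4 ≤ 3 / 2 := by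
    rw [show (4:ℝ) = 2 ^ 2 by norm_num, Real.log_pow]
    have := Real.log_two_lt_d9
    push_cast; linarith
  have b2 : ((4:ℝ) ^ j) ^ 2 ≤ ep (3 * 5 ^ j) := by
    rw [← Real.exp_log (show (0:ℝ) < (4 ^ j) ^ 2 by positivity), Real.log_pow, Real.log_pow]
    apply Real.exp_le_exp.2
    push_cast
    nlinarith [Real.log_nonneg (show (1:ℝ) ≤ 4 by norm_num)]
  have b3 : ((4 ^ j).factorial : ℝ) ≤ ep (8 * 5 ^ j) := by
    calc ((4 ^ j).factorial : ℝ) ≤ ((4:ℝ) ^ j) ^ (4 ^ j : ℕ) := by exact_mod_cast Nat.factorial_le_pow (4 ^ j)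
      _ = ep (4 ^ j * (j * lg 4)) := by
        rw [← Real.log_pow, mul_comm, ← Real.rpow_def_of_pos (by positivity), ← Real.rpow_natCast]
        push_cast; rfl
      _ ≤ _ := by
        apply Real.exp_le_exp.2
        nlinarith [mul_nonneg (Nat.cast_nonneg (α := ℝ) j) (pow_nonneg (show (0:ℝ) ≤ 4 by norm_num) j)]
  calc D * ((4:ℝ) ^ j + 2) ^ 2 * (4 ^ j).factorial ≤ D * (3 * (4:ℝ) ^ j) ^ 2 * (4 ^ j).factorial := by
        gcongr; linarith
    _ = (9 * D) * ((4:ℝ) ^ j) ^ 2 * (4 ^ j).factorial := by ring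
    _ ≤ ep (9 * D * 5 ^ j) * ep (3 * 5 ^ j) * ep (8 * 5 ^ j) := by gcongr
    _ = _ := by rw [← Real.exp_add, ← Real.exp_add]; ring_nf

lemma norm_GammaSeq_le {s : ℂ} (hs : 0 < s.re) {n : ℕ} (hn : n ≠ 0) :
    ‖Complex.GammaSeq s n‖ ≤ Real.Gamma s.re := by
  rw [Complex.GammaSeq_eq_approx_Gamma_integral hs hn, Real.Gamma_eq_integral hs,
    intervalIntegral.integral_of_le (by positivity)]
  refine (norm_integral_le_integral_norm _).trans ?_
  have hI := Real.GammaIntegral_convergent hs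
  calc _ ≤ ∫ x in Ioc 0 (n:ℝ), ep (-x) * x ^ (s.re - 1) := by
        refine integral_mono_of_nonneg (Eventually.of_forall fun _ => norm_nonneg _)
          (hI.mono_set Ioc_subset_Ioi_self) ?_
        rw [EventuallyLE, ae_restrict_iff' measurableSet_Ioc]
        refine Eventually.of_forall fun x hx => ?_
        rw [norm_mul, Complex.norm_cpow_eq_rpow_re_of_pos hx.1, Complex.norm_real]
        have h1 : 0 ≤ 1 - x / n := by
          rw [sub_nonneg, div_le_one (by positivity)]; exact hx.2
        rw [Real.norm_of_nonneg (by positivity)]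
        simp only [Complex.sub_re, Complex.one_re]
        gcongr
        · exact Real.rpow_nonneg hx.1.le _
        · exact Real.one_sub_div_pow_le_exp_neg hx.2
    _ ≤ _ := by
        refine setIntegral_mono_set hI ?_ (Eventually.of_forall Ioc_subset_Ioi_self)
        rw [EventuallyLE, ae_restrict_iff' measurableSet_Ioi]
        refine Eventually.of_forall fun x hx => ?_
        have : 0 < x := hx
        simp only [Pi.zero_apply]; positivity

lemma GammaSeq_diffAt {s : ℂ} (hs : 0 < s.re) {n : ℕ} (hn : n ≠ 0) :
    DifferentiableAt ℂ (fun z => Complex.GammaSeq z n) s := by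
  unfold Complex.GammaSeq
  have h1 : (n : ℂ) ≠ 0 := by exact_mod_cast hn
  have h2 : ∏ j ∈ Finset.range (n + 1), (s + (j:ℂ)) ≠ 0 := by
    rw [Finset.prod_ne_zero_iff]
    intro j _ h
    have := congrArg Complex.re h
    simp at this
    have : (0:ℝ) ≤ j := by positivity
    linarith
  refine DifferentiableAt.div ?_ (by fun_prop) h2
  exact (DifferentiableAt.const_cpow differentiableAt_id (Or.inl h1)).mul_const _

lemma GammaSeq_logDeriv {s : ℂ} (hs : 0 < s.re) {n : ℕ} (hn : n ≠ 0) :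
    logDeriv (fun z => Complex.GammaSeq z n) s =
      Complex.log n - ∑ j ∈ Finset.range (n + 1), 1 / (s + j) := by
  have h1 : (n : ℂ) ≠ 0 := by exact_mod_cast hn
  have hj : ∀ j ∈ Finset.range (n+1), s + (j:ℂ) ≠ 0 := by
    intro j _ h
    have := congrArg Complex.re h
    simp at this
    have : (0:ℝ) ≤ j := by positivity
    linarith
  have h2 : ∏ j ∈ Finset.range (n + 1), (s + (j:ℂ)) ≠ 0 := Finset.prod_ne_zero_iff.2 hj
  have h3 : (n:ℂ) ^ s ≠ 0 := by simp [Complex.cpow_eq_zero_iff, h1]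
  have hf : (n.factorial : ℂ) ≠ 0 := by exact_mod_cast Nat.factorial_ne_zero n
  have hd : DifferentiableAt ℂ (fun z : ℂ => (n:ℂ) ^ z) s :=
    DifferentiableAt.const_cpow differentiableAt_id (Or.inl h1)
  unfold Complex.GammaSeq
  rw [logDeriv_div (f := fun z : ℂ => (n:ℂ) ^ z * n.factorial)
    (g := fun z : ℂ => ∏ j ∈ Finset.range (n + 1), (z + (j:ℂ))) s (mul_ne_zero h3 hf) h2
    (hd.mul_const _) (by fun_prop), logDeriv_mul_const _ _ hf, logDeriv_prod hj (fun _ _ => by fun_prop)]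
  congr 1
  · have h4 := (HasDerivAt.const_cpow (c := (n:ℂ)) (hasDerivAt_id s) (Or.inl h1)).deriv
    simp only [id] at h4
    rw [logDeriv_apply]
    change deriv (fun z : ℂ => (n:ℂ) ^ z) s / (n:ℂ) ^ s = _
    rw [h4]
    field_simp
  · refine Finset.sum_congr rfl fun j _ => ?_
    simp [logDeriv_apply]

lemma deriv_GammaSeq_tendsto {s : ℂ} (hs : 0 < s.re) :
    Tendsto (fun n => deriv (fun z => Complex.GammaSeq z n) s) atTop (𝓝 (deriv Gm s)) := by
  set r := s.re / 2 with hr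
  have hr0 : 0 < r := by positivity
  have hU : IsOpen {z : ℂ | 0 < z.re} := isOpen_lt continuous_const Complex.continuous_re
  have hsub : ∀ z ∈ Metric.closedBall s r, r ≤ z.re ∧ z.re ≤ 3 * r := by
    intro z hz
    have h1 : ‖z - s‖ ≤ r := by simpa [dist_eq_norm] using hz
    have h2 := (abs_le.1 ((Complex.abs_re_le_norm (z - s)).trans h1))
    simp only [Complex.sub_re] at h2
    constructor <;> linarith [h2.1, h2.2]
  have hsub' : Metric.closedBall s r ⊆ {z : ℂ | 0 < z.re} := fun z hz => by
    have := hsub z hz; simp only [Set.mem_ofPred_eq]; linarith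
  obtain ⟨C, hC⟩ : ∃ C, ∀ x ∈ Icc r (3 * r), Real.Gamma x ≤ C := by
    have hc : ContinuousOn Real.Gamma (Icc r (3 * r)) := by
      intro x hx
      refine (Real.differentiableAt_Gamma fun m => ?_).continuousAt.continuousWithinAt
      have : (0:ℝ) ≤ m := by positivity
      have := hx.1
      linarith
    obtain ⟨C, hC⟩ := isCompact_Icc.bddAbove_image hc
    exact ⟨C, fun x hx => hC (mem_image_of_mem _ hx)⟩
  have hG : DifferentiableOn ℂ Gm {z : ℂ | 0 < z.re} := by
    intro z hz
    refine (Complex.differentiableAt_Gamma z fun m h => ?_).differentiableWithinAt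
    have h1 : 0 < z.re := hz
    rw [h] at h1; simp at h1
    have : (0:ℝ) ≤ m := by positivity
    linarith
  have e0 := Complex.two_pi_I_inv_smul_circleIntegral_sub_sq_inv_smul_of_differentiable hU hsub' hG
    (Metric.mem_ball_self hr0)
  rw [← e0]
  have en : ∀ᶠ n : ℕ in atTop, ((2 * pI * cI : ℂ)⁻¹ •
      ∮ z in C(s, r), ((z - s) ^ 2)⁻¹ • Complex.GammaSeq z n) = deriv (fun z => Complex.GammaSeq z n) s := by
    filter_upwards [eventually_ne_atTop 0] with n hn
    exact Complex.two_pi_I_inv_smul_circleIntegral_sub_sq_inv_smul_of_differentiable hU hsub'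
      (fun z hz => (GammaSeq_diffAt hz hn).differentiableWithinAt) (Metric.mem_ball_self hr0)
  refine Tendsto.congr' en (Tendsto.const_smul ?_ _)
  unfold circleIntegral
  have hcirc : ∀ θ : ℝ, circleMap s r θ ∈ Metric.closedBall s r :=
    fun θ => circleMap_mem_closedBall s hr0.le θ
  have hne : ∀ θ : ℝ, circleMap s r θ - s ≠ 0 := fun θ => sub_ne_zero.2 (circleMap_ne_center hr0.ne')
  refine intervalIntegral.tendsto_integral_filter_of_dominated_convergence
    (fun _ => r * ((r ^ 2)⁻¹ * C)) ?_ ?_ ?_ ?_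
  · filter_upwards [eventually_ne_atTop 0] with n hn
    refine Continuous.aestronglyMeasurable ?_
    have c1 : Continuous fun θ : ℝ => Complex.GammaSeq (circleMap s r θ) n := by
      rw [continuous_iff_continuousAt]
      intro θ
      exact ContinuousAt.comp (f := circleMap s r) (g := fun z => Complex.GammaSeq z n)
        (GammaSeq_diffAt (hsub' (hcirc θ)) hn).continuousAt (continuous_circleMap s r).continuousAt
    simp only [deriv_circleMap]
    have c2 : Continuous fun θ : ℝ => circleMap 0 r θ * cI :=
      (continuous_circleMap 0 r).mul continuous_const
    have c3 : Continuous fun θ : ℝ => ((circleMap s r θ - s) ^ 2)⁻¹ :=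
      Continuous.inv₀ (((continuous_circleMap s r).sub continuous_const).pow 2)
        (fun θ => pow_ne_zero _ (hne θ))
    exact c2.smul (c3.smul c1)
  · filter_upwards [eventually_ne_atTop 0] with n hn
    refine Eventually.of_forall fun θ _ => ?_
    rw [norm_smul, norm_smul, norm_inv, norm_pow, deriv_circleMap]
    have h1 : ‖circleMap s r θ - s‖ = r := by simp [circleMap, abs_of_pos hr0]
    have h2 : ‖circleMap 0 r θ * cI‖ = r := by simp [abs_of_pos hr0]
    rw [h1, h2]
    have h3 := hsub _ (hcirc θ)
    gcongr
    exact (norm_GammaSeq_le (hsub' (hcirc θ)) hn).trans (hC _ ⟨h3.1, h3.2⟩)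
  · exact intervalIntegrable_const
  · refine Eventually.of_forall fun θ _ => ?_
    exact ((Complex.GammaSeq_tendsto_Gamma _).const_smul _).const_smul _

lemma digamma_tendsto {s : ℂ} (hs : 0 < s.re) :
    Tendsto (fun n : ℕ => Complex.log n - ∑ j ∈ Finset.range (n + 1), 1 / (s + j)) atTop
      (𝓝 (logDeriv Gm s)) := by
  have h := (deriv_GammaSeq_tendsto hs).div (Complex.GammaSeq_tendsto_Gamma s)
    (Complex.Gamma_ne_zero_of_re_pos hs)
  refine h.congr' ?_
  filter_upwards [eventually_ne_atTop 0] with n hn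
  rw [← GammaSeq_logDeriv hs hn]; rfl

noncomputable def mm (ρ : ℂ) : ℝ := (aon XX ρ : ℝ)
noncomputable def pp (d x : ℝ) : ℝ := d / (d ^ 2 + x ^ 2)
noncomputable def kap (ρ : ℂ) (t : ℝ) : ℝ :=
  (pp (5/4 - ρ.re) (t - ρ.im) + pp (1/4 + ρ.re) (t - ρ.im)) / 2

lemma mm_nonneg (ρ : ℂ) : 0 ≤ mm ρ := by unfold mm; positivity

lemma mm_zero {ρ : ℂ} (h : XX ρ ≠ 0) : mm ρ = 0 := by
  unfold mm; rw [order_zero_of_ne h]; simp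

lemma mm_pos_re {ρ : ℂ} (h : mm ρ ≠ 0) : XX ρ = 0 ∧ 0 < ρ.re ∧ ρ.re < 1 := by
  have h1 : XX ρ = 0 := by by_contra h2; exact h (mm_zero h2)
  exact ⟨h1, ((XX_zero_iff ρ).1 h1).2⟩

lemma logDeriv_XX_one_sub (w : ℂ) : logDeriv XX (1 - w) = - logDeriv XX w := by
  have h1 : HasDerivAt (fun z => XX (1 - z)) (deriv XX (1 - w) * (-1)) w := by
    have h2 : HasDerivAt (fun z : ℂ => 1 - z) (-1) w := by
      simpa using (hasDerivAt_id w).const_sub 1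
    exact (XX_diff (1 - w)).hasDerivAt.comp w h2
  have h3 : (fun z => XX (1 - z)) = XX := funext XX_one_sub
  rw [h3] at h1
  rw [logDeriv_apply, logDeriv_apply, XX_one_sub, h1.deriv]
  ring

lemma logDeriv_XX_conj {w : ℂ} (h : 0 < w.re) :
    logDeriv XX (starRingEnd ℂ w) = starRingEnd ℂ (logDeriv XX w) := by
  have h1 := (XX_diff w).hasDerivAt.conj_conj
  have h2 : (starRingEnd ℂ ∘ XX ∘ starRingEnd ℂ) =ᶠ[𝓝 (starRingEnd ℂ w)] XX := by
    have hU : IsOpen {z : ℂ | 0 < z.re} := isOpen_lt continuous_const Complex.continuous_re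
    have hm : starRingEnd ℂ w ∈ {z : ℂ | 0 < z.re} := by simpa using h
    filter_upwards [hU.mem_nhds hm] with z hz
    simp only [Function.comp_apply]
    rw [XX_conj hz]; simp
  have h3 := h1.congr_of_eventuallyEq h2.symm
  rw [logDeriv_apply, logDeriv_apply, h3.deriv, XX_conj h, map_div₀]

lemma inv_re (a b : ℝ) : (1 / ((a:ℂ) + b * cI)).re = pp a b := by
  rw [one_div, Complex.inv_re, Complex.normSq_add_mul_I]; simp [pp]

lemma hasSum_kap (t : ℝ) :
    HasSum (fun ρ : ℂ => mm ρ * kap ρ t) (logDeriv XX (5/4 + t * cI)).re := by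
  obtain ⟨A, hA, hG⟩ := XX_Gro
  set s : ℂ := 5/4 + t * cI with hs
  have hsre : s.re = 5/4 := by simp [hs]
  have h1 : XX s ≠ 0 := XX_ne_zero_of_one_le (by rw [hsre]; norm_num)
  have h2 : XX (1 - starRingEnd ℂ s) ≠ 0 := by
    rw [XX_one_sub, XX_conj (by rw [hsre]; norm_num)]; simpa using h1
  have h := H_main XX_diff XX_zero hA hG h1 h2
  rw [logDeriv_XX_one_sub, logDeriv_XX_conj (by rw [hsre]; norm_num)] at h
  have h3 := (Complex.hasSum_re h).mul_left (1/2)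
  have hv : (logDeriv XX s).re = 1 / 2 * (logDeriv XX s - -(starRingEnd ℂ) (logDeriv XX s)).re := by
    simp; ring
  rw [hv]
  refine (congrArg (fun f : ℂ → ℝ => HasSum f _) (funext ?_)).mpr h3
  · intro ρ
    rw [← Complex.ofReal_natCast, Complex.re_ofReal_mul]
    have e1 : s - ρ = ((5/4 - ρ.re : ℝ) : ℂ) + ((t - ρ.im : ℝ) : ℂ) * cI := by
      apply Complex.ext <;> simp [hs]
    have e2 : 1 - starRingEnd ℂ s - ρ = ((-(1/4 + ρ.re) : ℝ) : ℂ) + ((t - ρ.im : ℝ) : ℂ) * cI := by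
      have him : s.im = t := by simp [hs]
      apply Complex.ext
      · simp only [Complex.sub_re, Complex.one_re, Complex.conj_re, hsre]; simp; ring
      · simp only [Complex.sub_im, Complex.one_im, Complex.conj_im, him]; simp
    rw [e1, e2, Complex.sub_re, inv_re, inv_re]
    simp only [kap, mm, pp]
    rw [neg_sq]
    ring

lemma kap_bounds {ρ : ℂ} (h0 : 0 < ρ.re) (h1 : ρ.re < 1) (t : ℝ) :
    1 / (16 * (1 + (t - ρ.im) ^ 2)) ≤ kap ρ t ∧ kap ρ t ≤ 20 / (1 + (t - ρ.im) ^ 2) := by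
  have key : ∀ d x : ℝ, 1/4 < d → d < 5/4 → 1 / (16 * (1 + x^2)) ≤ pp d x ∧ pp d x ≤ 20 / (1 + x^2) := by
    intro d x h2 h3
    unfold pp
    have hd : 0 < d ^ 2 + x ^ 2 := by positivity
    have hx : 0 < 1 + x ^ 2 := by positivity
    constructor
    · rw [div_le_div_iff₀ (by positivity) hd]; nlinarith [sq_nonneg x]
    · rw [div_le_div_iff₀ hd hx]; nlinarith [sq_nonneg x]
  obtain ⟨a1, a2⟩ := key (5/4 - ρ.re) (t - ρ.im) (by linarith) (by linarith)
  obtain ⟨b1, b2⟩ := key (1/4 + ρ.re) (t - ρ.im) (by linarith) (by linarith)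
  unfold kap
  constructor <;> linarith

lemma mm_kap_nonneg (ρ : ℂ) (t : ℝ) : 0 ≤ mm ρ * kap ρ t := by
  by_cases h : mm ρ = 0
  · simp [h]
  · obtain ⟨-, h0, h1⟩ := mm_pos_re h
    refine mul_nonneg (mm_nonneg ρ) (le_trans ?_ (kap_bounds h0 h1 t).1)
    positivity

-- Dirichlet series
noncomputable def DD (t : ℝ) : ℝ :=
  ∑' n : ℕ, ArithmeticFunction.vonMangoldt n * (n:ℝ) ^ neA * cs (t * lg n)

lemma summable_DD : Summable fun n : ℕ => ArithmeticFunction.vonMangoldt n * (n:ℝ) ^ neA := by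
  have h := (ArithmeticFunction.LSeriesSummable_vonMangoldt (s := 5/4) (by norm_num)).norm
  refine h.congr fun n => ?_
  by_cases hn : n = 0
  · simp [hn]
  rw [LSeries.term_of_ne_zero hn, norm_div, Complex.norm_real, Real.norm_of_nonneg ArithmeticFunction.vonMangoldt_nonneg,
    Complex.norm_natCast_cpow_of_pos (Nat.pos_of_ne_zero hn), Real.rpow_neg (by positivity), div_eq_mul_inv]
  norm_num

lemma DD_term_le (t : ℝ) (n : ℕ) :
    ‖ArithmeticFunction.vonMangoldt n * (n:ℝ) ^ neA * cs (t * lg n)‖ ≤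
      ArithmeticFunction.vonMangoldt n * (n:ℝ) ^ neA := by
  rw [norm_mul, Real.norm_of_nonneg (mul_nonneg ArithmeticFunction.vonMangoldt_nonneg (by positivity))]
  exact mul_le_of_le_one_right (mul_nonneg ArithmeticFunction.vonMangoldt_nonneg (by positivity)) (Real.abs_cos_le_one _)

lemma DD_cont : Continuous DD := by
  refine continuous_tsum (fun n => by fun_prop) summable_DD fun n t => DD_term_le t n

lemma DD_bdd : ∃ C, ∀ t, |DD t| ≤ C :=
  ⟨_, fun t => tsum_of_norm_bounded summable_DD.hasSum (DD_term_le t)⟩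

lemma DD_eq (t : ℝ) : DD t = -(logDeriv riemannZeta (5/4 + t * cI)).re := by
  set s : ℂ := 5/4 + t * cI with hs
  have hsre : 1 < s.re := by simp [hs]; norm_num
  have h := ArithmeticFunction.LSeries_vonMangoldt_eq_deriv_riemannZeta_div hsre
  have h2 := (ArithmeticFunction.LSeriesSummable_vonMangoldt hsre).hasSum
  have h3 := Complex.hasSum_re h2
  rw [logDeriv_apply, ← Complex.neg_re, ← neg_div, ← h]
  unfold LSeries DD
  rw [← h3.tsum_eq]
  refine tsum_congr fun n => ?_
  by_cases hn : n = 0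
  · simp [hn]
  rw [LSeries.term_of_ne_zero hn, div_eq_mul_inv (Complex.ofReal _), Complex.re_ofReal_mul, mul_assoc]
  congr 1
  rw [← Complex.cpow_neg, Complex.cpow_def_of_ne_zero (by exact_mod_cast hn), ← Complex.natCast_log,
    Complex.exp_re, Real.rpow_def_of_pos (by positivity)]
  have e1 : ((lg n : ℂ) * -s).re = lg n * -(5/4) := by
    rw [Complex.re_ofReal_mul]; simp [hs]
  have e2 : ((lg n : ℂ) * -s).im = -(t * lg n) := by
    rw [Complex.im_ofReal_mul]; simp [hs]; ring
  rw [e1, e2, Real.cos_neg]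

lemma psi_near {z : ℂ} (hz : z.re = 5/8) (hi : 2 ≤ |z.im|) :
    |(logDeriv Gm z).re - lg ‖z‖| ≤
      (2 ^ eH * ∑' j : ℕ, ((j:ℝ) + 1) ^ neH) * |z.im| ^ neE := by
  have hz0 : 0 < z.re := by rw [hz]; norm_num
  have hsum : Summable fun j : ℕ => ((j:ℝ) + 1) ^ neH := by
    have := (summable_nat_add_iff 1).2 (Real.summable_nat_rpow.2 (show neH < -1 by norm_num))
    simpa using this
  have hre : ∀ j : ℕ, (z + j).re = 5/8 + j := fun j => by simp [hz]
  have him : ∀ j : ℕ, (z + j).im = z.im := fun j => by simp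
  have hn2 : ∀ j : ℕ, 2 ≤ ‖z + j‖ := fun j =>
    hi.trans (by rw [← him j]; exact Complex.abs_im_le_norm _)
  have hne : ∀ j : ℕ, z + j ≠ 0 := fun j h => by have := hn2 j; rw [h] at this; norm_num at this
  have hy : 0 < |z.im| := by linarith
  have hinv : ∀ j : ℕ, (‖z + j‖ ^ 2)⁻¹ ≤ 2 ^ eH * ((j:ℝ) + 1) ^ neH * |z.im| ^ neE := by
    intro j
    have hj : (0:ℝ) ≤ j := by positivity
    have h1 : ((j:ℝ) + 1) / 2 ≤ ‖z + j‖ := by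
      have := (Complex.abs_re_le_norm (z + j))
      rw [hre j, abs_of_nonneg (by positivity)] at this
      linarith
    have h2 : |z.im| ≤ ‖z + j‖ := by rw [← him j]; exact Complex.abs_im_le_norm _
    have hp : 0 < ‖z + j‖ := by linarith [hn2 j]
    have h3 : (((j:ℝ) + 1) / 2) ^ eH * |z.im| ^ eE ≤ ‖z + j‖ ^ 2 := by
      calc _ ≤ ‖z + j‖ ^ eH * ‖z + j‖ ^ eE := by gcongr
        _ = ‖z + j‖ ^ 2 := by rw [← Real.rpow_add hp]; norm_num
    calc (‖z + j‖ ^ 2)⁻¹ ≤ ((((j:ℝ) + 1) / 2) ^ eH * |z.im| ^ eE)⁻¹ := by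
          gcongr
      _ = _ := by
          rw [Real.div_rpow (by positivity) (by norm_num), Real.rpow_neg (by positivity), Real.rpow_neg hy.le]
          field_simp
  have hterm : ∀ j : ℕ, |(lg ‖z + (j+1:ℕ)‖ - lg ‖z + j‖) - (1 / (z + j)).re| ≤ (‖z + j‖ ^ 2)⁻¹ := by
    intro j
    set w := z + j with hw
    have h1 : z + ((j+1:ℕ):ℂ) = w * (1 + 1 / w) := by
      have := hne j; rw [← hw] at this
      rw [mul_add, mul_one_div_cancel this, hw]; push_cast; ring
    have h2 : 2 ≤ ‖w‖ := hn2 j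
    have h3 : ‖1 / w‖ ≤ 1/2 := by
      rw [norm_div, norm_one]; exact one_div_le_one_div_of_le (by norm_num) h2
    have h4 : (1 + 1 / w) ≠ 0 := by
      intro h
      have h5 : (1:ℂ) / w = -1 := by linear_combination h
      rw [h5] at h3; norm_num at h3
    rw [h1, norm_mul, Real.log_mul (by positivity) (by simpa using h4), add_sub_cancel_left]
    have h5 : lg ‖1 + 1 / w‖ = (Complex.log (1 + 1 / w)).re := (Complex.log_re _).symm
    rw [h5, ← Complex.sub_re]
    refine (Complex.abs_re_le_norm _).trans ((Complex.norm_log_one_add_sub_self_le (by linarith)).trans ?_)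
    have h6 : (1 - ‖1 / w‖)⁻¹ ≤ 2 := by
      rw [inv_le_comm₀ (by linarith) (by norm_num)]; linarith
    have h7 : ‖1 / w‖ ^ 2 = (‖w‖ ^ 2)⁻¹ := by rw [norm_div, norm_one]; simp
    rw [h7]
    have h8 : 0 ≤ (‖w‖ ^ 2)⁻¹ := by positivity
    nlinarith
  have hlim : Tendsto (fun n : ℕ => lg n - lg ‖z + (n+1:ℕ)‖) atTop (𝓝 0) := by
    have h1 : Tendsto (fun n : ℕ => ‖1 + (z + 1) / (n:ℂ)‖) atTop (𝓝 1) := by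
      have : Tendsto (fun n : ℕ => 1 + (z + 1) / (n:ℂ)) atTop (𝓝 (1 + 0)) :=
        tendsto_const_nhds.add (tendsto_const_div_atTop_nhds_zero_nat _)
      simpa using this.norm
    have h2 := (h1.log one_ne_zero).neg
    rw [Real.log_one, neg_zero] at h2
    refine h2.congr' ?_
    filter_upwards [eventually_ne_atTop 0] with n hn
    have hn' : (n:ℂ) ≠ 0 := by exact_mod_cast hn
    have e : z + ((n+1:ℕ):ℂ) = n * (1 + (z + 1) / n) := by field_simp; push_cast; ring
    have h3 : (1 + (z + 1) / (n:ℂ)) ≠ 0 := by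
      intro h
      have := hn2 (n+1); rw [e, h] at this; norm_num at this
    rw [e, norm_mul, Real.log_mul (by simpa using hn) (by simpa using h3)]
    simp
  have hd := (Complex.continuous_re.tendsto _).comp (digamma_tendsto hz0)
  have hfin : Tendsto (fun n : ℕ => (Complex.log n - ∑ j ∈ Finset.range (n + 1), 1 / (z + j)).re -
      (lg n - lg ‖z + (n+1:ℕ)‖) - lg ‖z‖) atTop
      (𝓝 ((logDeriv Gm z).re - 0 - lg ‖z‖)) :=
    (hd.sub hlim).sub tendsto_const_nhds
  rw [sub_zero] at hfin
  refine le_of_tendsto hfin.abs (Eventually.of_forall fun n => ?_)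
  have htel : ∑ j ∈ Finset.range (n+1), (lg ‖z + (j+1:ℕ)‖ - lg ‖z + j‖) =
      lg ‖z + (n+1:ℕ)‖ - lg ‖z‖ := by
    have := Finset.sum_range_sub (fun j : ℕ => lg ‖z + j‖) (n+1)
    simpa using this
  have e : (Complex.log n - ∑ j ∈ Finset.range (n + 1), 1 / (z + j)).re -
      (lg n - lg ‖z + (n+1:ℕ)‖) - lg ‖z‖ =
      ∑ j ∈ Finset.range (n+1), ((lg ‖z + (j+1:ℕ)‖ - lg ‖z + j‖) - (1 / (z + j)).re) := by
    rw [Finset.sum_sub_distrib, htel, Complex.sub_re, Complex.re_sum, ← Complex.natCast_log, Complex.ofReal_re]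
    ring
  rw [e]
  calc _ ≤ ∑ j ∈ Finset.range (n+1), |(lg ‖z + (j+1:ℕ)‖ - lg ‖z + j‖) - (1 / (z + j)).re| :=
        Finset.abs_sum_le_sum_abs _ _
    _ ≤ ∑ j ∈ Finset.range (n+1), 2 ^ eH * ((j:ℝ) + 1) ^ neH * |z.im| ^ neE :=
        Finset.sum_le_sum fun j _ => (hterm j).trans (hinv j)
    _ = (2 ^ eH * ∑ j ∈ Finset.range (n+1), ((j:ℝ) + 1) ^ neH) * |z.im| ^ neE := by
        rw [Finset.mul_sum, Finset.sum_mul]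
    _ ≤ _ := by
        gcongr
        exact hsum.sum_le_tsum _ (fun j _ => by positivity)

noncomputable def RR (t : ℝ) : ℝ := (logDeriv XX (5/4 + t * cI)).re
noncomputable def GG (t : ℝ) : ℝ := RR t + DD t

lemma RR_cont : Continuous RR := by
  have h1 : Continuous fun z : ℂ => deriv XX z := (XX_diff.contDiff (n := 1)).continuous_deriv le_rfl
  have h2 : Continuous fun t : ℝ => (5/4 + t * cI : ℂ) := by fun_prop
  have h3 : Continuous fun t : ℝ => deriv XX (5/4 + t * cI) / XX (5/4 + t * cI) := by
    refine (h1.comp h2).div (XX_diff.continuous.comp h2) fun t => ?_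
    refine XX_ne_zero_of_one_le ?_
    simp; norm_num
  exact Complex.continuous_re.comp h3

lemma GG_cont : Continuous GG := RR_cont.add DD_cont

lemma logDeriv_Gammaℝ {s : ℂ} (hs : 0 < s.re) :
    logDeriv Complex.Gammaℝ s = -(lg pI : ℂ) / 2 + logDeriv Gm (s / 2) / 2 := by
  have hpi : (pI:ℂ) ≠ 0 := by exact_mod_cast Real.pi_ne_zero
  have hs2 : 0 < (s/2).re := by simp; exact hs
  have hG : DifferentiableAt ℂ Gm (s/2) := Complex.differentiableAt_Gamma _ fun m h => by
    have := congrArg Complex.re h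
    rw [Complex.neg_re, Complex.natCast_re] at this
    have : (0:ℝ) ≤ m := by positivity
    linarith
  have h1 : HasDerivAt (fun z : ℂ => (pI:ℂ) ^ (-z/2)) ((pI:ℂ) ^ (-s/2) * Complex.log pI * (-1/2)) s :=
    HasDerivAt.const_cpow ((hasDerivAt_id s).neg.div_const 2) (Or.inl hpi)
  have h2 : HasDerivAt (fun z : ℂ => Gm (z/2)) (deriv Gm (s/2) * (1/2)) s :=
    HasDerivAt.comp s (h₂ := Gm) hG.hasDerivAt ((hasDerivAt_id s).div_const 2)
  have h3 := h1.mul h2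
  have hne := Complex.Gamma_ne_zero_of_re_pos hs2
  have hne2 : (pI:ℂ) ^ (-s/2) ≠ 0 := by simp [Complex.cpow_eq_zero_iff, hpi]
  have e : Complex.Gammaℝ = (fun z : ℂ => (pI:ℂ) ^ (-z/2)) * (fun z : ℂ => Gm (z/2)) := by
    funext z; rw [Complex.Gammaℝ_def]; rfl
  rw [logDeriv_apply, e, h3.deriv, logDeriv_apply, Pi.mul_apply, Complex.ofReal_log Real.pi_pos.le]
  field_simp

lemma GG_eq (t : ℝ) : GG t = pp (5/4) t + pp (1/4) t - lg pI / 2 +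
    (logDeriv Gm ((5/4 + t * cI) / 2)).re / 2 := by
  set s : ℂ := 5/4 + t * cI with hs
  have hre : s.re = 5/4 := by simp [hs]
  have hs0 : s ≠ 0 := by intro h; rw [h] at hre; norm_num at hre
  have hs1 : s ≠ 1 := by intro h; rw [h] at hre; norm_num at hre
  have hs1' : s - 1 ≠ 0 := sub_ne_zero.2 hs1
  have hz : riemannZeta s ≠ 0 := riemannZeta_ne_zero_of_one_le_re (by rw [hre]; norm_num)
  have hg : Complex.Gammaℝ s ≠ 0 := Complex.Gammaℝ_ne_zero_of_re_pos (by rw [hre]; norm_num)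
  have hev : XX =ᶠ[𝓝 s] ((fun z => z * (z - 1)) * (Complex.Gammaℝ * riemannZeta)) := by
    have hU : IsOpen {z : ℂ | 1 < z.re} := isOpen_lt continuous_const Complex.continuous_re
    have hm : s ∈ {z : ℂ | 1 < z.re} := by simp only [Set.mem_ofPred_eq]; rw [hre]; norm_num
    filter_upwards [hU.mem_nhds hm] with z hz
    have hz' : 1 < z.re := hz
    rw [XX_eq_zeta (by linarith) (by rintro rfl; norm_num at hz')]
    rfl
  have hdg : DifferentiableAt ℂ Complex.Gammaℝ s := by
    have : DifferentiableAt ℂ (fun z => (Complex.Gammaℝ z)⁻¹)⁻¹ s :=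
      (Complex.differentiable_Gammaℝ_inv s).inv (inv_ne_zero hg)
    have e : (fun z => (Complex.Gammaℝ z)⁻¹)⁻¹ = Complex.Gammaℝ := by funext z; simp
    rwa [e] at this
  have hdz : DifferentiableAt ℂ riemannZeta s := differentiableAt_riemannZeta hs1
  have h1 : logDeriv XX s = 1 / s + 1 / (s - 1) + (logDeriv Complex.Gammaℝ s + logDeriv riemannZeta s) := by
    rw [logDeriv_apply, hev.deriv_eq, hev.eq_of_nhds, ← logDeriv_apply]
    have e1 := logDeriv_mul (f := fun z => z * (z - 1)) (g := Complex.Gammaℝ * riemannZeta) s (mul_ne_zero hs0 hs1')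
      (mul_ne_zero hg hz) (by fun_prop) (hdg.mul hdz)
    have e2 := logDeriv_mul (f := Complex.Gammaℝ) (g := riemannZeta) s hg hz hdg hdz
    have e3 := logDeriv_mul (f := fun z : ℂ => z) (g := fun z => z - 1) s hs0 hs1' (by fun_prop) (by fun_prop)
    have e4 : logDeriv (fun z : ℂ => z - 1) s = 1 / (s - 1) := by simp [logDeriv_apply]
    have e5 : logDeriv (fun z : ℂ => z) s = 1 / s := by simp [logDeriv_apply]
    rw [e4, e5] at e3
    rw [e3] at e1
    refine Eq.trans e1 ?_
    congr 1
  have e1 : (1 / s).re = pp (5/4) t := by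
    rw [← inv_re]; congr 2; rw [hs]; push_cast; ring
  have e2 : (1 / (s - 1)).re = pp (1/4) t := by
    rw [← inv_re]; congr 2; rw [hs]; push_cast; ring
  unfold GG RR
  rw [DD_eq, ← hs, h1, logDeriv_Gammaℝ (by rw [hre]; norm_num)]
  simp only [Complex.add_re, e1, e2]
  have e3 : (-(lg pI : ℂ) / 2).re = - lg pI / 2 := by
    rw [← Complex.ofReal_neg]; exact Complex.div_ofNat_re _ _
  have e4 : (logDeriv Gm (s / 2) / 2).re = (logDeriv Gm (s / 2)).re / 2 :=
    Complex.div_ofNat_re _ _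
  rw [e3, e4]; ring

lemma GG_asymp : ∃ c₀ C : ℝ, 0 < C ∧ ∀ t : ℝ,
    |GG t - lg (1 + |t|) / 2 - c₀| ≤ C * (1 + |t|) ^ neE := by
  set c₀ : ℝ := - lg pI / 2 - lg 2 / 2 with hc₀
  set K : ℝ := 2 ^ eH * ∑' j : ℕ, ((j:ℝ) + 1) ^ neH with hK
  have hK0 : 0 ≤ K := by rw [hK]; exact mul_nonneg (by positivity) (tsum_nonneg fun j => by positivity)
  obtain ⟨M, hM⟩ : ∃ M, ∀ t ∈ Icc (-4:ℝ) 4, |GG t - lg (1 + |t|) / 2 - c₀| ≤ M := by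
    have hc : Continuous fun t : ℝ => |GG t - lg (1 + |t|) / 2 - c₀| := by
      refine (((GG_cont).sub ((Continuous.log (by fun_prop) fun t => ?_).div_const 2)).sub continuous_const).abs
      positivity
    obtain ⟨M, hM⟩ := isCompact_Icc.bddAbove_image (hc.continuousOn (s := Icc (-4:ℝ) 4))
    exact ⟨M, fun x hx => hM (mem_image_of_mem _ hx)⟩
  have hM0 : 0 ≤ M := (abs_nonneg _).trans (hM 0 (by norm_num))
  refine ⟨c₀, M * 5 + 4 * K + 20, by positivity, fun t => ?_⟩
  have hx1 : 1 ≤ 1 + |t| := by linarith [abs_nonneg t]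
  have hx0 : 0 < 1 + |t| := by linarith
  have hP : 0 < (1 + |t|) ^ neE := by positivity
  by_cases ht : |t| ≤ 4
  · have h1 := hM t (abs_le.1 ht)
    have h2 : (1 + |t|)⁻¹ ≤ (1 + |t|) ^ neE := by
      rw [← Real.rpow_neg_one]; exact Real.rpow_le_rpow_of_exponent_le hx1 (by norm_num)
    have h3 : (5:ℝ)⁻¹ ≤ (1 + |t|)⁻¹ := by gcongr; linarith
    nlinarith
  push Not at ht
  have ht0 : 0 < |t| := by linarith
  have hinv : |t|⁻¹ ≤ 2 * (1 + |t|) ^ neE := by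
    have h2 : (1 + |t|)⁻¹ ≤ (1 + |t|) ^ neE := by
      rw [← Real.rpow_neg_one]; exact Real.rpow_le_rpow_of_exponent_le hx1 (by norm_num)
    have h3 : |t|⁻¹ ≤ 2 * (1 + |t|)⁻¹ := by
      rw [← div_eq_mul_inv, ← one_div, div_le_div_iff₀ ht0 hx0]; linarith
    linarith
  set z : ℂ := (5/4 + t * cI) / 2 with hz
  have hzre : z.re = 5/8 := by
    rw [hz, Complex.div_ofNat_re]; simp; norm_num
  have hzim : z.im = t / 2 := by
    rw [hz, Complex.div_ofNat_im]; simp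
  have hzi : |z.im| = |t| / 2 := by rw [hzim, abs_div]; norm_num
  have h1 := psi_near hzre (by rw [hzi]; linarith)
  rw [← hK, hzi] at h1
  have h2 : (|t| / 2) ^ neE ≤ 4 * (1 + |t|) ^ neE := by
    have : (1 + |t|) / 4 ≤ |t| / 2 := by linarith
    calc (|t| / 2) ^ neE ≤ ((1 + |t|) / 4) ^ neE :=
          Real.rpow_le_rpow_of_nonpos (by positivity) this (by norm_num)
      _ = 4 ^ eE * (1 + |t|) ^ neE := by
          rw [Real.div_rpow hx0.le (by norm_num), Real.rpow_neg (by norm_num : (0:ℝ) ≤ 4)]; field_simp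
      _ ≤ 4 ^ (1:ℝ) * (1 + |t|) ^ neE :=
          mul_le_mul_of_nonneg_right (Real.rpow_le_rpow_of_exponent_le (by norm_num) (by norm_num)) (by positivity)
      _ = _ := by rw [Real.rpow_one]
  have hn : ‖z‖ ^ 2 = (5/8) ^ 2 + (|t| / 2) ^ 2 := by
    rw [← hzi, ← hzre, sq_abs, ← Complex.normSq_eq_norm_sq, Complex.normSq_apply]; ring
  have h3 : |t| / 2 ≤ ‖z‖ := by rw [← hzi]; exact Complex.abs_im_le_norm z
  have h4 : ‖z‖ ≤ (1 + |t|) / 2 * 1 + 0 := by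
    have : ‖z‖ ^ 2 ≤ ((1 + |t|) / 2) ^ 2 := by rw [hn]; clear * - ht; nlinarith
    have := abs_le_of_sq_le_sq this (by positivity)
    linarith [abs_le.1 this]
  have h5 : lg ‖z‖ ≤ lg (1 + |t|) - lg 2 := by
    rw [← Real.log_div hx0.ne' (by norm_num)]
    exact Real.log_le_log (by linarith) (by linarith)
  have h6 : lg (1 + |t|) - lg 2 - |t|⁻¹ ≤ lg ‖z‖ := by
    have a1 : lg (|t| / 2) ≤ lg ‖z‖ := Real.log_le_log (by positivity) h3
    rw [Real.log_div ht0.ne' (by norm_num)] at a1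
    have a2 : lg ((1 + |t|) / |t|) ≤ (1 + |t|) / |t| - 1 := Real.log_le_sub_one_of_pos (by positivity)
    rw [Real.log_div hx0.ne' ht0.ne'] at a2
    have a3 : (1 + |t|) / |t| - 1 = |t|⁻¹ := by field_simp; ring
    linarith
  have h7 : ∀ d : ℝ, 0 < d → d ≤ 5/4 → |pp d t| ≤ 2 * |t|⁻¹ := by
    intro d hd hd2
    unfold pp
    rw [abs_of_pos (by positivity), ← div_eq_mul_inv, div_le_div_iff₀ (by positivity) ht0, ← sq_abs t]
    nlinarith
  have h8 := abs_le.1 (h7 (5/4) (by norm_num) (by norm_num))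
  have h9 := abs_le.1 (h7 (1/4) (by norm_num) (by norm_num))
  have h10 := abs_le.1 (h1.trans (mul_le_mul_of_nonneg_left h2 hK0))
  have hGG : GG t = _ := GG_eq t
  rw [← hz] at hGG
  clear h1 h2 hn h3 h4 h7 hM hzi hzre hzim hK hz
  generalize (1 + |t|) ^ neE = P at *
  have hMP : 0 ≤ M * P := by positivity
  have hKP : 0 ≤ K * P := by positivity
  clear_value K z
  rw [hGG, abs_le]
  constructor <;> linarith [h8.1, h8.2, h9.1, h9.2, h10.1, h10.2]

lemma log_diff_bound (t y : ℝ) : |lg (1 + |t - y|) - lg (1 + |t|)| ≤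
    60 * (1 + |y|) ^ eB * (1 + |t|) ^ neC := by
  set a := 1 + |t| with ha
  set b := 1 + |t - y| with hb
  set u := 1 + |y| with hu
  have ha1 : 1 ≤ a := by rw [ha]; linarith [abs_nonneg t]
  have hb1 : 1 ≤ b := by rw [hb]; linarith [abs_nonneg (t - y)]
  have hu1 : 1 ≤ u := by rw [hu]; linarith [abs_nonneg y]
  have d1 : a ≤ b + |y| := by
    have := abs_sub_abs_le_abs_sub t (t - y); rw [sub_sub_cancel] at this; linarith
  have d2 : b ≤ a + |y| := by
    have := abs_sub t y; linarith
  have hlog : ∀ p q : ℝ, 1 ≤ p → 1 ≤ q → p ≤ q + |y| → lg p - lg q ≤ |y| / q := by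
    intro p q hp hq h
    rw [← Real.log_div (by positivity) (by positivity)]
    have := Real.log_le_sub_one_of_pos (show 0 < p / q by positivity)
    have h2 : p / q - 1 ≤ |y| / q := by rw [div_sub_one (by positivity)]; gcongr; linarith
    linarith
  have hlog2 : ∀ p q : ℝ, 1 ≤ p → 1 ≤ q → p ≤ q + |y| → lg p - lg q ≤ lg u := by
    intro p q hp hq h
    have : lg p ≤ lg (u * q) := Real.log_le_log (by positivity) (by
      rw [hu]; nlinarith [abs_nonneg y])
    rw [Real.log_mul (by positivity) (by positivity)] at this
    linarith
  by_cases hy : |y| ≤ a / 2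
  · have hb2 : a / 2 ≤ b := by linarith
    have h1 : |lg b - lg a| ≤ 2 * u / a := by
      rw [abs_le]
      have e1 := hlog a b ha1 hb1 d1
      have e2 := hlog b a hb1 ha1 d2
      have e3 : |y| / b ≤ 2 * u / a := by
        rw [div_le_div_iff₀ (by positivity) (by positivity)]
        nlinarith [abs_nonneg y]
      have e4 : |y| / a ≤ 2 * u / a := by gcongr; linarith [abs_nonneg y]
      constructor <;> linarith
    refine h1.trans ?_
    have h2 : u ^ (1/20:ℝ) ≤ 2 * a ^ (1/5:ℝ) := by
      have : u ≤ 2 * a := by linarith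
      calc u ^ (1/20:ℝ) ≤ (2 * a) ^ (1/20:ℝ) := by gcongr
        _ = 2 ^ (1/20:ℝ) * a ^ (1/20:ℝ) := Real.mul_rpow (by norm_num) (by positivity)
        _ ≤ 2 ^ (1:ℝ) * a ^ (1/5:ℝ) := mul_le_mul (Real.rpow_le_rpow_of_exponent_le (by norm_num) (by norm_num))
            (Real.rpow_le_rpow_of_exponent_le ha1 (by norm_num)) (by positivity) (by positivity)
        _ = _ := by rw [Real.rpow_one]
    have e1 : u = u ^ eB * u ^ (1/20:ℝ) := by rw [← Real.rpow_add (by positivity)]; norm_num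
    have e2 : a = a ^ eC * a ^ (1/5:ℝ) := by rw [← Real.rpow_add (by positivity)]; norm_num
    rw [Real.rpow_neg (by positivity)]
    calc 2 * u / a = 2 * (u ^ eB * u ^ (1/20:ℝ)) / (a ^ eC * a ^ (1/5:ℝ)) := by rw [← e1, ← e2]
      _ ≤ 2 * (u ^ eB * (2 * a ^ (1/5:ℝ))) / (a ^ eC * a ^ (1/5:ℝ)) := by gcongr
      _ = 4 * (u ^ eB * (a ^ eC)⁻¹) := by field_simp; ring
      _ ≤ 60 * (u ^ eB * (a ^ eC)⁻¹) := by gcongr; norm_num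
      _ = _ := by ring
  · push Not at hy
    have h1 : |lg b - lg a| ≤ lg u := by
      rw [abs_le]
      have e1 := hlog2 a b ha1 hb1 d1
      have e2 := hlog2 b a hb1 ha1 d2
      constructor <;> linarith
    have h2 : lg u ≤ u ^ (1/10:ℝ) / (1/10) := Real.log_le_rpow_div (by positivity) (by norm_num)
    have h3 : a ^ eC ≤ 2 * u ^ (17/20:ℝ) := by
      have : a ≤ 2 * u := by linarith
      calc a ^ eC ≤ (2 * u) ^ eC := by gcongr
        _ = 2 ^ eC * u ^ eC := Real.mul_rpow (by norm_num) (by positivity)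
        _ ≤ 2 ^ (1:ℝ) * u ^ (17/20:ℝ) := mul_le_mul (Real.rpow_le_rpow_of_exponent_le (by norm_num) (by norm_num))
            (Real.rpow_le_rpow_of_exponent_le hu1 (by norm_num)) (by positivity) (by positivity)
        _ = _ := by rw [Real.rpow_one]
    have e1 : u ^ eB = u ^ (17/20:ℝ) * u ^ (1/10:ℝ) := by rw [← Real.rpow_add (by positivity)]; norm_num
    have h4 : 1 ≤ 2 * u ^ (17/20:ℝ) * a ^ neC := by
      rw [Real.rpow_neg (by positivity), ← div_eq_mul_inv, le_div_iff₀ (by positivity)]; linarith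
    rw [e1]
    have h5 : 0 ≤ u ^ (1/10:ℝ) := by positivity
    have : 0 ≤ u ^ (17/20:ℝ) * a ^ neC := by positivity
    nlinarith

lemma GG_diff : ∃ C : ℝ, 0 < C ∧ ∀ t y : ℝ,
    |GG (t - y) - GG t| ≤ C * (1 + |y|) ^ eB * (1 + |t|) ^ neC := by
  obtain ⟨c₀, C, hC, h⟩ := GG_asymp
  refine ⟨2 * C + 30, by positivity, fun t y => ?_⟩
  have h1 := h t
  have h2 := h (t - y)
  have h3 := log_diff_bound t y
  have hy : 1 ≤ 1 + |y| := by linarith [abs_nonneg y]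
  have ht : 1 ≤ 1 + |t| := by linarith [abs_nonneg t]
  have hb : 0 < 1 + |t - y| := by positivity
  have e1 : (1 + |t|) ^ neE ≤ (1 + |y|) ^ eB * (1 + |t|) ^ neC := by
    calc (1 + |t|) ^ neE ≤ (1 + |t|) ^ neC := Real.rpow_le_rpow_of_exponent_le ht (by norm_num)
      _ ≤ _ := le_mul_of_one_le_left (by positivity) (Real.one_le_rpow hy (by norm_num))
  have e2 : (1 + |t - y|) ^ neE ≤ (1 + |y|) ^ eB * (1 + |t|) ^ neC := by
    have g1 : 1 + |t| ≤ (1 + |y|) * (1 + |t - y|) := by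
      have := abs_add_le y (t - y)
      rw [add_sub_cancel] at this
      nlinarith [abs_nonneg y, abs_nonneg (t - y)]
    have g2 : (1 + |t|) ^ eC ≤ (1 + |y|) ^ eC * (1 + |t - y|) ^ eC := by
      rw [← Real.mul_rpow (by positivity) hb.le]; gcongr
    have g3 : (1 + |y|) ^ eC ≤ (1 + |y|) ^ eB := Real.rpow_le_rpow_of_exponent_le hy (by norm_num)
    calc (1 + |t - y|) ^ neE ≤ (1 + |t - y|) ^ neC :=
          Real.rpow_le_rpow_of_exponent_le (by linarith [abs_nonneg (t - y)]) (by norm_num)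
      _ ≤ _ := by
          rw [Real.rpow_neg hb.le, Real.rpow_neg (by positivity), ← div_eq_mul_inv, ← one_div,
            div_le_div_iff₀ (by positivity) (by positivity), one_mul]
          exact g2.trans (by gcongr)
  have h1' := abs_le.1 h1
  have h2' := abs_le.1 h2
  have h3' := abs_le.1 h3
  rw [abs_le]
  have e1C := mul_le_mul_of_nonneg_left e1 hC.le
  have e2C := mul_le_mul_of_nonneg_left e2 hC.le
  constructor <;> linarith [h1'.1, h1'.2, h2'.1, h2'.2, h3'.1, h3'.2]

lemma density : ∃ C : ℝ, 0 < C ∧ ∀ t : ℝ,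
    Summable (fun ρ : ℂ => mm ρ / (1 + (t - ρ.im) ^ 2)) ∧
    ∑' ρ : ℂ, mm ρ / (1 + (t - ρ.im) ^ 2) ≤ C * lg (3 + |t|) := by
  obtain ⟨c₀, C, hC, h⟩ := GG_asymp
  obtain ⟨D, hD⟩ := DD_bdd
  have hD0 : 0 ≤ D := (abs_nonneg _).trans (hD 0)
  refine ⟨16 * (1 + |c₀| + C + D), by positivity, fun t => ?_⟩
  have hle : ∀ ρ : ℂ, mm ρ / (1 + (t - ρ.im) ^ 2) ≤ 16 * (mm ρ * kap ρ t) := by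
    intro ρ
    by_cases hm : mm ρ = 0
    · simp [hm]
    obtain ⟨-, h0, h1⟩ := mm_pos_re hm
    have h2 := (kap_bounds h0 h1 t).1
    have h3 : mm ρ / (1 + (t - ρ.im) ^ 2) = 16 * (mm ρ * (1 / (16 * (1 + (t - ρ.im) ^ 2)))) := by
      have : 0 < 1 + (t - ρ.im) ^ 2 := by positivity
      field_simp
    rw [h3]
    have := mm_nonneg ρ
    gcongr
  have hs := (hasSum_kap t).mul_left 16
  have h0 : ∀ ρ : ℂ, 0 ≤ mm ρ / (1 + (t - ρ.im) ^ 2) := fun ρ => div_nonneg (mm_nonneg ρ) (by positivity)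
  have hsum : Summable (fun ρ : ℂ => mm ρ / (1 + (t - ρ.im) ^ 2)) := Summable.of_nonneg_of_le h0 hle hs.summable
  refine ⟨hsum, (hsum.tsum_le_tsum hle hs.summable).trans ?_⟩
  rw [hs.tsum_eq]
  have h1 := abs_le.1 (h t)
  have h2 := abs_le.1 (hD t)
  have h3 : RR t = GG t - DD t := by unfold GG; ring
  have h4 : (1 + |t|) ^ neE ≤ 1 := Real.rpow_le_one_of_one_le_of_nonpos (by linarith [abs_nonneg t]) (by norm_num)
  have h5 : 1 ≤ lg (3 + |t|) := by
    rw [Real.le_log_iff_exp_le (by positivity)]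
    have := Real.exp_one_lt_d9
    linarith [abs_nonneg t]
  have h6 : lg (1 + |t|) ≤ lg (3 + |t|) := Real.log_le_log (by positivity) (by linarith)
  have h7 : 0 ≤ lg (1 + |t|) := Real.log_nonneg (by linarith [abs_nonneg t])
  have h8 := le_abs_self c₀
  change 16 * RR t ≤ _
  have h9 : RR t ≤ (1 + |c₀| + C + D) * lg (3 + |t|) := by
    rw [h3]
    have : C * (1 + |t|) ^ neE ≤ C := mul_le_of_le_one_right hC.le h4
    nlinarith [abs_nonneg c₀]
  linarith

noncomputable def EE (Q : ℝ → ℝ) (V x : ℝ) : ℝ := ∫ v in (0:ℝ)..V, Q v * cs (x * v)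

lemma EE_neg (Q : ℝ → ℝ) (V x : ℝ) : EE Q V (-x) = EE Q V x := by
  unfold EE; simp

lemma EE_cont {Q : ℝ → ℝ} (hQ : Continuous Q) (V : ℝ) : Continuous (EE Q V) := by
  unfold EE
  exact intervalIntegral.continuous_parametric_intervalIntegral_of_continuous' (by fun_prop) _ _

/-- decay of the cosine transform -/
lemma EE_bound {Q : ℝ → ℝ} (hQ : ContDiff ℝ 2 Q) {V M : ℝ} (hV : 0 ≤ V) (hQV : Q V = 0)
    (h0 : ∀ v ∈ Icc 0 V, |Q v| ≤ M) (h1 : ∀ v ∈ Icc 0 V, |deriv Q v| ≤ M)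
    (h2 : ∀ v ∈ Icc 0 V, |deriv (deriv Q) v| ≤ M) (x : ℝ) :
    |EE Q V x| ≤ 2 * M * (1 + V) / (1 + x ^ 2) := by
  have hM : 0 ≤ M := (abs_nonneg _).trans (h0 0 ⟨le_rfl, hV⟩)
  have hd1 : ∀ v, HasDerivAt Q (deriv Q v) v := fun v => (hQ.differentiable (by norm_num) v).hasDerivAt
  have hQ' : ContDiff ℝ 1 (deriv Q) := by
    have : ContDiff ℝ (1 + 1) Q := by simpa [one_add_one_eq_two] using hQ
    exact (contDiff_succ_iff_deriv.1 this).2.2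
  have hd2 : ∀ v, HasDerivAt (deriv Q) (deriv (deriv Q) v) v :=
    fun v => (hQ'.differentiable (by norm_num) v).hasDerivAt
  have hc2 : Continuous (deriv (deriv Q)) := hQ'.continuous_deriv le_rfl
  have hc1 : Continuous (deriv Q) := hQ'.continuous
  have hc0 : Continuous Q := hQ.continuous
  have hbd : ∀ (F : ℝ → ℝ) , (∀ v ∈ Icc 0 V, |F v| ≤ M) → |∫ v in (0:ℝ)..V, F v * cs (x * v)| ≤ M * V := by
    intro F hF
    have := intervalIntegral.norm_integral_le_of_norm_le_const (a := 0) (b := V) (C := M)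
      (f := fun v => F v * cs (x * v)) (by
        intro v hv
        rw [uIoc_of_le hV] at hv
        rw [norm_mul]
        exact (mul_le_of_le_one_right (norm_nonneg _) (Real.abs_cos_le_one _)).trans (hF v ⟨hv.1.le, hv.2⟩))
    rwa [sub_zero, abs_of_nonneg hV, Real.norm_eq_abs] at this
  have hA : |EE Q V x| ≤ M * V := hbd Q h0
  have hB : x ^ 2 * |EE Q V x| ≤ 2 * M + M * V := by
    by_cases hx : x = 0
    · rw [hx]; simp; positivity
    have i1 : x * EE Q V x = - ∫ v in (0:ℝ)..V, deriv Q v * sn (x * v) := by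
      have hs : ∀ v, HasDerivAt (fun v => sn (x * v)) (x * cs (x * v)) v := fun v => by
        have := ((hasDerivAt_id' v).const_mul x).sin
        rw [mul_one, mul_comm] at this
        exact this
      have := intervalIntegral.integral_mul_deriv_eq_deriv_mul (a := 0) (b := V) (fun v _ => hd1 v) (fun v _ => hs v)
        (hc1.intervalIntegrable _ _) ((by fun_prop : Continuous fun v => x * cs (x * v)).intervalIntegrable _ _)
      rw [hQV] at this
      simp only [mul_zero, Real.sin_zero, zero_mul, zero_sub, sub_self] at this
      rw [← this, EE, ← intervalIntegral.integral_const_mul]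
      congr 1; funext v; ring
    have i2 : x * (∫ v in (0:ℝ)..V, deriv Q v * sn (x * v)) =
        - (deriv Q V * cs (x * V) - deriv Q 0 - ∫ v in (0:ℝ)..V, deriv (deriv Q) v * cs (x * v)) := by
      have hs : ∀ v, HasDerivAt (fun v => cs (x * v)) (-(x * sn (x * v))) v := fun v => by
        have := ((hasDerivAt_id' v).const_mul x).cos
        exact this.congr_deriv (by ring)
      have := intervalIntegral.integral_mul_deriv_eq_deriv_mul (a := 0) (b := V) (fun v _ => hd2 v) (fun v _ => hs v)
        (hc2.intervalIntegrable _ _) ((by fun_prop : Continuous fun v => -(x * sn (x * v))).intervalIntegrable _ _)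
      simp only [mul_zero, Real.cos_zero, mul_one] at this
      rw [← this, ← intervalIntegral.integral_const_mul, ← intervalIntegral.integral_neg]
      congr 1; funext v; ring
    have i3 : x ^ 2 * EE Q V x = deriv Q V * cs (x * V) - deriv Q 0 -
        ∫ v in (0:ℝ)..V, deriv (deriv Q) v * cs (x * v) := by
      linear_combination x * i1 - i2
    have : x ^ 2 * |EE Q V x| = |x ^ 2 * EE Q V x| := by rw [abs_mul, abs_of_nonneg (sq_nonneg x)]
    rw [this, i3]
    have a1 := h1 V ⟨hV, le_rfl⟩
    have a2 := h1 0 ⟨le_rfl, hV⟩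
    have a3 := hbd _ h2
    have a4 : |deriv Q V * cs (x * V)| ≤ M := by
      rw [abs_mul]; exact (mul_le_of_le_one_right (abs_nonneg _) (Real.abs_cos_le_one _)).trans a1
    have a5 := abs_sub (deriv Q V * cs (x * V) - deriv Q 0) (∫ v in (0:ℝ)..V, deriv (deriv Q) v * cs (x * v))
    have a6 := abs_sub (deriv Q V * cs (x * V)) (deriv Q 0)
    linarith
  rw [le_div_iff₀ (by positivity)]
  linarith

lemma EE_bound' {Q : ℝ → ℝ} (hQ : ContDiff ℝ 2 Q) {V : ℝ} (hV : 0 ≤ V) (hQV : Q V = 0) :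
    ∃ C, 0 < C ∧ ∀ x, |EE Q V x| ≤ C / (1 + x ^ 2) := by
  have hQ' : ContDiff ℝ 1 (deriv Q) := by
    have : ContDiff ℝ (1 + 1) Q := by simpa [one_add_one_eq_two] using hQ
    exact (contDiff_succ_iff_deriv.1 this).2.2
  have hb : ∀ F : ℝ → ℝ, Continuous F → ∃ M, ∀ v ∈ Icc 0 V, |F v| ≤ M := by
    intro F hF
    obtain ⟨M, hM⟩ := isCompact_Icc.bddAbove_image (hF.abs.continuousOn (s := Icc 0 V))
    exact ⟨M, fun x hx => hM (mem_image_of_mem _ hx)⟩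
  obtain ⟨M0, g0⟩ := hb Q hQ.continuous
  obtain ⟨M1, g1⟩ := hb _ hQ'.continuous
  obtain ⟨M2, g2⟩ := hb _ (hQ'.continuous_deriv le_rfl)
  have hm : (0:ℝ) ∈ Icc 0 V := ⟨le_rfl, hV⟩
  have p0 := (abs_nonneg _).trans (g0 0 hm)
  have p1 := (abs_nonneg _).trans (g1 0 hm)
  have p2 := (abs_nonneg _).trans (g2 0 hm)
  refine ⟨2 * (M0 + M1 + M2 + 1) * (1 + V), by positivity, fun x => ?_⟩
  exact EE_bound hQ hV hQV (fun v hv => (g0 v hv).trans (by linarith)) (fun v hv => (g1 v hv).trans (by linarith))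
    (fun v hv => (g2 v hv).trans (by linarith)) x

lemma EE_integrable {Q : ℝ → ℝ} (hQ : ContDiff ℝ 2 Q) {V : ℝ} (hV : 0 ≤ V) (hQV : Q V = 0) :
    Integrable (EE Q V) := by
  obtain ⟨C, hC, h⟩ := EE_bound' hQ hV hQV
  refine (integrable_inv_one_add_sq.const_mul C).mono' (EE_cont hQ.continuous V).aestronglyMeasurable
    (Eventually.of_forall fun x => ?_)
  rw [Real.norm_eq_abs, ← div_eq_mul_inv]; exact h x

lemma even_exp_integral {f : ℝ → ℝ} (hf : Integrable f) (he : ∀ v, f (-v) = f v) (θ : ℝ) :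
    ∫ v : ℝ, cE (((θ * v : ℝ) : ℂ) * cI) • (f v : ℂ) =
      ((∫ v, f v * cs (θ * v) : ℝ) : ℂ) := by
  have hF : Integrable fun v : ℝ => cE (((θ * v : ℝ) : ℂ) * cI) • (f v : ℂ) := by
    refine hf.norm.mono' ?_ (Eventually.of_forall fun v => ?_)
    · exact ((by fun_prop : Continuous fun v : ℝ => cE (((θ * v : ℝ) : ℂ) * cI)).aestronglyMeasurable).smul
        (hf.ofReal (𝕜 := ℂ)).aestronglyMeasurable
    · rw [norm_smul, Complex.norm_exp_ofReal_mul_I, one_mul, Complex.norm_real]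
  have h1 := integral_neg_eq_self (fun v : ℝ => cE (((θ * v : ℝ) : ℂ) * cI) • (f v : ℂ)) volume
  have h2 := integral_add hF hF.comp_neg
  rw [h1] at h2
  have h3 : ∀ v : ℝ, cE (((θ * v : ℝ) : ℂ) * cI) • (f v : ℂ) +
      cE (((θ * -v : ℝ) : ℂ) * cI) • (f (-v) : ℂ) = 2 * ((f v * cs (θ * v) : ℝ) : ℂ) := by
    intro v
    rw [he v, Complex.ofReal_mul (f v), Complex.ofReal_cos, Complex.cos, smul_eq_mul, smul_eq_mul]
    push_cast
    ring_nf
  simp only [h3] at h2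
  rw [integral_const_mul, integral_complex_ofReal] at h2
  linear_combination (-1/2 : ℂ) * h2

/-- Fourier inversion for cosine transforms -/
lemma EE_inversion {Q : ℝ → ℝ} (hQ : ContDiff ℝ 2 Q) {V : ℝ} (hV : 0 ≤ V) (hQV : Q V = 0) {v : ℝ} (hv : 0 ≤ v) :
    ∫ y, EE Q V y * cs (v * y) = pI * Q (min v V) := by
  set f : ℝ → ℝ := fun u => Q (min |u| V) with hf
  have hfc : Continuous f := hQ.continuous.comp (by fun_prop)
  have hfs : HasCompactSupport f := by
    refine HasCompactSupport.intro (isCompact_Icc (a := -V) (b := V)) fun u hu => ?_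
    have : V ≤ |u| := by
      by_contra h; push Not at h; exact hu (abs_le.1 h.le)
    simp [hf, min_eq_right this, hQV]
  have hfi : Integrable f := hfc.integrable_of_hasCompactSupport hfs
  have hfe : ∀ u, f (-u) = f u := fun u => by simp [hf]
  have hcos : ∀ θ : ℝ, ∫ u, f u * cs (θ * u) = 2 * EE Q V θ := by
    intro θ
    have e1 : ∀ u, f u * cs (θ * u) = (fun w => Q (min w V) * cs (θ * w)) |u| := by
      intro u
      simp only [hf]
      congr 1
      rcases abs_choice u with h | h <;> rw [h]
      rw [mul_neg, Real.cos_neg]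
    simp only [e1]
    rw [integral_comp_abs (f := fun w => Q (min w V) * cs (θ * w))]
    congr 1
    rw [EE, intervalIntegral.integral_of_le hV, ← Ioc_union_Ioi_eq_Ioi hV,
      setIntegral_union (Ioc_disjoint_Ioi le_rfl) measurableSet_Ioi]
    · rw [setIntegral_congr_fun (g := fun w => Q w * cs (θ * w)) measurableSet_Ioc (fun w hw => by
        simp only [min_eq_left hw.2]), setIntegral_congr_fun (g := fun w => (0:ℝ)) measurableSet_Ioi (fun w hw => by
        simp only [min_eq_right (le_of_lt (mem_Ioi.1 hw)), hQV, zero_mul])]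
      simp
    · exact ((hQ.continuous.comp (by fun_prop : Continuous fun w : ℝ => min w V)).mul (by fun_prop)).continuousOn.integrableOn_compact
        isCompact_Icc |>.mono_set Ioc_subset_Icc_self
    · refine (integrableOn_zero).congr_fun (fun w hw => ?_) measurableSet_Ioi
      simp only [min_eq_right (le_of_lt (mem_Ioi.1 hw)), hQV, zero_mul]
  have hFf : FourierTransform.fourier (fun u => (f u : ℂ)) = fun w : ℝ => ((2 * EE Q V (2 * pI * w) : ℝ) : ℂ) := by
    funext w
    rw [Real.fourier_real_eq_integral_exp_smul]
    have := even_exp_integral hfi hfe (-2 * pI * w)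
    have e : ∀ v : ℝ, -2 * pI * v * w = -2 * pI * w * v := fun v => by ring
    simp only [e]
    rw [this, hcos, show -2 * pI * w = -(2 * pI * w) by ring, EE_neg]
  have hEi := EE_integrable hQ hV hQV
  have hpi : (2 * pI) ≠ 0 := by positivity
  have hEi2 : Integrable fun w : ℝ => 2 * EE Q V (2 * pI * w) := (hEi.comp_mul_left' hpi).const_mul 2
  have hFi : Integrable (FourierTransform.fourier (fun u => (f u : ℂ))) := by
    rw [hFf]; exact hEi2.ofReal
  have hinv := hfi.ofReal.fourierInv_fourier_eq hFi (v := v)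
    ((Complex.continuous_ofReal.comp hfc).continuousAt)
  rw [hFf, Real.fourierInv_eq'] at hinv
  have e : ∀ w : ℝ, 2 * pI * inner ℝ w v = 2 * pI * v * w := fun w => by
    simp; ring
  simp only [e] at hinv
  rw [even_exp_integral hEi2 (fun w => by rw [mul_neg, EE_neg])] at hinv
  have hinv2 : ∫ w, 2 * EE Q V (2 * pI * w) * cs (2 * pI * v * w) = f v := by
    exact_mod_cast hinv
  have hsub := Measure.integral_comp_mul_left (fun y => 2 * EE Q V y * cs (v * y)) (2 * pI)
  have e2 : ∀ w : ℝ, 2 * EE Q V (2 * pI * w) * cs (2 * pI * v * w) =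
      2 * EE Q V (2 * pI * w) * cs (v * (2 * pI * w)) := fun w => by ring_nf
  simp only [e2] at hinv2
  rw [hinv2] at hsub
  have hfv : f v = Q (min v V) := by simp [hf, abs_of_nonneg hv]
  rw [hfv, abs_of_pos (by positivity), smul_eq_mul] at hsub
  have e3 : ∫ y, 2 * EE Q V y * cs (v * y) = 2 * ∫ y, EE Q V y * cs (v * y) := by
    rw [← integral_const_mul]; congr 1; funext y; ring
  rw [e3] at hsub
  rw [hsub]; field_simp

lemma EE_inversion' {Q : ℝ → ℝ} (hQ : ContDiff ℝ 2 Q) {V : ℝ} (hV : 0 ≤ V) (hQV : Q V = 0) {v : ℝ} (hv : 0 ≤ v) (x : ℝ) :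
    ∫ y, EE Q V y * cs (v * (x - y)) = pI * Q (min v V) * cs (v * x) := by
  have hEi := EE_integrable hQ hV hQV
  have i1 : Integrable fun y => EE Q V y * cs (v * y) :=
    hEi.mul_bdd (c := 1) (by fun_prop) (Eventually.of_forall fun y => Real.abs_cos_le_one _)
  have i2 : Integrable fun y => EE Q V y * sn (v * y) :=
    hEi.mul_bdd (c := 1) (by fun_prop) (Eventually.of_forall fun y => Real.abs_sin_le_one _)
  have h0 : ∫ y, EE Q V y * sn (v * y) = 0 := by
    have h1 := integral_neg_eq_self (fun y => EE Q V y * sn (v * y)) volume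
    have h2 : ∀ y, EE Q V (-y) * sn (v * -y) = -(EE Q V y * sn (v * y)) := fun y => by
      rw [EE_neg, mul_neg, Real.sin_neg]; ring
    simp only [h2] at h1
    rw [integral_neg] at h1
    linarith
  have e : ∀ y, EE Q V y * cs (v * (x - y)) =
      cs (v * x) * (EE Q V y * cs (v * y)) + sn (v * x) * (EE Q V y * sn (v * y)) := fun y => by
    rw [mul_sub, Real.cos_sub]; ring
  simp only [e]
  rw [integral_add (i1.const_mul _) (i2.const_mul _), integral_const_mul, integral_const_mul, h0,
    EE_inversion hQ hV hQV hv]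
  ring

/-- Lemma F -/
lemma EE_conv {Q h : ℝ → ℝ} (hQ : ContDiff ℝ 2 Q) {V : ℝ} (hV : 0 ≤ V) (hQV : Q V = 0)
    (hh : IntegrableOn h (Ioi 0)) (x : ℝ) :
    ∫ y, EE Q V y * (∫ v in Ioi (0:ℝ), h v * cs (v * (x - y))) =
      pI * ∫ v in (0:ℝ)..V, Q v * h v * cs (v * x) := by
  have hEi := EE_integrable hQ hV hQV
  have hprod : Integrable (fun p : ℝ × ℝ => EE Q V p.1 * (h p.2 * cs (p.2 * (x - p.1))))
      (volume.prod (volume.restrict (Ioi 0))) := by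
    have h1 := (hEi.mul_prod hh).mul_bdd (c := 1) (g := fun p : ℝ × ℝ => cs (p.2 * (x - p.1)))
      (by fun_prop) (Eventually.of_forall fun y => Real.abs_cos_le_one _)
    refine h1.congr (Eventually.of_forall fun p => ?_)
    simp only []; ring
  have h1 : ∫ y, EE Q V y * (∫ v in Ioi (0:ℝ), h v * cs (v * (x - y))) =
      ∫ y, ∫ v in Ioi (0:ℝ), EE Q V y * (h v * cs (v * (x - y))) := by
    congr 1; funext y; rw [integral_const_mul]
  rw [h1, integral_integral_swap hprod]
  have h2 : ∀ v ∈ Ioi (0:ℝ), ∫ y, EE Q V y * (h v * cs (v * (x - y))) =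
      pI * (Q (min v V) * h v * cs (v * x)) := by
    intro v hv
    have : ∀ y, EE Q V y * (h v * cs (v * (x - y))) = h v * (EE Q V y * cs (v * (x - y))) := fun y => by ring
    simp only [this]
    rw [integral_const_mul, EE_inversion' hQ hV hQV (le_of_lt hv)]; ring
  rw [setIntegral_congr_fun measurableSet_Ioi h2, integral_const_mul]
  congr 1
  rw [intervalIntegral.integral_of_le hV]
  have h3 : ∀ v ∈ Ioi (0:ℝ), Q (min v V) * h v * cs (v * x) =
      (Ioc 0 V).indicator (fun v => Q v * h v * cs (v * x)) v := by
    intro v hv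
    by_cases hvV : v ≤ V
    · rw [indicator_of_mem (show v ∈ Ioc 0 V from ⟨hv, hvV⟩), min_eq_left hvV]
    · rw [indicator_of_notMem (fun h => hvV h.2), min_eq_right (le_of_not_ge hvV), hQV]; simp
  rw [setIntegral_congr_fun measurableSet_Ioi h3, setIntegral_indicator measurableSet_Ioc,
    inter_eq_self_of_subset_right Ioc_subset_Ioi_self]

lemma exp_integrableOn {d : ℝ} (hd : 0 < d) : IntegrableOn (fun v : ℝ => ep (-d * v)) (Ioi 0) :=
  integrableOn_exp_mul_Ioi (by linarith) 0

lemma pp_int {d : ℝ} (hd : 0 < d) (x : ℝ) :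
    ∫ v in Ioi (0:ℝ), ep (-d * v) * cs (v * x) = pp d x := by
  have ha : ((-d : ℂ) + x * cI).re < 0 := by simp [hd]
  have h1 := integral_exp_mul_complex_Ioi ha 0
  have h2 := integrableOn_exp_mul_complex_Ioi ha 0
  have h3 := integral_re h2
  have h4 : ∀ v : ℝ, (RCLike.re (cE (((-d : ℂ) + x * cI) * v)) : ℝ) = ep (-d * v) * cs (v * x) := by
    intro v
    change (cE (((-d : ℂ) + x * cI) * v)).re = _
    rw [Complex.exp_re]; simp [mul_comm]
  simp only [h4] at h3
  rw [h3, h1]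
  have h5 := inv_re d (-x)
  change (_ : ℂ).re = _
  have h6 : -cE (((-d : ℂ) + x * cI) * (0:ℝ)) / ((-d : ℂ) + x * cI) = 1 / ((d:ℂ) + ((-x : ℝ):ℂ) * cI) := by
    have : (-d : ℂ) + x * cI = -((d:ℂ) + ((-x : ℝ):ℂ) * cI) := by push_cast; ring
    rw [this, Complex.ofReal_zero, mul_zero, Complex.exp_zero, neg_div_neg_eq]
  rw [h6, h5]; simp [pp]

lemma kap_cont (ρ : ℂ) : Continuous (kap ρ) := by
  unfold kap pp
  by_cases h : (5/4 - ρ.re = 0)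
  · by_cases h' : (1/4 + ρ.re = 0)
    · linarith
    · simp only [h, zero_div, zero_add]
      exact (Continuous.div (by fun_prop) (by fun_prop) (fun t => by positivity)).div_const _
  · by_cases h' : (1/4 + ρ.re = 0)
    · simp only [h', zero_div, add_zero]
      exact (Continuous.div (by fun_prop) (by fun_prop) (fun t => by positivity)).div_const _
    · exact ((Continuous.div (by fun_prop) (by fun_prop) (fun t => by positivity)).add
        (Continuous.div (by fun_prop) (by fun_prop) (fun t => by positivity))).div_const _

lemma kap_int {ρ : ℂ} (h0 : 0 < ρ.re) (h1 : ρ.re < 1) {L : ℝ} (hL : 0 < L) (t u : ℝ) :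
    kap ρ (t - u / L) = ∫ v in Ioi (0:ℝ), (L * ep (-(3/4) * L * v) * kc ((ρ.re - 1/2) * L * v)) *
      cs (v * (L * (t - ρ.im) - u)) := by
  have key : ∀ d : ℝ, 0 < d → L * (∫ v in Ioi (0:ℝ), ep (-(d*L) * v) * cs (v * (L * (t - ρ.im) - u))) =
      pp d (t - u / L - ρ.im) := by
    intro d hd
    rw [pp_int (by positivity)]
    unfold pp
    have e : L * (t - ρ.im) - u = L * (t - u / L - ρ.im) := by field_simp; ring
    rw [e]
    have : d ^ 2 + (t - u / L - ρ.im) ^ 2 ≠ 0 := by positivity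
    rw [show (d * L) ^ 2 + (L * (t - u / L - ρ.im)) ^ 2 = L ^ 2 * (d ^ 2 + (t - u / L - ρ.im) ^ 2) by ring]
    field_simp
  have ii : ∀ d : ℝ, 0 < d → Integrable (fun v => ep (-(d*L) * v) * cs (v * (L * (t - ρ.im) - u)))
      (volume.restrict (Ioi 0)) := by
    intro d hd
    exact (exp_integrableOn (show 0 < d * L by positivity)).mul_bdd (c := 1) (by fun_prop)
      (Eventually.of_forall fun y => Real.abs_cos_le_one _)
  have h2 : ∀ v : ℝ, (L * ep (-(3/4) * L * v) * kc ((ρ.re - 1/2) * L * v)) *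
      cs (v * (L * (t - ρ.im) - u)) =
      (L/2) * (ep (-((5/4 - ρ.re)*L) * v) * cs (v * (L * (t - ρ.im) - u))) +
      (L/2) * (ep (-((1/4 + ρ.re)*L) * v) * cs (v * (L * (t - ρ.im) - u))) := by
    intro v
    rw [Real.cosh_eq, show -((5/4 - ρ.re)*L) * v = -(3/4) * L * v + (ρ.re - 1/2) * L * v by ring,
      show -((1/4 + ρ.re)*L) * v = -(3/4) * L * v + -((ρ.re - 1/2) * L * v) by ring, Real.exp_add, Real.exp_add]
    ring
  simp only [h2]
  rw [integral_add ((ii _ (by linarith)).const_mul _) ((ii _ (by linarith)).const_mul _), integral_const_mul,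
    integral_const_mul, kap, ← key _ (by linarith : 0 < 5/4 - ρ.re), ← key _ (by linarith : 0 < 1/4 + ρ.re)]
  ring

lemma zeros_finite (R : ℝ) : {ρ : ℂ | XX ρ = 0 ∧ ‖ρ‖ ≤ R}.Finite := by
  obtain ⟨A, -, hG⟩ := XX_Gro
  exact H_finite XX_diff XX_zero hG R

lemma zeros_countable : Countable {ρ : ℂ | XX ρ = 0} := by
  have : {ρ : ℂ | XX ρ = 0} = ⋃ n : ℕ, {ρ : ℂ | XX ρ = 0 ∧ ‖ρ‖ ≤ n} := by
    ext ρ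
    simp only [mem_iUnion, Set.mem_ofPred_eq]
    exact ⟨fun h => (exists_nat_ge ‖ρ‖).imp fun n hn => ⟨h, hn⟩, fun ⟨n, h, _⟩ => h⟩
  rw [this]
  exact (countable_iUnion fun n : ℕ => (zeros_finite (n:ℝ)).countable).to_subtype

lemma weight_integrable : Integrable fun u : ℝ => (1 + |u|) ^ eB / (1 + u ^ 2) := by
  have h := (integrable_one_add_norm (E := ℝ) (μ := volume) (r := 21/20) (by simp; norm_num)).const_mul 2
  refine h.mono' ?_ (Eventually.of_forall fun u => ?_)
  · exact (Continuous.div ((by fun_prop : Continuous fun u : ℝ => 1 + |u|).rpow_const (fun u => Or.inr (by norm_num)))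
      (by fun_prop) (fun u => by positivity)).aestronglyMeasurable
  · have h1 : 0 < 1 + |u| := by positivity
    rw [Real.norm_of_nonneg (by positivity), Real.norm_eq_abs, div_le_iff₀ (by positivity),
      show eB = -(21/20) + 2 by norm_num, Real.rpow_add h1]
    have h2 : (1 + |u|) ^ (2:ℝ) ≤ 2 * (1 + u ^ 2) := by
      rw [Real.rpow_two]; nlinarith [sq_nonneg (1 - |u|), sq_abs u]
    have h3 : 0 ≤ (1 + |u|) ^ (-(21/20):ℝ) := by positivity
    nlinarith

lemma RR_growth (t : ℝ) {L : ℝ} (hL : 1 ≤ L) : ∃ C, 0 < C ∧ ∀ u, |RR (t - u / L)| ≤ C * (1 + |u|) ^ eB := by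
  obtain ⟨C, hC, h⟩ := GG_diff
  obtain ⟨D, hD⟩ := DD_bdd
  have hD0 := (abs_nonneg _).trans (hD 0)
  refine ⟨C + D + |GG t|, by positivity, fun u => ?_⟩
  have h1 := h t (u / L)
  have h2 := hD (t - u / L)
  have e : RR (t - u / L) = (GG (t - u / L) - GG t) + GG t - DD (t - u / L) := by unfold GG; ring
  have h3 : (1 + |u / L|) ^ eB ≤ (1 + |u|) ^ eB := by
    apply Real.rpow_le_rpow (by positivity) _ (by norm_num)
    rw [abs_div, abs_of_pos (by linarith : 0 < L)]
    have := div_le_self (abs_nonneg u) hL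
    linarith
  have h4 : (1 + |t|) ^ neC ≤ 1 := Real.rpow_le_one_of_one_le_of_nonpos (by linarith [abs_nonneg t]) (by norm_num)
  have h5 : 1 ≤ (1 + |u|) ^ eB := Real.one_le_rpow (by linarith [abs_nonneg u]) (by norm_num)
  have h6 : C * (1 + |u / L|) ^ eB * (1 + |t|) ^ neC ≤ C * (1 + |u|) ^ eB := by
    calc _ ≤ C * (1 + |u / L|) ^ eB * 1 := by gcongr
      _ ≤ _ := by rw [mul_one]; gcongr
  rw [e]
  have h7 := abs_sub (GG (t - u / L) - GG t + GG t) (DD (t - u / L))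
  have h8 := abs_add_le (GG (t - u / L) - GG t) (GG t)
  have h9 : D + |GG t| ≤ (D + |GG t|) * (1 + |u|) ^ eB := le_mul_of_one_le_right (by positivity) h5
  linarith

lemma hasSum_zeros_iff {f : ℂ → ℝ} (hf : ∀ ρ, XX ρ ≠ 0 → f ρ = 0) {a : ℝ} :
    HasSum (fun ρ : {ρ : ℂ | XX ρ = 0} => f ρ) a ↔ HasSum f a :=
  hasSum_subtype_iff_of_support_subset fun ρ hρ => by
    by_contra h; exact hρ (hf ρ h)

lemma E_mul_integrable {E g : ℝ → ℝ} (hE : Continuous E) (hg : Continuous g) {K C : ℝ} (hK : ∀ u, |E u| ≤ K / (1 + u ^ 2))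
    (hC : ∀ u, |g u| ≤ C * (1 + |u|) ^ eB) : Integrable fun u => E u * g u := by
  refine (weight_integrable.const_mul (K * C)).mono' (hE.mul hg).aestronglyMeasurable (Eventually.of_forall fun u => ?_)
  rw [norm_mul, Real.norm_eq_abs, Real.norm_eq_abs]
  calc |E u| * |g u| ≤ (K / (1 + u ^ 2)) * (C * (1 + |u|) ^ eB) :=
        mul_le_mul (hK u) (hC u) (abs_nonneg _) ((abs_nonneg _).trans (hK u))
    _ = _ := by ring

lemma conv_zero {E : ℝ → ℝ} (hE : Continuous E) {K : ℝ} (hK : ∀ u, |E u| ≤ K / (1 + u ^ 2)) {L : ℝ} (hL : 1 ≤ L) (t : ℝ) :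
    HasSum (fun ρ : ℂ => mm ρ * ∫ u, E u * kap ρ (t - u / L)) (∫ u, E u * RR (t - u / L)) := by
  obtain ⟨C, hC, h⟩ := RR_growth t hL
  have hs : ∀ s, HasSum (fun ρ : {ρ : ℂ | XX ρ = 0} => mm ρ * kap ρ s) (RR s) := fun s =>
    (hasSum_zeros_iff (f := fun ρ => mm ρ * kap ρ s) fun ρ h => by simp [mm_zero h]).2 (hasSum_kap s)
  rw [← hasSum_zeros_iff fun ρ h => by simp [mm_zero h]]
  have := zeros_countable
  have hcts : ∀ ρ, Continuous fun u : ℝ => E u * (mm ρ * kap ρ (t - u / L)) := fun ρ => by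
    have := kap_cont ρ
    fun_prop
  have key := hasSum_integral_of_dominated_convergence (μ := volume) (F := fun (ρ : {ρ : ℂ | XX ρ = 0}) u => E u * (mm ρ * kap ρ (t - u / L)))
    (f := fun u => E u * RR (t - u / L)) (fun ρ u => |E u| * (mm ρ * kap ρ (t - u / L)))
    (fun ρ => (hcts ρ).aestronglyMeasurable) (fun ρ => Eventually.of_forall fun u => by
      rw [norm_mul, Real.norm_eq_abs, Real.norm_of_nonneg (mm_kap_nonneg _ _)])
    (Eventually.of_forall fun u => ((hs _).summable.mul_left _))
    (by
      have : (fun u => ∑' ρ : {ρ : ℂ | XX ρ = 0}, |E u| * (mm ρ * kap ρ (t - u / L))) = fun u => |E u| * RR (t - u / L) := by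
        funext u; exact ((hs _).mul_left _).tsum_eq
      rw [this]
      have := RR_cont
      exact E_mul_integrable hE.abs (by fun_prop) (fun u => by rw [abs_abs]; exact hK u) h)
    (Eventually.of_forall fun u => ((hs _).mul_left _))
  refine (congrArg (fun f : {ρ : ℂ | XX ρ = 0} → ℝ => HasSum f _) (funext fun ρ => ?_)).mpr key
  rw [← integral_const_mul]
  congr 1; funext u; ring

lemma conv_DD {E : ℝ → ℝ} (hE : Continuous E) {K : ℝ} (hK : ∀ u, |E u| ≤ K / (1 + u ^ 2)) (L : ℝ) (t : ℝ) :
    HasSum (fun n : ℕ => ArithmeticFunction.vonMangoldt n * (n:ℝ) ^ neA * ∫ u, E u * cs ((t - u / L) * lg n))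
      (∫ u, E u * DD (t - u / L)) := by
  have hEi : Integrable E := by
    refine (integrable_inv_one_add_sq.const_mul K).mono' hE.aestronglyMeasurable (Eventually.of_forall fun x => ?_)
    rw [Real.norm_eq_abs, ← div_eq_mul_inv]; exact hK x
  have hs : ∀ s, HasSum (fun n : ℕ => ArithmeticFunction.vonMangoldt n * (n:ℝ) ^ neA * cs (s * lg n)) (DD s) :=
    fun s => (Summable.of_norm_bounded summable_DD (DD_term_le s)).hasSum
  have key := hasSum_integral_of_dominated_convergence (μ := volume) (F := fun (n : ℕ) u => E u *
      (ArithmeticFunction.vonMangoldt n * (n:ℝ) ^ neA * cs ((t - u / L) * lg n)))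
    (f := fun u => E u * DD (t - u / L)) (fun n u => |E u| * (ArithmeticFunction.vonMangoldt n * (n:ℝ) ^ neA))
    (fun n => (by fun_prop : Continuous _).aestronglyMeasurable) (fun n => Eventually.of_forall fun u => by
      rw [norm_mul, Real.norm_eq_abs]; exact mul_le_mul_of_nonneg_left (DD_term_le _ n) (abs_nonneg _))
    (Eventually.of_forall fun u => summable_DD.mul_left _)
    (by simp only [tsum_mul_left]; exact hEi.abs.mul_const _)
    (Eventually.of_forall fun u => ((hs _).mul_left _))
  refine (congrArg (fun f : ℕ → ℝ => HasSum f _) (funext fun ρ => ?_)).mpr key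
  rw [← integral_const_mul]
  congr 1; funext u; ring

noncomputable def EQ (q : ℝ → ℝ) (L α : ℝ) : ℝ := q α * ep (3/4 * L * α)
noncomputable def PH (q : ℝ → ℝ) (A L : ℝ) (ρ : ℂ) (t : ℝ) : ℝ :=
  L * ∫ α in (0:ℝ)..A, q α * kc ((ρ.re - 1/2) * L * α) * cs (α * (L * (t - ρ.im)))
noncomputable def cf (q : ℝ → ℝ) (A T : ℝ) (n : ℕ) : ℝ :=
  ArithmeticFunction.vonMangoldt n * (n:ℝ) ^ neG * q (min (lg n / lg T) A)
noncomputable def SS (q : ℝ → ℝ) (A T t : ℝ) : ℝ :=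
  ∑ n ∈ Finset.range (⌊T⌋₊ + 1), cf q A T n * cs (t * lg n)

lemma cd_deriv {q : ℝ → ℝ} (hq : ContDiff ℝ 2 q) : ContDiff ℝ 1 (deriv q) := by
  have : ContDiff ℝ (1 + 1) q := by simpa [one_add_one_eq_two] using hq
  exact (contDiff_succ_iff_deriv.1 this).2.2

lemma cont_bdd {F : ℝ → ℝ} (hF : Continuous F) (A : ℝ) : ∃ M, 0 < M ∧ ∀ v ∈ Icc 0 A, |F v| ≤ M := by
  obtain ⟨M, hM⟩ := isCompact_Icc.bddAbove_image (hF.abs.continuousOn (s := Icc 0 A))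
  exact ⟨max M 1, by positivity, fun x hx => (hM (mem_image_of_mem _ hx)).trans (le_max_left _ _)⟩

/-- transform of `q * (exponential or cosh type factor)` -/
lemma EE_prod_bound {q : ℝ → ℝ} (hq : ContDiff ℝ 2 q) {A : ℝ} (hA : 0 ≤ A) (hqA : q A = 0) :
    ∃ C, 0 < C ∧ ∀ (g : ℝ → ℝ) (c M : ℝ), ContDiff ℝ 2 g → 0 ≤ c → (∀ α ∈ Icc 0 A, |g α| ≤ M) →
      (∀ α ∈ Icc 0 A, |deriv g α| ≤ c * M) → (∀ α ∈ Icc 0 A, |deriv (deriv g) α| ≤ c ^ 2 * M) →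
      ∀ x, |EE (fun α => q α * g α) A x| ≤ C * (1 + c) ^ 2 * M / (1 + x ^ 2) := by
  have hq' := cd_deriv hq
  obtain ⟨M0, p0, g0⟩ := cont_bdd hq.continuous A
  obtain ⟨M1, p1, g1⟩ := cont_bdd hq'.continuous A
  obtain ⟨M2, p2, g2⟩ := cont_bdd (hq'.continuous_deriv le_rfl) A
  set N := M0 + M1 + M2 with hN
  refine ⟨2 * (1 + A) * (N * 4), by positivity, fun g c M hg hc b0 b1 b2 x => ?_⟩
  have hM : 0 ≤ M := (abs_nonneg _).trans (b0 0 ⟨le_rfl, hA⟩)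
  have hg' := cd_deriv hg
  have d1 : deriv (fun α => q α * g α) = fun α => deriv q α * g α + q α * deriv g α := by
    funext α
    exact ((hq.differentiable (by norm_num) α).hasDerivAt.mul (hg.differentiable (by norm_num) α).hasDerivAt).deriv
  have d2 : deriv (deriv (fun α => q α * g α)) = fun α => (deriv (deriv q) α * g α + deriv q α * deriv g α) +
      (deriv q α * deriv g α + q α * deriv (deriv g) α) := by
    rw [d1]; funext α
    have e1 := (hq.differentiable (by norm_num) α).hasDerivAt
    have e2 := (hg.differentiable (by norm_num) α).hasDerivAt
    have e3 := (hq'.differentiable (by norm_num) α).hasDerivAt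
    have e4 := (hg'.differentiable (by norm_num) α).hasDerivAt
    exact ((e3.mul e2).add (e1.mul e4)).deriv
  have hNc : ∀ (P Q x y : ℝ), |P| ≤ N → |x| ≤ y → |P * x| ≤ N * y := fun P _ x y h1 h2 => by
    rw [abs_mul]; exact mul_le_mul h1 h2 (abs_nonneg _) (by positivity)
  have m0 : ∀ α ∈ Icc 0 A, |q α| ≤ N := fun α h => (g0 α h).trans (by linarith)
  have m1 : ∀ α ∈ Icc 0 A, |deriv q α| ≤ N := fun α h => (g1 α h).trans (by linarith)
  have m2 : ∀ α ∈ Icc 0 A, |deriv (deriv q) α| ≤ N := fun α h => (g2 α h).trans (by linarith)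
  have hNp : 0 < N := by positivity
  have hNM : 0 ≤ N * M := by positivity
  have key := EE_bound (Q := fun α => q α * g α) (M := N * 4 * ((1 + c) ^ 2 * M)) (hq.mul hg) hA (by simp [hqA]) ?_ ?_ ?_ x
  · refine key.trans (le_of_eq ?_); ring
  · intro α h
    have := hNc _ 0 _ _ (m0 α h) (b0 α h)
    nlinarith [mul_nonneg hNM hc, mul_nonneg hNM (sq_nonneg c)]
  · intro α h
    rw [d1]
    have h1 := hNc _ 0 _ _ (m1 α h) (b0 α h)
    have h2 := hNc _ 0 _ _ (m0 α h) (b1 α h)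
    have := abs_add_le (deriv q α * g α) (q α * deriv g α)
    simp only []
    nlinarith [mul_nonneg hNM hc, mul_nonneg hNM (sq_nonneg c)]
  · intro α h
    rw [d2]
    have h1 := hNc _ 0 _ _ (m2 α h) (b0 α h)
    have h2 := hNc _ 0 _ _ (m1 α h) (b1 α h)
    have h3 := hNc _ 0 _ _ (m0 α h) (b2 α h)
    have a1 := abs_add_le (deriv (deriv q) α * g α + deriv q α * deriv g α) (deriv q α * deriv g α + q α * deriv (deriv g) α)
    have a2 := abs_add_le (deriv (deriv q) α * g α) (deriv q α * deriv g α)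
    have a3 := abs_add_le (deriv q α * deriv g α) (q α * deriv (deriv g) α)
    simp only []
    nlinarith [mul_nonneg hNM hc, mul_nonneg hNM (sq_nonneg c)]

lemma deriv_exp_c (c : ℝ) : deriv (fun α : ℝ => ep (c * α)) = fun α => c * ep (c * α) := by
  funext α
  have := ((hasDerivAt_id' α).const_mul c).exp
  rw [mul_one, mul_comm] at this
  exact this.deriv

lemma EQ_bound {q : ℝ → ℝ} (hq : ContDiff ℝ 2 q) {A : ℝ} (hA : 0 ≤ A) (hqA : q A = 0) :
    ∃ C, 0 < C ∧ ∀ L : ℝ, 1 ≤ L → ∀ x, |EE (EQ q L) A x| ≤ C * L ^ 2 * ep (3/4 * L * A) / (1 + x ^ 2) := by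
  obtain ⟨C, hC, h⟩ := EE_prod_bound hq hA hqA
  refine ⟨C * 4, by positivity, fun L hL x => ?_⟩
  have hL0 : 0 < L := by linarith
  have hle : ∀ α ∈ Icc 0 A, |ep (3/4 * L * α)| ≤ ep (3/4 * L * A) := fun α hα => by
    rw [Real.abs_exp]; apply Real.exp_le_exp.2; exact mul_le_mul_of_nonneg_left hα.2 (by positivity)
  have := h (fun α => ep (3/4 * L * α)) (3/4 * L) (ep (3/4 * L * A)) (by fun_prop) (by positivity) hle
    (fun α hα => by
      rw [deriv_exp_c, abs_mul, abs_of_nonneg (by positivity : 0 ≤ 3/4 * L)]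
      exact mul_le_mul_of_nonneg_left (hle α hα) (by positivity))
    (fun α hα => by
      rw [deriv_exp_c, deriv_const_mul_field, deriv_exp_c]
      simp only []
      rw [← mul_assoc, abs_mul, ← pow_two, abs_of_nonneg (by positivity : 0 ≤ (3/4 * L)^2)]
      exact mul_le_mul_of_nonneg_left (hle α hα) (by positivity)) x
  refine this.trans ?_
  have h2 : (1 + 3/4 * L) ^ 2 ≤ 4 * L ^ 2 := by nlinarith
  have h3 : C * (1 + 3/4 * L) ^ 2 ≤ C * 4 * L ^ 2 := by nlinarith
  gcongr

lemma conv_main {q : ℝ → ℝ} (hq : ContDiff ℝ 2 q) {A : ℝ} (hA : 0 < A) (hA1 : A < 1) (hqA : q A = 0) :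
    ∃ C, 0 < C ∧ ∀ T : ℝ, 3 ≤ T → ∀ t : ℝ, Summable (fun ρ : ℂ => mm ρ * PH q A (lg T) ρ t) ∧
      |(∑' ρ : ℂ, mm ρ * PH q A (lg T) ρ t) - q 0 * GG t + SS q A T t| ≤
        C * (lg T) ^ 2 * T ^ (3/4 * A) * (1 + |t|) ^ neC := by
  obtain ⟨C1, hC1, h1⟩ := EQ_bound hq hA.le hqA
  obtain ⟨C2, hC2, h2⟩ := GG_diff
  set Iw := ∫ u : ℝ, (1 + |u|) ^ eB / (1 + u ^ 2) with hIw
  have hIw0 : 0 ≤ Iw := integral_nonneg fun u => by positivity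
  refine ⟨C1 * C2 * (Iw + 1), by positivity, fun T hT t => ?_⟩
  set L := lg T with hLdef
  have hT0 : 0 < T := by linarith
  have hL : 1 ≤ L := by
    rw [hLdef, Real.le_log_iff_exp_le hT0]; linarith [Real.exp_one_lt_d9]
  have hL0 : 0 < L := by linarith
  have hexp : ep (3/4 * L * A) = T ^ (3/4 * A) := by
    rw [Real.rpow_def_of_pos hT0]; congr 1; ring
  set Q := EQ q L with hQ
  have hQc : ContDiff ℝ 2 Q := by
    rw [hQ]; unfold EQ; exact hq.mul (by fun_prop)
  have hQA : Q A = 0 := by simp [hQ, EQ, hqA]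
  set E := EE Q A with hE
  have hEc : Continuous E := EE_cont hQc.continuous A
  set K := C1 * L ^ 2 * ep (3/4 * L * A) with hK
  have hEK : ∀ u, |E u| ≤ K / (1 + u ^ 2) := h1 L hL
  have hpi := Real.pi_pos
  -- zeros
  have hz := (conv_zero hEc hEK hL t).mul_left (1 / pI)
  have hzt : ∀ ρ : ℂ, 1 / pI * (mm ρ * ∫ u, E u * kap ρ (t - u / L)) = mm ρ * PH q A L ρ t := by
    intro ρ
    by_cases hm : mm ρ = 0
    · simp [hm]
    obtain ⟨-, hr0, hr1⟩ := mm_pos_re hm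
    have hh : IntegrableOn (fun v => L * ep (-(3/4) * L * v) * kc ((ρ.re - 1/2) * L * v)) (Ioi 0) := by
      have e1 := (exp_integrableOn (show 0 < (5/4 - ρ.re) * L by apply mul_pos _ hL0; linarith)).const_mul (L/2)
      have e2 := (exp_integrableOn (show 0 < (1/4 + ρ.re) * L by apply mul_pos _ hL0; linarith)).const_mul (L/2)
      refine (e1.add e2).congr (Eventually.of_forall fun v => ?_)
      simp only [Pi.add_apply]
      rw [Real.cosh_eq, show -((5/4 - ρ.re)*L) * v = -(3/4) * L * v + (ρ.re - 1/2) * L * v by ring,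
        show -((1/4 + ρ.re)*L) * v = -(3/4) * L * v + -((ρ.re - 1/2) * L * v) by ring, Real.exp_add, Real.exp_add]
      ring
    have := EE_conv hQc hA.le hQA hh (L * (t - ρ.im))
    simp only [kap_int hr0 hr1 hL0]
    rw [hE, this, PH, ← intervalIntegral.integral_const_mul L]
    have hcan : ∀ I : ℝ, 1 / pI * (mm ρ * (pI * I)) = mm ρ * I := fun I => by field_simp
    rw [hcan]
    congr 2
    funext v
    have : ep (3/4 * L * v) * ep (-(3/4) * L * v) = 1 := by rw [← Real.exp_add]; simp
    simp only [hQ, EQ]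
    linear_combination q v * L * kc ((ρ.re - 1/2) * L * v) * cs (v * (L * (t - ρ.im))) * this
  simp only [hzt] at hz
  refine ⟨hz.summable, ?_⟩
  rw [hz.tsum_eq]
  -- primes
  have hd := (conv_DD hEc hEK L t).mul_left (1 / pI)
  have hdt : ∀ n : ℕ, 1 / pI * (ArithmeticFunction.vonMangoldt n * (n:ℝ) ^ neA * ∫ u, E u * cs ((t - u / L) * lg n))
      = cf q A T n * cs (t * lg n) := by
    intro n
    by_cases hn : n = 0
    · simp [hn, cf]
    have hn0 : (0:ℝ) < n := by positivity
    have hn1 : (1:ℝ) ≤ n := by exact_mod_cast Nat.one_le_iff_ne_zero.2 hn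
    have hlog : 0 ≤ lg n := Real.log_nonneg hn1
    have e : ∀ u : ℝ, (t - u / L) * lg n = lg n / L * (L * t - u) := fun u => by field_simp
    simp only [e]
    rw [hE, EE_inversion' hQc hA.le hQA (by positivity), cf, ← hLdef]
    rw [show lg n / L * (L * t) = t * lg n by field_simp]
    by_cases hc : lg n / L ≤ A
    · rw [min_eq_left hc, hQ, EQ, show 3/4 * L * (lg n / L) = lg n * (3/4) by field_simp, ← Real.rpow_def_of_pos hn0,
        show neG = -(5/4) + 3/4 by norm_num, Real.rpow_add hn0]
      field_simp
    · rw [min_eq_right (le_of_not_ge hc), hQA, hqA]; simp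
  simp only [hdt] at hd
  have hdS : (1 / pI) * ∫ u, E u * DD (t - u / L) = SS q A T t := by
    rw [← hd.tsum_eq, SS]
    refine tsum_eq_sum fun n hn => ?_
    have hn1 : T < n := by
      rw [Finset.mem_range, not_lt] at hn
      exact (Nat.lt_floor_add_one T).trans_le (by exact_mod_cast hn)
    have : 1 ≤ lg n / lg T := by
      rw [one_le_div (by rw [← hLdef]; exact hL0)]
      exact Real.log_le_log hT0 hn1.le
    rw [cf, min_eq_right (by linarith), hqA]; simp
  -- gamma
  have hGc := GG_cont
  have hi : ∫ u, E u = pI * q 0 := by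
    have := EE_inversion hQc hA.le hQA le_rfl
    simp only [zero_mul, Real.cos_zero, mul_one, min_eq_left hA.le] at this
    rw [hE, this, hQ, EQ]; simp
  have hEi : Integrable E := EE_integrable hQc hA.le hQA
  have hdiffb : ∀ u, |GG (t - u / L) - GG t| ≤ (C2 * (1 + |t|) ^ neC) * (1 + |u|) ^ eB := by
    intro u
    refine (h2 t (u / L)).trans ?_
    have h3 : (1 + |u / L|) ^ eB ≤ (1 + |u|) ^ eB := by
      apply Real.rpow_le_rpow (by positivity) _ (by norm_num)
      rw [abs_div, abs_of_pos hL0]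
      have := div_le_self (abs_nonneg u) hL
      linarith
    calc _ ≤ C2 * (1 + |u|) ^ eB * (1 + |t|) ^ neC := by gcongr
      _ = _ := by ring
  have hIG : Integrable fun u => E u * (GG (t - u / L) - GG t) := E_mul_integrable hEc (by fun_prop) hEK hdiffb
  obtain ⟨D, hD⟩ := DD_bdd
  have hDc := DD_cont
  have hID : Integrable fun u => E u * DD (t - u / L) := by
    refine E_mul_integrable hEc (by fun_prop) hEK (C := D) (fun u => (hD _).trans ?_)
    exact le_mul_of_one_le_right ((abs_nonneg _).trans (hD 0)) (Real.one_le_rpow (by linarith [abs_nonneg u]) (by norm_num))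
  have hsplit : ∫ u, E u * RR (t - u / L) = (∫ u, E u * (GG (t - u / L) - GG t)) + (∫ u, E u) * GG t - ∫ u, E u * DD (t - u / L) := by
    rw [← integral_mul_const, ← integral_add hIG (hEi.mul_const _)]
    have h5 := integral_sub (hIG.add (hEi.mul_const (GG t))) hID
    simp only [Pi.add_apply] at h5
    rw [← h5]
    congr 1; funext u; simp only [GG]; ring
  have hbound : |∫ u, E u * (GG (t - u / L) - GG t)| ≤ K * (C2 * (1 + |t|) ^ neC) * Iw := by
    rw [hIw, ← integral_const_mul]
    rw [← Real.norm_eq_abs]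
    refine norm_integral_le_of_norm_le (weight_integrable.const_mul _) (Eventually.of_forall fun u => ?_)
    rw [norm_mul, Real.norm_eq_abs, Real.norm_eq_abs]
    calc _ ≤ (K / (1 + u ^ 2)) * ((C2 * (1 + |t|) ^ neC) * (1 + |u|) ^ eB) :=
          mul_le_mul (hEK u) (hdiffb u) (abs_nonneg _) ((abs_nonneg _).trans (hEK u))
      _ = _ := by ring
  have hfin : 1 / pI * (∫ u, E u * RR (t - u / L)) - q 0 * GG t + SS q A T t =
      1 / pI * ∫ u, E u * (GG (t - u / L) - GG t) := by
    rw [hsplit, ← hdS, hi]; field_simp; ring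
  rw [hfin, abs_mul, abs_of_pos (by positivity)]
  have hpi1 : 1 / pI ≤ 1 := by rw [div_le_one hpi]; linarith [Real.pi_gt_three]
  calc _ ≤ 1 * (K * (C2 * (1 + |t|) ^ neC) * Iw) := mul_le_mul hpi1 hbound (abs_nonneg _) zero_le_one
    _ ≤ 1 * (K * (C2 * (1 + |t|) ^ neC) * (Iw + 1)) := by
        gcongr; linarith
    _ = _ := by rw [hK, hexp]; ring

lemma band_finite (a b : ℝ) : {ρ : ℂ | XX ρ = 0 ∧ a < ρ.im ∧ ρ.im ≤ b}.Finite := by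
  refine (zeros_finite (1 + (|a| + |b|))).subset fun ρ h => ⟨h.1, ?_⟩
  obtain ⟨h1, h2, h3⟩ := h
  obtain ⟨-, hr0, hr1⟩ := (XX_zero_iff ρ).1 h1
  refine (Complex.norm_le_abs_re_add_abs_im ρ).trans (add_le_add ?_ ?_)
  · rw [abs_of_pos hr0]; exact hr1.le
  · exact abs_le_max_abs_abs h2.le h3 |>.trans (max_le (by linarith [abs_nonneg b]) (by linarith [abs_nonneg a]))

noncomputable def Bd (a b : ℝ) : Finset ℂ := (band_finite a b).toFinset

lemma mem_Bd {a b : ℝ} {ρ : ℂ} : ρ ∈ Bd a b ↔ XX ρ = 0 ∧ a < ρ.im ∧ ρ.im ≤ b := by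
  simp [Bd]

noncomputable def Hs : ℝ := ∑' ρ : ℂ, mm ρ * (1 + ‖ρ‖) ^ neA

lemma Hs_summable : Summable fun ρ : ℂ => mm ρ * (1 + ‖ρ‖) ^ neA := by
  obtain ⟨A, hA, hG⟩ := XX_Gro
  exact H_summable XX_diff XX_zero hA.le hG

lemma Hs_nonneg : 0 ≤ Hs := tsum_nonneg fun ρ => mul_nonneg (mm_nonneg ρ) (by positivity)

lemma far_pt {ρ : ℂ} (h0 : 0 < ρ.re) (h1 : ρ.re < 1) {t r K : ℝ} (hr : 1 ≤ r) (ht : |t| ≤ K * r) (hK : 0 ≤ K)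
    (hf : r ≤ |t - ρ.im|) :
    1 / (1 + (t - ρ.im) ^ 2) ≤ r ^ neF * (3 + K) ^ eA * (1 + ‖ρ‖) ^ neA := by
  set x := |t - ρ.im| with hx
  have hx1 : 1 ≤ x := hr.trans hf
  have hx0 : 0 < x := by linarith
  have hn : 1 + ‖ρ‖ ≤ (3 + K) * x := by
    have a1 := Complex.norm_le_abs_re_add_abs_im ρ
    rw [abs_of_pos h0] at a1
    have a2 : |ρ.im| ≤ |t| + x := by
      have := abs_sub t (t - ρ.im)
      rw [sub_sub_cancel] at this; exact this
    nlinarith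
  have e1 : (t - ρ.im) ^ 2 = x ^ 2 := (sq_abs _).symm
  have e2 : 1 / (1 + (t - ρ.im) ^ 2) ≤ x ^ (-2:ℝ) := by
    rw [e1, Real.rpow_neg hx0.le, Real.rpow_two, ← one_div]
    apply one_div_le_one_div_of_le (by positivity); linarith
  have e3 : x ^ (-2:ℝ) = x ^ neF * x ^ neA := by
    rw [← Real.rpow_add hx0]; norm_num
  have e4 : x ^ neF ≤ r ^ neF := Real.rpow_le_rpow_of_nonpos (by linarith) hf (by norm_num)
  have e5 : x ^ neA ≤ (3 + K) ^ eA * (1 + ‖ρ‖) ^ neA := by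
    have : ((3 + K) * x) ^ neA ≤ (1 + ‖ρ‖) ^ neA :=
      Real.rpow_le_rpow_of_nonpos (by positivity) hn (by norm_num)
    rw [Real.mul_rpow (by positivity) hx0.le] at this
    have h3 : (3 + K) ^ eA * (3 + K) ^ neA = 1 := by
      rw [← Real.rpow_add (by positivity)]; norm_num
    calc x ^ neA = (3 + K) ^ eA * ((3 + K) ^ neA * x ^ neA) := by
          rw [← mul_assoc, h3, one_mul]
      _ ≤ _ := by gcongr
  calc _ ≤ x ^ neF * x ^ neA := e3 ▸ e2
    _ ≤ r ^ neF * ((3 + K) ^ eA * (1 + ‖ρ‖) ^ neA) := by gcongr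
    _ = _ := by ring

lemma pp_integral_le {d : ℝ} (hd : 0 < d) (a b c : ℝ) : ∫ t in a..b, pp d (t - c) ≤ pI := by
  have h : ∀ t ∈ uIcc a b, HasDerivAt (fun t => Real.arctan ((t - c) / d)) (pp d (t - c)) t := by
    intro t _
    have := (((hasDerivAt_id' t).sub_const c).div_const d).arctan
    refine this.congr_deriv ?_
    unfold pp
    have : d ^ 2 + (t - c) ^ 2 ≠ 0 := by positivity
    field_simp
  have hc : Continuous fun t => pp d (t - c) := by
    unfold pp; exact Continuous.div (by fun_prop) (by fun_prop) (fun t => by positivity)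
  rw [intervalIntegral.integral_eq_sub_of_hasDerivAt h (hc.intervalIntegrable _ _)]
  linarith [Real.arctan_lt_pi_div_two ((b - c) / d), Real.neg_pi_div_two_lt_arctan ((a - c) / d)]

lemma kap_integral_le {ρ : ℂ} (h0 : 0 < ρ.re) (h1 : ρ.re < 1) (a b : ℝ) : ∫ t in a..b, kap ρ t ≤ pI := by
  have hc : ∀ d : ℝ, 0 < d → Continuous fun t => pp d (t - ρ.im) := fun d hd => by
    unfold pp; exact Continuous.div (by fun_prop) (by fun_prop) (fun t => by positivity)
  unfold kap
  rw [intervalIntegral.integral_div, intervalIntegral.integral_add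
    ((hc _ (by linarith)).intervalIntegrable _ _) ((hc _ (by linarith)).intervalIntegrable _ _)]
  linarith [pp_integral_le (show 0 < 5/4 - ρ.re by linarith) a b ρ.im, pp_integral_le (show 0 < 1/4 + ρ.re by linarith) a b ρ.im]

lemma log_three {T : ℝ} (hT : 3 ≤ T) : 1 ≤ lg T := by
  rw [Real.le_log_iff_exp_le (by linarith)]; linarith [Real.exp_one_lt_d9]

open Classical in
lemma hasSum_ite_fin (s : Finset ℂ) (f : ℂ → ℝ) : HasSum (fun ρ => if ρ ∈ s then f ρ else 0) (∑ ρ ∈ s, f ρ) := by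
  have h : HasSum (fun ρ => if ρ ∈ s then f ρ else 0) (∑ ρ ∈ s, if ρ ∈ s then f ρ else 0) :=
    hasSum_sum_of_ne_finset_zero (fun ρ h => by simp [h])
  rwa [Finset.sum_congr rfl (fun ρ h => by rw [if_pos h])] at h

lemma count_lower {η : ℝ} (hη : 0 < η) (hη1 : η < 1/4) :
    ∀ᶠ T in atTop, (1 - 3 * η) * (T * lg T / (2 * pI)) ≤ ∑ ρ ∈ Bd T (2 * T), mm ρ := by
  obtain ⟨c₀, C, hC, hG⟩ := GG_asymp
  obtain ⟨D, hD⟩ := DD_bdd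
  set K := 2 / η with hK
  have hK0 : 0 < K := by positivity
  set C1 := 20 * ((3 + K) ^ eA * Hs) with hC1
  have hC10 : 0 ≤ C1 := by have := Hs_nonneg; positivity
  set C2 := C + D + |c₀| with hC2
  have hev : ∀ᶠ T : ℝ in atTop, 2 * (C1 + C2) / η ≤ lg T := Real.tendsto_log_atTop.eventually_ge_atTop _
  filter_upwards [hev, eventually_ge_atTop 3, eventually_ge_atTop (1/η)] with T hT1 hT3 hTη
  set L := lg T with hL
  have hL1 : 1 ≤ L := log_three hT3
  have hηT : 1 ≤ η * T := by rw [div_le_iff₀ hη] at hTη; linarith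
  have hup : ∀ t ∈ Icc ((1 + η) * T) ((2 - η) * T), RR t ≤ (∑ ρ ∈ Bd T (2 * T), mm ρ * kap ρ t) + C1 := by
    intro t ht
    have ht0 : 0 < t := lt_of_lt_of_le (by positivity) ht.1
    have hs1 := hasSum_ite_fin (Bd T (2 * T)) fun ρ => mm ρ * kap ρ t
    have hs2 := (Hs_summable.hasSum.mul_left (20 * (3 + K) ^ eA))
    have hle := hasSum_le (fun ρ => ?_) (hasSum_kap t) (hs1.add hs2)
    · refine hle.trans (le_of_eq ?_); rw [hC1, Hs]; ring
    · by_cases hm : mm ρ = 0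
      · simp [hm]
      obtain ⟨hz, h0, h1⟩ := mm_pos_re hm
      have hmn := mm_nonneg ρ
      by_cases hb : ρ ∈ Bd T (2 * T)
      · rw [if_pos hb]; simp only [le_add_iff_nonneg_right]; positivity
      · rw [if_neg hb, zero_add]
        have hb' : ρ.im ≤ T ∨ 2 * T < ρ.im := by
          by_contra hcon; push Not at hcon; exact hb (mem_Bd.2 ⟨hz, hcon.1, hcon.2⟩)
        have hfar : η * T ≤ |t - ρ.im| := by
          rcases hb' with h | h
          · exact le_trans (by linarith [ht.1]) (le_abs_self _)
          · exact le_trans (by linarith [ht.2]) (neg_le_abs _)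
        have htK : |t| ≤ K * (η * T) := by
          rw [abs_of_pos ht0, hK]
          have : 2 / η * (η * T) = 2 * T := by field_simp
          rw [this]; nlinarith [ht.2]
        have hp := far_pt h0 h1 hηT htK hK0.le hfar
        have hr : (η * T) ^ neF ≤ 1 := Real.rpow_le_one_of_one_le_of_nonpos hηT (by norm_num)
        have hk := (kap_bounds h0 h1 t).2
        have : kap ρ t ≤ 20 * (3 + K) ^ eA * (1 + ‖ρ‖) ^ neA := by
          calc kap ρ t ≤ 20 * (1 / (1 + (t - ρ.im) ^ 2)) := by rw [mul_one_div]; exact hk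
            _ ≤ 20 * (1 * (3 + K) ^ eA * (1 + ‖ρ‖) ^ neA) := by
                gcongr
                exact hp.trans (by gcongr)
            _ = _ := by ring
        calc mm ρ * kap ρ t ≤ mm ρ * _ := mul_le_mul_of_nonneg_left this hmn
          _ = _ := by ring
  have hlow : ∀ t ∈ Icc ((1 + η) * T) ((2 - η) * T), L / 2 - C2 ≤ RR t := by
    intro t ht
    have htT : T ≤ t := le_trans (by nlinarith) ht.1
    have ht0 : 0 < t := by linarith
    have h1 := (abs_le.1 (hG t)).1
    have h2 := (abs_le.1 (hD t)).2
    have h3 : (1 + |t|) ^ neE ≤ 1 := Real.rpow_le_one_of_one_le_of_nonpos (by linarith [abs_nonneg t]) (by norm_num)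
    have h4 : L ≤ lg (1 + |t|) := Real.log_le_log (by linarith) (by rw [abs_of_pos ht0]; linarith)
    have h5 : C * (1 + |t|) ^ neE ≤ C := mul_le_of_le_one_right hC.le h3
    have h6 : RR t = GG t - DD t := by unfold GG; ring
    have h7 := neg_abs_le c₀
    rw [h6]; linarith
  set a := (1 + η) * T with ha
  set b := (2 - η) * T with hb
  have hab : a ≤ b := by rw [ha, hb]; nlinarith
  have hkc := kap_cont
  have hmono : ∫ t in a..b, (L / 2 - C2) ≤ ∫ t in a..b, ((∑ ρ ∈ Bd T (2 * T), mm ρ * kap ρ t) + C1) := by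
    refine intervalIntegral.integral_mono_on hab (by simp) ?_ fun t ht => (hlow t ht).trans (hup t ht)
    exact Continuous.intervalIntegrable (by fun_prop) _ _
  rw [intervalIntegral.integral_const, intervalIntegral.integral_add ci (by simp),
    intervalIntegral.integral_const, intervalIntegral.integral_finsetSum (fun ρ _ => Continuous.intervalIntegrable (by fun_prop) _ _)] at hmono
  have hsum : ∑ ρ ∈ Bd T (2 * T), ∫ t in a..b, mm ρ * kap ρ t ≤ (∑ ρ ∈ Bd T (2 * T), mm ρ) * pI := by
    rw [Finset.sum_mul]
    refine Finset.sum_le_sum fun ρ hρ => ?_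
    rw [intervalIntegral.integral_const_mul]
    obtain ⟨-, h0, h1⟩ := (XX_zero_iff ρ).1 (mem_Bd.1 hρ).1
    exact mul_le_mul_of_nonneg_left (kap_integral_le h0 h1 a b) (mm_nonneg ρ)
  have hba : b - a = (1 - 2 * η) * T := by rw [ha, hb]; ring
  rw [hba, smul_eq_mul, smul_eq_mul] at hmono
  have hfin : (1 - 2 * η) * T * (L / 2 - C2 - C1) ≤ (∑ ρ ∈ Bd T (2 * T), mm ρ) * pI := by linarith
  have hT0 : 0 < T := by linarith
  rw [div_le_iff₀ hη] at hT1
  have hC20 : 0 ≤ C2 := by have := (abs_nonneg _).trans (hD 0); positivity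
  have : (1 - 3 * η) * (T * L / 2) ≤ (1 - 2 * η) * T * (L / 2 - C2 - C1) := by
    have : (1 - 2 * η) * T * (L / 2 - C2 - C1) - (1 - 3 * η) * (T * L / 2) = T * (η * L / 2 - (1 - 2 * η) * (C1 + C2)) := by ring
    have h2 : 0 ≤ η * L / 2 - (1 - 2 * η) * (C1 + C2) := by nlinarith
    nlinarith
  have hpi := Real.pi_pos
  calc (1 - 3 * η) * (T * L / (2 * pI)) = (1 - 3 * η) * (T * L / 2) / pI := by field_simp
    _ ≤ _ := by rw [div_le_iff₀ hpi]; linarith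

open ArithmeticFunction (vonMangoldt)

lemma log_factorial_eq (n : ℕ) : lg (n.factorial) = ∑ d ∈ Finset.Ioc 0 n, vonMangoldt d * ((n / d : ℕ) : ℝ) := by
  have h1 : lg (n.factorial) = ∑ k ∈ Finset.Ioc 0 n, lg k := by
    induction n with
    | zero => simp
    | succ m ih =>
      rw [Nat.factorial_succ, Nat.cast_mul, Real.log_mul (by positivity) (by positivity), ih,
        Finset.sum_Ioc_succ_top (Nat.zero_le m), add_comm]
  have h2 : ∀ k ∈ Finset.Ioc 0 n, lg k = ∑ d ∈ Finset.Ioc 0 n, if d ∣ k then vonMangoldt d else 0 := by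
    intro k hk
    rw [Finset.mem_Ioc] at hk
    rw [← ArithmeticFunction.vonMangoldt_sum, ← Finset.sum_filter]
    refine Finset.sum_congr ?_ fun _ _ => rfl
    ext d
    simp only [Nat.mem_divisors, Finset.mem_filter, Finset.mem_Ioc]
    constructor
    · rintro ⟨h, h'⟩
      exact ⟨⟨Nat.pos_of_dvd_of_pos h hk.1, (Nat.le_of_dvd hk.1 h).trans hk.2⟩, h⟩
    · rintro ⟨_, h⟩; exact ⟨h, by omega⟩
  rw [h1, Finset.sum_congr rfl h2, Finset.sum_comm]
  refine Finset.sum_congr rfl fun d _ => ?_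
  rw [← Finset.sum_filter, Finset.sum_const, Nat.Ioc_filter_dvd_card_eq_div, nsmul_eq_mul, mul_comm]

lemma mertens : ∃ C, 0 < C ∧ ∀ n : ℕ, 1 ≤ n → |∑ d ∈ Finset.Ioc 0 n, vonMangoldt d / d - lg n| ≤ C := by
  refine ⟨lg 4 + 5, by positivity, fun n hn => ?_⟩
  have hn0 : (0:ℝ) < n := by positivity
  have hn1 : (1:ℝ) ≤ n := by exact_mod_cast hn
  set S := ∑ d ∈ Finset.Ioc 0 n, vonMangoldt d / d with hS
  have hf := log_factorial_eq n
  have hup : lg n.factorial ≤ n * S := by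
    rw [hf, hS, Finset.mul_sum]
    refine Finset.sum_le_sum fun d _ => ?_
    have := Nat.cast_div_le (α := ℝ) (m := n) (n := d)
    calc _ ≤ vonMangoldt d * ((n:ℝ) / d) := mul_le_mul_of_nonneg_left this ArithmeticFunction.vonMangoldt_nonneg
      _ = _ := by ring
  have hlo : n * S - Chebyshev.psi n ≤ lg n.factorial := by
    rw [hf, hS, Finset.mul_sum, Chebyshev.psi, Nat.floor_natCast, ← Finset.sum_sub_distrib]
    refine Finset.sum_le_sum fun d hd => ?_
    have hd0 : (0:ℝ) < d := by exact_mod_cast (Finset.mem_Ioc.1 hd).1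
    have h1 : (n:ℝ) / d - 1 ≤ ((n / d : ℕ) : ℝ) := by
      rw [sub_le_iff_le_add, div_le_iff₀ hd0]
      have h2 := Nat.lt_div_mul_add (a := n) (b := d) (Finset.mem_Ioc.1 hd).1
      have h3 : (n:ℝ) < ((n / d : ℕ) : ℝ) * d + d := by exact_mod_cast h2
      linarith
    calc _ = vonMangoldt d * ((n:ℝ) / d - 1) := by ring
      _ ≤ _ := mul_le_mul_of_nonneg_left h1 ArithmeticFunction.vonMangoldt_nonneg
  have hst := Stirling.le_log_factorial_stirling (n := n) (by omega)
  have hlogn : 0 ≤ lg n := Real.log_nonneg hn1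
  have hpi : 0 ≤ lg (2 * pI) := Real.log_nonneg (by linarith [Real.pi_gt_three])
  have hfu : lg n.factorial ≤ n * lg n := by
    have h : (n.factorial : ℝ) ≤ (n:ℝ) ^ n := by exact_mod_cast Nat.factorial_le_pow n
    have := Real.log_le_log (by positivity) h
    rwa [Real.log_pow] at this
  have hpsi := Chebyshev.psi_le_const_mul_self (x := n) hn0.le
  have hl4 : 0 < lg 4 := Real.log_pos (by norm_num)
  rw [abs_le]
  constructor
  · have : n * (lg n - 1) ≤ n * S := by linarith
    have := le_of_mul_le_mul_left this hn0
    linarith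
  · have : n * S ≤ n * (lg n + (lg 4 + 4)) := by linarith
    have := le_of_mul_le_mul_left this hn0
    linarith

lemma mertens_lt : ∃ C, 0 < C ∧ ∀ x : ℝ, 1 ≤ x → |∑ d ∈ Finset.range ⌈x⌉₊, vonMangoldt d / d - lg x| ≤ C := by
  obtain ⟨C, hC, h⟩ := mertens
  refine ⟨C + lg 2, by positivity, fun x hx => ?_⟩
  have hl2 : 0 ≤ lg 2 := Real.log_nonneg (by norm_num)
  obtain ⟨m, hm⟩ : ∃ m, ⌈x⌉₊ = m + 1 := Nat.exists_eq_succ_of_ne_zero (by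
    have : 0 < ⌈x⌉₊ := Nat.ceil_pos.2 (by linarith)
    omega)
  have hsum : ∑ d ∈ Finset.range ⌈x⌉₊, vonMangoldt d / (d:ℝ) = ∑ d ∈ Finset.Ioc 0 m, vonMangoldt d / d := by
    rw [hm, Finset.range_eq_Ico, Finset.sum_eq_sum_Ico_succ_bot (by omega)]
    simp
    rfl
  rw [hsum]
  have hx2 : x ≤ m + 1 := by have := Nat.le_ceil x; rw [hm] at this; exact_mod_cast this
  have hx3 : (m:ℝ) < x := by
    have := Nat.ceil_lt_add_one (a := x) (by linarith)
    rw [hm] at this; push_cast at this; linarith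
  by_cases hm0 : m = 0
  · have : x = 1 := by rw [hm0] at hx2; norm_num at hx2; linarith
    rw [hm0, this]; simp; positivity
  · have hm1 : 1 ≤ m := by omega
    have hm1' : (1:ℝ) ≤ m := by exact_mod_cast hm1
    have a1 := h m hm1
    have a2 : lg m ≤ lg x := Real.log_le_log (by linarith) hx3.le
    have a3 : lg x ≤ lg m + lg 2 := by
      rw [← Real.log_mul (by positivity) (by norm_num)]
      exact Real.log_le_log (by linarith) (by linarith)
    rw [abs_le] at a1 ⊢
    constructor <;> linarith [a1.1, a1.2]

lemma mertens_weight {h : ℝ → ℝ} (hh : ContDiff ℝ 1 h) {A : ℝ} (hA : 0 < A) (hA1 : A < 1) (hhA : h A = 0) :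
    ∃ C, 0 < C ∧ ∀ T : ℝ, 3 ≤ T →
      |∑ n ∈ Finset.range (⌊T⌋₊ + 1), vonMangoldt n / n * h (min (lg n / lg T) A) -
        lg T * ∫ α in (0:ℝ)..A, h α| ≤ C := by
  obtain ⟨C, hC, hM⟩ := mertens_lt
  have hc' : Continuous (deriv h) := hh.continuous_deriv le_rfl
  obtain ⟨M, hM0, hMb⟩ := cont_bdd hc' A
  refine ⟨M * C * A, by positivity, fun T hT => ?_⟩
  set L := lg T with hL
  have hL1 : 1 ≤ L := log_three hT
  have hL0 : 0 < L := by linarith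
  have hd : ∀ α, HasDerivAt h (deriv h α) α := fun α => (hh.differentiable (by norm_num) α).hasDerivAt
  set N := ⌊T⌋₊ + 1 with hN
  set F : ℝ → ℝ := fun α => ∑ n ∈ Finset.range N, vonMangoldt n / n * (Ioi (lg n / L)).indicator (fun _ => (1:ℝ)) α with hF
  have hii : ∀ u : ℝ, IntervalIntegrable (fun α => deriv h α * (Ioi u).indicator (fun _ => (1:ℝ)) α) volume 0 A := by
    intro u
    rw [intervalIntegrable_iff]
    have h0 : IntegrableOn (deriv h) (uIoc 0 A) := by
      rw [← intervalIntegrable_iff]; exact hc'.intervalIntegrable _ _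
    have := h0.indicator (measurableSet_Ioi (a := u))
    refine this.congr (Eventually.of_forall fun α => ?_)
    by_cases hα : α ∈ Ioi u
    · simp [hα]
    · simp [hα]
  have hind : ∀ u : ℝ, 0 ≤ u → ∫ α in (0:ℝ)..A, deriv h α * (Ioi u).indicator (fun _ => (1:ℝ)) α = - h (min u A) := by
    intro u hu
    have e : ∀ α, deriv h α * (Ioi u).indicator (fun _ => (1:ℝ)) α = (Ioi u).indicator (deriv h) α := fun α => by
      by_cases hα : α ∈ Ioi u
      · simp [hα]
      · simp [hα]
    simp only [e]
    rw [intervalIntegral.integral_of_le hA.le, setIntegral_indicator measurableSet_Ioi]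
    have e2 : Ioc 0 A ∩ Ioi u = Ioc u A := by
      ext α; simp only [mem_inter_iff, mem_Ioc, mem_Ioi]
      constructor
      · rintro ⟨⟨h1, h2⟩, h3⟩; exact ⟨h3, h2⟩
      · rintro ⟨h1, h2⟩; exact ⟨⟨by linarith, h2⟩, h1⟩
    rw [e2]
    by_cases huA : u ≤ A
    · rw [← intervalIntegral.integral_of_le huA, intervalIntegral.integral_eq_sub_of_hasDerivAt (fun x _ => hd x) (hc'.intervalIntegrable _ _),
        min_eq_left huA, hhA]; ring
    · rw [min_eq_right (le_of_not_ge huA), hhA, Ioc_eq_empty (by linarith)]; simp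
  have hun : ∀ n : ℕ, 0 ≤ lg n / L := fun n => by
    have : 0 ≤ lg n := Real.log_natCast_nonneg n
    positivity
  have hFint : IntervalIntegrable (fun α => deriv h α * F α) volume 0 A := by
    have : (fun α => deriv h α * F α) = fun α => ∑ n ∈ Finset.range N, vonMangoldt n / n * (deriv h α * (Ioi (lg n / L)).indicator (fun _ => (1:ℝ)) α) := by
      funext α; rw [hF, Finset.mul_sum]; exact Finset.sum_congr rfl fun n _ => by ring
    rw [this]
    have hs := IntervalIntegrable.sum (Finset.range N) (f := fun (n : ℕ) α => vonMangoldt n / n * (deriv h α * (Ioi (lg n / L)).indicator (fun _ => (1:ℝ)) α))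
      fun n _ => (hii (lg n / L)).const_mul _
    refine (congrArg (fun f => IntervalIntegrable f volume 0 A) (funext fun α => ?_)).mp hs
    rw [Finset.sum_apply]
  have h1 : ∑ n ∈ Finset.range N, vonMangoldt n / n * h (min (lg n / L) A) = - ∫ α in (0:ℝ)..A, deriv h α * F α := by
    have : ∀ α, deriv h α * F α = ∑ n ∈ Finset.range N, vonMangoldt n / n * (deriv h α * (Ioi (lg n / L)).indicator (fun _ => (1:ℝ)) α) := by
      intro α; rw [hF, Finset.mul_sum]; exact Finset.sum_congr rfl fun n _ => by ring
    simp only [this]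
    rw [intervalIntegral.integral_finsetSum fun n _ => (hii _).const_mul _, ← Finset.sum_neg_distrib]
    refine Finset.sum_congr rfl fun n _ => ?_
    rw [intervalIntegral.integral_const_mul, hind _ (hun n)]; ring
  have h2 : L * ∫ α in (0:ℝ)..A, h α = - ∫ α in (0:ℝ)..A, deriv h α * (L * α) := by
    have := intervalIntegral.integral_mul_deriv_eq_deriv_mul (a := 0) (b := A) (u := fun α => L * α) (u' := fun _ => L)
      (fun v _ => by simpa using (hasDerivAt_id' v).const_mul L) (fun v _ => hd v)
      (by simp) (hc'.intervalIntegrable _ _)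
    rw [hhA] at this
    have e : ∀ α, deriv h α * (L * α) = L * α * deriv h α := fun α => by ring
    simp only [e]
    rw [this, intervalIntegral.integral_const_mul]; ring
  rw [h1, h2, ← neg_add', ← sub_eq_add_neg, abs_neg, ← intervalIntegral.integral_sub hFint ci]
  have h3 := intervalIntegral.norm_integral_le_of_norm_le_const (a := 0) (b := A) (C := M * C)
      (f := fun α => deriv h α * F α - deriv h α * (L * α)) (by
    intro α hα
    rw [uIoc_of_le hA.le] at hα
    rw [← mul_sub, norm_mul]
    refine mul_le_mul (hMb α ⟨hα.1.le, hα.2⟩) ?_ (norm_nonneg _) hM0.le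
    have hx : 1 ≤ ep (L * α) := Real.one_le_exp (by have := hα.1; positivity)
    have := hM _ hx
    rw [Real.log_exp] at this
    rw [Real.norm_eq_abs]
    refine (le_of_eq ?_).trans this
    congr 2
    simp only [hF]
    have hsub : Finset.range ⌈ep (L * α)⌉₊ ⊆ Finset.range N := by
      rw [Finset.range_subset_range, Nat.ceil_le, hN]
      have : ep (L * α) ≤ T := by
        rw [← Real.le_log_iff_exp_le (by linarith)]; exact mul_le_of_le_one_right hL0.le (by linarith [hα.2])
      push_cast
      exact this.trans (Nat.lt_floor_add_one T).le
    rw [← Finset.sum_subset hsub]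
    · refine Finset.sum_congr rfl fun n hn => ?_
      rw [Finset.mem_range, Nat.lt_ceil] at hn
      by_cases hn0 : n = 0
      · simp [hn0]
      have : lg n / L < α := by
        rw [div_lt_iff₀ hL0, Real.log_lt_iff_lt_exp (by positivity), mul_comm]; exact hn
      rw [indicator_of_mem (show α ∈ Ioi _ from this), mul_one]
    · intro n _ hn
      rw [Finset.mem_range, Nat.lt_ceil, not_lt] at hn
      have : α ≤ lg n / L := by
        rw [le_div_iff₀ hL0, Real.le_log_iff_exp_le (lt_of_lt_of_le (Real.exp_pos _) hn), mul_comm]; exact hn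
      rw [indicator_of_notMem (s := Ioi _) (fun h => absurd (mem_Ioi.1 h) (not_lt.2 this)), mul_zero])
  rw [sub_zero, abs_of_pos hA] at h3
  exact h3

open scoped ContDiff

lemma osc_decay (N : ℕ) : ∀ g : ℝ → ℝ, ContDiff ℝ ∞ g → HasCompactSupport g → ∃ C, 0 < C ∧ ∀ y : ℝ,
    |y| ^ N * |∫ s, g s * cs (s * y)| ≤ C ∧ |y| ^ N * |∫ s, g s * sn (s * y)| ≤ C := by
  induction N with
  | zero =>
    intro g hg hs
    have hi : Integrable g := hg.continuous.integrable_of_hasCompactSupport hs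
    refine ⟨(∫ s, |g s|) + 1, by have : 0 ≤ ∫ s, |g s| := integral_nonneg fun s => abs_nonneg _
                                 positivity, fun y => ?_⟩
    rw [pow_zero, one_mul, one_mul]
    constructor
    · rw [← Real.norm_eq_abs]
      refine (norm_integral_le_of_norm_le hi.abs (Eventually.of_forall fun s => ?_)).trans (by linarith)
      rw [norm_mul]; exact mul_le_of_le_one_right (norm_nonneg _) (Real.abs_cos_le_one _)
    · rw [← Real.norm_eq_abs]
      refine (norm_integral_le_of_norm_le hi.abs (Eventually.of_forall fun s => ?_)).trans (by linarith)
      rw [norm_mul]; exact mul_le_of_le_one_right (norm_nonneg _) (Real.abs_sin_le_one _)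
  | succ N ih =>
    intro g hg hs
    have hg' : ContDiff ℝ ∞ (deriv g) := ((contDiff_infty_iff_deriv (𝕜 := ℝ)).1 hg).2
    obtain ⟨C, hC, h⟩ := ih (deriv g) hg' hs.deriv
    refine ⟨C, hC, fun y => ?_⟩
    have hd : ∀ s, HasDerivAt g (deriv g s) s := fun s => (hg.differentiable (by simp) s).hasDerivAt
    have hi : ∀ F G : ℝ → ℝ, Continuous F → HasCompactSupport F → Continuous G → Integrable (F * G) := fun F G h1 h2 h3 =>
      (h1.mul h3).integrable_of_hasCompactSupport (h2.mul_right)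
    have hds : ∀ s : ℝ, HasDerivAt (fun s : ℝ => sn (s * y)) (y * cs (s * y)) s := fun s => by
      have := ((hasDerivAt_id' s).mul_const y).sin
      exact this.congr_deriv (by ring)
    have hdc : ∀ s : ℝ, HasDerivAt (fun s : ℝ => cs (s * y)) (-(y * sn (s * y))) s := fun s => by
      have := ((hasDerivAt_id' s).mul_const y).cos
      exact this.congr_deriv (by ring)
    have e1 := integral_mul_deriv_eq_deriv_mul_of_integrable (fun s _ => hd s) (fun s _ => hds s) (hi _ _ hg.continuous hs (by fun_prop))
      (hi _ _ hg'.continuous hs.deriv (by fun_prop)) (hi _ _ hg.continuous hs (by fun_prop))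
    have e2 := integral_mul_deriv_eq_deriv_mul_of_integrable (fun s _ => hd s) (fun s _ => hdc s) (hi _ _ hg.continuous hs (by fun_prop))
      (hi _ _ hg'.continuous hs.deriv (by fun_prop)) (hi _ _ hg.continuous hs (by fun_prop))
    have f1 : y * ∫ s, g s * cs (s * y) = - ∫ s, deriv g s * sn (s * y) := by
      rw [← e1, ← integral_const_mul]; congr 1; funext s; ring
    have f2 : y * ∫ s, g s * sn (s * y) = ∫ s, deriv g s * cs (s * y) := by
      have : ∀ s, g s * -(y * sn (s * y)) = -(y * (g s * sn (s * y))) := fun s => by ring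
      simp only [this] at e2
      rw [integral_neg, integral_const_mul] at e2
      linarith
    constructor
    · rw [pow_succ, mul_assoc, ← abs_mul, f1, abs_neg]; exact (h y).2
    · rw [pow_succ, mul_assoc, ← abs_mul, f2]; exact (h y).1

noncomputable def WT (w : ℝ → ℝ) (T x : ℝ) : ℝ := ∫ t, w (t / T) * cs (t * x)

lemma WT_eq (w : ℝ → ℝ) {T : ℝ} (hT : 0 < T) (x : ℝ) : WT w T x = T * ∫ s, w s * cs (s * (T * x)) := by
  have h := Measure.integral_comp_div (fun s => w s * cs (s * (T * x))) T
  rw [abs_of_pos hT, smul_eq_mul] at h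
  rw [← h, WT]
  congr 1; funext t
  congr 2; field_simp

lemma WT_decay {w : ℝ → ℝ} (hw : ContDiff ℝ ∞ w) (hs : HasCompactSupport w) {A : ℝ} (hA1 : A < 1) :
    ∃ C, 0 < C ∧ ∀ T : ℝ, 3 ≤ T → ∀ x : ℝ, T ^ (-A) ≤ |x| → |WT w T x| ≤ C * T ^ (-(4:ℝ)) := by
  obtain ⟨N, hN⟩ := exists_nat_gt (5 / (1 - A))
  obtain ⟨C, hC, h⟩ := osc_decay N w hw hs
  refine ⟨C, hC, fun T hT x hx => ?_⟩
  have hT0 : 0 < T := by linarith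
  rw [WT_eq w hT0, abs_mul, abs_of_pos hT0]
  set J := |∫ s, w s * cs (s * (T * x))| with hJ
  have h1 := (h (T * x)).1
  have hN' : 5 ≤ (1 - A) * N := by rw [div_lt_iff₀ (by linarith)] at hN; linarith
  have h2 : T ^ (5:ℝ) ≤ |T * x| ^ N := by
    have : T ^ (1 - A) ≤ |T * x| := by
      rw [abs_mul, abs_of_pos hT0, show 1 - A = 1 + -A by ring, Real.rpow_add hT0, Real.rpow_one]
      gcongr
    calc T ^ (5:ℝ) ≤ T ^ ((1 - A) * N) := Real.rpow_le_rpow_of_exponent_le (by linarith) hN'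
      _ = (T ^ (1 - A)) ^ N := by rw [Real.rpow_mul hT0.le, Real.rpow_natCast]
      _ ≤ _ := by gcongr
  have h3 : T ^ (5:ℝ) * J ≤ C := (mul_le_mul_of_nonneg_right h2 (abs_nonneg _)).trans h1
  have e5 : T ^ (5:ℝ) = T * T ^ (4:ℝ) := by
    rw [show (5:ℝ) = 1 + 4 by norm_num, Real.rpow_add hT0, Real.rpow_one]
  rw [Real.rpow_neg hT0.le, ← div_eq_mul_inv, le_div_iff₀ (by positivity)]
  rw [e5] at h3; linarith

lemma cf_zero {q : ℝ → ℝ} {A T : ℝ} {n : ℕ} (hn : n < 2) : cf q A T n = 0 := by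
  unfold cf; interval_cases n <;> simp

lemma cf_zero' {q : ℝ → ℝ} {A T : ℝ} (hqA : q A = 0) (hT : 3 ≤ T) {n : ℕ} (hn : T ^ A < n) : cf q A T n = 0 := by
  have hT0 : 0 < T := by linarith
  have hL := log_three hT
  have : A ≤ lg n / lg T := by
    rw [le_div_iff₀ (by linarith), ← Real.log_rpow hT0]
    exact Real.log_le_log (by positivity) hn.le
  rw [cf, min_eq_right this, hqA, mul_zero]

lemma cf_bound {q : ℝ → ℝ} (hq : Continuous q) {A : ℝ} (hA : 0 < A) : ∃ C, 0 < C ∧ ∀ T : ℝ, 3 ≤ T → ∀ n ∈ Finset.range (⌊T⌋₊ + 1),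
    |cf q A T n| ≤ C * T := by
  obtain ⟨M, hM, h⟩ := cont_bdd hq A
  refine ⟨M, hM, fun T hT n hn => ?_⟩
  have hT0 : 0 < T := by linarith
  have hL := log_three hT
  have hn' : (n:ℝ) ≤ T := by
    rw [Finset.mem_range] at hn
    exact (Nat.le_floor_iff hT0.le).1 (by omega)
  by_cases hn2 : n < 2
  · rw [cf_zero hn2]; simp; positivity
  have hn1 : (1:ℝ) ≤ n := by exact_mod_cast (by omega : 1 ≤ n)
  have hΛ : vonMangoldt n ≤ T := ArithmeticFunction.vonMangoldt_le_log.trans ((Real.log_le_self (by linarith)).trans hn')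
  have hq' : |q (min (lg n / lg T) A)| ≤ M := by
    apply h; exact ⟨le_min (by have := Real.log_nonneg hn1; positivity) hA.le, min_le_right _ _⟩
  have hr : (n:ℝ) ^ neG ≤ 1 := Real.rpow_le_one_of_one_le_of_nonpos hn1 (by norm_num)
  unfold cf
  rw [abs_mul, abs_of_nonneg (mul_nonneg ArithmeticFunction.vonMangoldt_nonneg (by positivity))]
  calc _ ≤ (T * 1) * M := by gcongr
    _ = _ := by ring

lemma log_sep {m n : ℕ} (hm : 1 ≤ m) (hn : 1 ≤ n) (hmn : m ≠ n) {X : ℝ} (hmX : (m:ℝ) ≤ X) (hnX : (n:ℝ) ≤ X) :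
    X⁻¹ ≤ |lg m - lg n| := by
  wlog h : n < m generalizing m n
  · rw [abs_sub_comm]; exact this hn hm hmn.symm hnX hmX (by omega)
  have hm0 : (0:ℝ) < m := by exact_mod_cast hm
  have hn0 : (0:ℝ) < n := by exact_mod_cast hn
  refine le_trans ?_ (le_abs_self _)
  rw [← Real.log_div hm0.ne' hn0.ne']
  have h1 := Real.one_sub_inv_le_log_of_pos (div_pos hm0 hn0)
  refine le_trans ?_ h1
  rw [inv_div]
  have h2 : (n:ℝ) + 1 ≤ m := by exact_mod_cast h
  calc X⁻¹ ≤ (m:ℝ)⁻¹ := inv_anti₀ hm0 hmX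
    _ ≤ 1 - n / m := by rw [inv_eq_one_div, le_sub_iff_add_le, ← add_div, div_le_one hm0]; linarith

lemma w_comp_integrable {w g : ℝ → ℝ} (hw : Continuous w) (hs : HasCompactSupport w) {T : ℝ} (hT : 0 < T) (hg : Continuous g) :
    Integrable fun t => w (t / T) * g t := by
  have h1 : HasCompactSupport fun t => w (t / T) := by
    have := hs.comp_homeomorph (Homeomorph.mulRight₀ T⁻¹ (by positivity))
    exact this
  exact ((by fun_prop : Continuous fun t => w (t / T) * g t)).integrable_of_hasCompactSupport h1.mul_right

lemma mean_SS {w : ℝ → ℝ} (hw : ContDiff ℝ ∞ w) (hs : HasCompactSupport w) {q₁ q₂ : ℝ → ℝ} (h₁ : Continuous q₁) (h₂ : Continuous q₂)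
    {A₁ A₂ : ℝ} (p₁ : 0 < A₁) (p₂ : 0 < A₂) (l₁ : A₁ < 1) (l₂ : A₂ < 1) (z₁ : q₁ A₁ = 0) (z₂ : q₂ A₂ = 0) :
    ∃ C, 0 < C ∧ ∀ T : ℝ, 3 ≤ T → |(∫ t, w (t / T) * (SS q₁ A₁ T t * SS q₂ A₂ T t)) -
      1/2 * T * (∫ s, w s) * ∑ n ∈ Finset.range (⌊T⌋₊ + 1), cf q₁ A₁ T n * cf q₂ A₂ T n| ≤ C := by
  set A := max A₁ A₂ with hAdef
  have hA1 : A < 1 := max_lt l₁ l₂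
  have hA0 : 0 < A := lt_max_of_lt_left p₁
  obtain ⟨C, hC, hW⟩ := WT_decay hw hs hA1
  obtain ⟨M₁, hM₁, hb₁⟩ := cf_bound h₁ p₁
  obtain ⟨M₂, hM₂, hb₂⟩ := cf_bound h₂ p₂
  refine ⟨4 * (M₁ * M₂ * C), by positivity, fun T hT => ?_⟩
  have hT0 : 0 < T := by linarith
  set R := Finset.range (⌊T⌋₊ + 1) with hR
  set a := cf q₁ A₁ T with ha
  set b := cf q₂ A₂ T with hb
  have hexp : ∀ t, w (t / T) * (SS q₁ A₁ T t * SS q₂ A₂ T t) = ∑ m ∈ R, ∑ n ∈ R, (a m * b n / 2) *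
      (w (t / T) * cs (t * (lg m - lg n)) + w (t / T) * cs (t * (lg m + lg n))) := by
    intro t
    rw [SS, SS, Finset.sum_mul_sum, Finset.mul_sum]
    refine Finset.sum_congr rfl fun m _ => ?_
    rw [Finset.mul_sum]
    refine Finset.sum_congr rfl fun n _ => ?_
    rw [show t * (lg m - lg n) = t * lg m - t * lg n by ring, show t * (lg m + lg n) = t * lg m + t * lg n by ring, Real.cos_sub, Real.cos_add]; ring
  have hint : ∀ x : ℝ, Integrable fun t => w (t / T) * cs (t * x) := fun x =>
    w_comp_integrable hw.continuous hs hT0 (by fun_prop)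
  have hadd : ∀ x y : ℝ, Integrable fun t => w (t / T) * cs (t * x) + w (t / T) * cs (t * y) := fun x y => (hint x).add (hint y)
  have hI : ∫ t, w (t / T) * (SS q₁ A₁ T t * SS q₂ A₂ T t) = ∑ m ∈ R, ∑ n ∈ R, (a m * b n / 2) *
      (WT w T (lg m - lg n) + WT w T (lg m + lg n)) := by
    simp only [hexp]
    rw [integral_finsetSum _ fun m _ => integrable_finsetSum _ fun n _ => (hadd _ _).const_mul _]
    refine Finset.sum_congr rfl fun m _ => ?_
    rw [integral_finsetSum _ fun n _ => (hadd _ _).const_mul _]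
    refine Finset.sum_congr rfl fun n _ => ?_
    rw [integral_const_mul, integral_add (hint _) (hint _)]; rfl
  have hW0 : WT w T 0 = T * ∫ s, w s := by rw [WT_eq w hT0]; simp
  have hD : 1/2 * T * (∫ s, w s) * ∑ n ∈ R, a n * b n = ∑ m ∈ R, ∑ n ∈ R, if m = n then (a m * b n / 2) * (T * ∫ s, w s) else 0 := by
    rw [Finset.mul_sum]
    refine Finset.sum_congr rfl fun m hm => ?_
    rw [Finset.sum_ite_eq, if_pos hm]; ring
  rw [hI, hD, ← Finset.sum_sub_distrib]
  simp only [← Finset.sum_sub_distrib]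
  have hterm : ∀ m ∈ R, ∀ n ∈ R, |(a m * b n / 2) * (WT w T (lg m - lg n) + WT w T (lg m + lg n)) -
      (if m = n then (a m * b n / 2) * (T * ∫ s, w s) else 0)| ≤ (M₁ * T) * (M₂ * T) * (C * T ^ (-(4:ℝ))) := by
    intro m hm n hn
    have hRHS : 0 ≤ (M₁ * T) * (M₂ * T) * (C * T ^ (-(4:ℝ))) := by positivity
    by_cases h0 : a m * b n = 0
    · simp only [h0, zero_div, zero_mul, ite_self, sub_self, abs_zero]; exact hRHS
    have ham : a m ≠ 0 := left_ne_zero_of_mul h0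
    have hbn : b n ≠ 0 := right_ne_zero_of_mul h0
    have hm2 : 2 ≤ m := by by_contra h; exact ham (cf_zero (by omega))
    have hn2 : 2 ≤ n := by by_contra h; exact hbn (cf_zero (by omega))
    have hmX : (m:ℝ) ≤ T ^ A := by
      by_contra h; push Not at h
      exact ham (cf_zero' z₁ hT (lt_of_le_of_lt (Real.rpow_le_rpow_of_exponent_le (by linarith) (le_max_left _ _)) h))
    have hnX : (n:ℝ) ≤ T ^ A := by
      by_contra h; push Not at h
      exact hbn (cf_zero' z₂ hT (lt_of_le_of_lt (Real.rpow_le_rpow_of_exponent_le (by linarith) (le_max_right _ _)) h))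
    have hab : |a m * b n| ≤ (M₁ * T) * (M₂ * T) := by
      rw [abs_mul]; exact mul_le_mul (hb₁ T hT m hm) (hb₂ T hT n hn) (abs_nonneg _) (by positivity)
    have hplus : |WT w T (lg m + lg n)| ≤ C * T ^ (-(4:ℝ)) := by
      apply hW T hT
      have h1 : lg 2 ≤ lg m := Real.log_le_log (by norm_num) (by exact_mod_cast hm2)
      have h2 : lg 2 ≤ lg n := Real.log_le_log (by norm_num) (by exact_mod_cast hn2)
      have h3 := Real.log_two_gt_d9
      have h4 : T ^ (-A) ≤ 1 := Real.rpow_le_one_of_one_le_of_nonpos (by linarith) (by linarith)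
      exact le_trans (by linarith) (le_abs_self _)
    by_cases hmn : m = n
    · subst hmn
      rw [if_pos rfl, sub_self, hW0, mul_add, add_sub_cancel_left, abs_mul, abs_div, abs_two]
      calc |a m * b m| / 2 * |WT w T (lg m + lg m)| ≤ ((M₁ * T) * (M₂ * T)) * (C * T ^ (-(4:ℝ))) := by
            refine mul_le_mul ?_ hplus (abs_nonneg _) (by positivity)
            linarith [abs_nonneg (a m * b m)]
        _ = _ := rfl
    · rw [if_neg hmn, sub_zero, abs_mul, abs_div, abs_two]
      have hminus : |WT w T (lg m - lg n)| ≤ C * T ^ (-(4:ℝ)) := by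
        apply hW T hT
        rw [Real.rpow_neg hT0.le]
        exact log_sep (by omega) (by omega) hmn hmX hnX
      have := abs_add_le (WT w T (lg m - lg n)) (WT w T (lg m + lg n))
      calc _ ≤ ((M₁ * T) * (M₂ * T)) / 2 * (2 * (C * T ^ (-(4:ℝ)))) := by
            refine mul_le_mul ?_ (by linarith) (abs_nonneg _) (by positivity)
            linarith
        _ = _ := by ring
  refine (Finset.abs_sum_le_sum_abs _ _).trans ?_
  have hcard : (R.card : ℝ) ≤ 2 * T := by
    rw [hR, Finset.card_range]; push_cast
    have := Nat.floor_le hT0.le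
    linarith
  calc _ ≤ ∑ m ∈ R, ∑ n ∈ R, (M₁ * T) * (M₂ * T) * (C * T ^ (-(4:ℝ))) := by
        refine Finset.sum_le_sum fun m hm => (Finset.abs_sum_le_sum_abs _ _).trans (Finset.sum_le_sum fun n hn => hterm m hm n hn)
    _ = (R.card : ℝ) * (R.card * ((M₁ * T) * (M₂ * T) * (C * T ^ (-(4:ℝ))))) := by simp
    _ ≤ (2 * T) * ((2 * T) * ((M₁ * T) * (M₂ * T) * (C * T ^ (-(4:ℝ))))) := by gcongr
    _ = 4 * (M₁ * M₂ * C) * (T ^ 4 * T ^ (-(4:ℝ))) := by ring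
    _ = _ := by
        rw [Real.rpow_neg hT0.le, show (4:ℝ) = ((4:ℕ):ℝ) by norm_num, Real.rpow_natCast, mul_inv_cancel₀ (by positivity), mul_one]

lemma mean_S {w : ℝ → ℝ} (hw : ContDiff ℝ ∞ w) (hs : HasCompactSupport w) {q : ℝ → ℝ} (h₁ : Continuous q)
    {A : ℝ} (p₁ : 0 < A) (l₁ : A < 1) :
    ∃ C, 0 < C ∧ ∀ T : ℝ, 3 ≤ T → |∫ t, w (t / T) * SS q A T t| ≤ C := by
  obtain ⟨C, hC, hW⟩ := WT_decay hw hs (A := 3/4) (by norm_num)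
  obtain ⟨M, hM, hb⟩ := cf_bound h₁ p₁
  refine ⟨2 * (M * C), by positivity, fun T hT => ?_⟩
  have hT0 : 0 < T := by linarith
  set R := Finset.range (⌊T⌋₊ + 1) with hR
  have hint : ∀ x : ℝ, Integrable fun t => w (t / T) * cs (t * x) := fun x =>
    w_comp_integrable hw.continuous hs hT0 (by fun_prop)
  have hI : ∫ t, w (t / T) * SS q A T t = ∑ n ∈ R, cf q A T n * WT w T (lg n) := by
    have : ∀ t, w (t / T) * SS q A T t = ∑ n ∈ R, cf q A T n * (w (t / T) * cs (t * lg n)) := fun t => by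
      rw [SS, Finset.mul_sum]; exact Finset.sum_congr rfl fun n _ => by ring
    simp only [this]
    rw [integral_finsetSum _ fun n _ => (hint _).const_mul _]
    exact Finset.sum_congr rfl fun n _ => by rw [integral_const_mul]; rfl
  have hterm : ∀ n ∈ R, |cf q A T n * WT w T (lg n)| ≤ (M * T) * (C * T ^ (-(4:ℝ))) := by
    intro n hn
    by_cases hn2 : n < 2
    · rw [cf_zero hn2]; simp; positivity
    rw [abs_mul]
    refine mul_le_mul (hb T hT n hn) (hW T hT _ ?_) (abs_nonneg _) (by positivity)
    have h1 : lg 2 ≤ lg n := Real.log_le_log (by norm_num) (by exact_mod_cast (by omega : 2 ≤ n))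
    have h3 := Real.log_two_gt_d9
    have h4 : T ^ neF ≤ (3:ℝ) ^ neF := Real.rpow_le_rpow_of_nonpos (by norm_num) hT (by norm_num)
    refine le_trans ?_ (le_abs_self _)
    refine le_trans ?_ h1
    have h5 : (3:ℝ) ^ neF ≤ (3:ℝ) ^ neG := Real.rpow_le_rpow_of_exponent_le (by norm_num) (by norm_num)
    have h6 : (3:ℝ) ^ neG ≤ 0.6 := by
      rw [Real.rpow_neg (by norm_num), ← Real.sqrt_eq_rpow]
      have : (1.7:ℝ) ≤ Real.sqrt 3 := Real.le_sqrt_of_sq_le (by norm_num)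
      calc (Real.sqrt 3)⁻¹ ≤ (1.7:ℝ)⁻¹ := inv_anti₀ (by norm_num) this
        _ ≤ _ := by norm_num
    linarith
  rw [hI]
  refine (Finset.abs_sum_le_sum_abs _ _).trans ((Finset.sum_le_sum hterm).trans ?_)
  have hcard : (R.card : ℝ) ≤ 2 * T := by
    rw [hR, Finset.card_range]; push_cast
    have := Nat.floor_le hT0.le
    linarith
  rw [Finset.sum_const, nsmul_eq_mul]
  have e4 : T ^ (-(4:ℝ)) * T ^ 2 ≤ 1 := by
    rw [← Real.rpow_natCast, ← Real.rpow_add hT0]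
    exact Real.rpow_le_one_of_one_le_of_nonpos (by linarith) (by norm_num)
  calc _ ≤ (2 * T) * ((M * T) * (C * T ^ (-(4:ℝ)))) := by gcongr
    _ = 2 * (M * C) * (T ^ (-(4:ℝ)) * T ^ 2) := by ring
    _ ≤ _ := mul_le_of_le_one_right (by positivity) e4

lemma cf_mul (q₁ q₂ : ℝ → ℝ) (A₁ A₂ T : ℝ) {n : ℕ} (hn : 2 ≤ n) : cf q₁ A₁ T n * cf q₂ A₂ T n =
    vonMangoldt n ^ 2 / n * (q₁ (min (lg n / lg T) A₁) * q₂ (min (lg n / lg T) A₂)) := by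
  have hn0 : (0:ℝ) < n := by positivity
  have h : (n:ℝ) ^ neG * (n:ℝ) ^ neG = 1 / n := by
    rw [← Real.rpow_add hn0, show (-(1/2) + -(1/2) : ℝ) = -1 by norm_num, Real.rpow_neg_one, one_div]
  unfold cf
  calc _ = vonMangoldt n ^ 2 * ((n:ℝ) ^ neG * (n:ℝ) ^ neG) *
      (q₁ (min (lg n / lg T) A₁) * q₂ (min (lg n / lg T) A₂)) := by ring
    _ = _ := by rw [h]; ring

lemma diag_upper {f b : ℝ → ℝ} {a a' : ℝ} (hf : ContDiff ℝ 1 f) (ha : 0 < a) (haa : a < a') (ha1 : a' < 1) (hfa : f a = 0)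
    (hf0 : ∀ α ∈ Icc 0 a, 0 ≤ f α) (hb : ∀ α ∈ Icc 0 a, b α = 1) :
    ∃ C, 0 < C ∧ ∀ T : ℝ, 3 ≤ T → ∑ n ∈ Finset.range (⌊T⌋₊ + 1), cf f a T n * cf b a' T n ≤
      lg T ^ 2 * (∫ α in (0:ℝ)..a, α * f α) + C * lg T := by
  obtain ⟨C, hC, h⟩ := mertens_weight (h := fun α => α * f α) (by fun_prop) ha (by linarith) (by simp [hfa])
  refine ⟨C, hC, fun T hT => ?_⟩
  have hL := log_three hT
  set L := lg T with hLd
  have h1 := (abs_le.1 (h T hT)).2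
  have h2 : ∑ n ∈ Finset.range (⌊T⌋₊ + 1), cf f a T n * cf b a' T n ≤ L * ∑ n ∈ Finset.range (⌊T⌋₊ + 1), vonMangoldt n / n *
      ((fun α => α * f α) (min (lg n / L) a)) := by
    rw [Finset.mul_sum]
    refine Finset.sum_le_sum fun n _ => ?_
    by_cases hn : n < 2
    · rw [cf_zero hn]; interval_cases n <;> simp
    push Not at hn
    rw [cf_mul _ _ _ _ _ hn]
    have hl : 0 ≤ lg n := Real.log_nonneg (by exact_mod_cast (by omega : 1 ≤ n))
    have hu : 0 ≤ lg n / L := by positivity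
    rw [← hLd]
    rcases le_total (lg n / L) a with hua | hua
    · rw [min_eq_left hua, min_eq_left (by linarith), hb _ ⟨hu, hua⟩]
      have hfu := hf0 _ ⟨hu, hua⟩
      have hΛ0 : 0 ≤ vonMangoldt n := ArithmeticFunction.vonMangoldt_nonneg
      have hΛ : vonMangoldt n ≤ lg n := ArithmeticFunction.vonMangoldt_le_log
      have e : L * (vonMangoldt n / n * (lg n / L * f (lg n / L))) =
          vonMangoldt n * lg n / n * f (lg n / L) := by field_simp
      simp only []
      rw [e, mul_one, sq]
      gcongr
    · rw [min_eq_right hua]; simp [hfa]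
  nlinarith

lemma diag_sq {q : ℝ → ℝ} (hq : Continuous q) {A : ℝ} (hA : 0 < A) :
    ∃ C, 0 < C ∧ ∀ T : ℝ, 3 ≤ T → ∑ n ∈ Finset.range (⌊T⌋₊ + 1), cf q A T n * cf q A T n ≤ C * lg T ^ 2 := by
  obtain ⟨C, hC, h⟩ := mertens
  obtain ⟨M, hM, hqM⟩ := cont_bdd hq A
  refine ⟨M ^ 2 * (1 + C), by positivity, fun T hT => ?_⟩
  have hL := log_three hT
  have hT0 : 0 < T := by linarith
  have hfl : 1 ≤ ⌊T⌋₊ := Nat.le_floor (by push_cast; linarith)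
  set L := lg T with hLd
  have h1 := (abs_le.1 (h _ hfl)).2
  have hlf : lg (⌊T⌋₊:ℝ) ≤ L := Real.log_le_log (by exact_mod_cast hfl) (Nat.floor_le hT0.le)
  have h2 : ∑ n ∈ Finset.range (⌊T⌋₊ + 1), cf q A T n * cf q A T n ≤ ∑ n ∈ Finset.range (⌊T⌋₊ + 1), M ^ 2 * L * (vonMangoldt n / n) := by
    refine Finset.sum_le_sum fun n hnR => ?_
    by_cases hn : n < 2
    · rw [cf_zero hn]; interval_cases n <;> simp
    push Not at hn
    rw [cf_mul _ _ _ _ _ hn]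
    have hl : 0 ≤ lg n := Real.log_nonneg (by exact_mod_cast (by omega : 1 ≤ n))
    have hu : 0 ≤ lg n / L := by positivity
    have hΛ0 : 0 ≤ vonMangoldt n := ArithmeticFunction.vonMangoldt_nonneg
    have hnT : (n:ℝ) ≤ T := by
      rw [Finset.mem_range] at hnR
      exact (Nat.le_floor_iff hT0.le).1 (by omega)
    have hΛ : vonMangoldt n ≤ L := ArithmeticFunction.vonMangoldt_le_log.trans (Real.log_le_log (by positivity) hnT)
    have hb := hqM (min (lg n / L) A) ⟨le_min hu hA.le, min_le_right _ _⟩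
    have hb2 : q (min (lg n / L) A) * q (min (lg n / L) A) ≤ M ^ 2 := by
      rw [← sq]; exact sq_le_sq' (abs_le.1 hb).1 (abs_le.1 hb).2
    calc _ ≤ vonMangoldt n ^ 2 / n * M ^ 2 := by gcongr
      _ = vonMangoldt n * vonMangoldt n / n * M ^ 2 := by rw [sq]
      _ ≤ L * vonMangoldt n / n * M ^ 2 := by gcongr
      _ = _ := by ring
  have h3 : ∑ n ∈ Finset.range (⌊T⌋₊ + 1), vonMangoldt n / n = ∑ n ∈ Finset.Ioc 0 ⌊T⌋₊, vonMangoldt n / (n:ℝ) := by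
    symm
    refine Finset.sum_subset (fun n => by simp) fun n hn hn' => ?_
    have : n = 0 := by simp at hn hn'; omega
    simp [this]
  rw [← Finset.mul_sum, h3] at h2
  refine h2.trans ?_
  have : ∑ n ∈ Finset.Ioc 0 ⌊T⌋₊, vonMangoldt n / (n:ℝ) ≤ (1 + C) * L := by nlinarith
  calc _ ≤ M ^ 2 * L * ((1 + C) * L) := by gcongr
    _ = _ := by ring

lemma SS_cont (q : ℝ → ℝ) (A T : ℝ) : Continuous (SS q A T) := by
  unfold SS; fun_prop

lemma prime_int {w : ℝ → ℝ} (hw : ContDiff ℝ ∞ w) (hs : HasCompactSupport w) (hw0 : 0 ≤ ∫ s, w s)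
    {f b : ℝ → ℝ} {a a' : ℝ} (hf : ContDiff ℝ 1 f) (hbc : Continuous b) (ha : 0 < a) (haa : a < a') (ha1 : a' < 1) (hfa : f a = 0)
    (hba : b a' = 0) (hf0 : ∀ α ∈ Icc 0 a, 0 ≤ f α) (hb : ∀ α ∈ Icc 0 a, b α = 1) (K : ℝ) (hK : 0 ≤ K) :
    ∃ C, 0 < C ∧ ∀ T : ℝ, 3 ≤ T → ∫ t, w (t / T) * ((1/2 * f 0 * lg T - SS f a T t) * (1/2 * lg T - SS b a' T t) +
        K * (lg T + SS f a T t ^ 2 / lg T + SS b a' T t ^ 2 / lg T)) ≤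
      T * (∫ s, w s) * lg T ^ 2 * (1/4 * f 0 + 1/2 * ∫ α in (0:ℝ)..a, α * f α) + C * T * lg T := by
  have ha' : 0 < a' := ha.trans haa
  set W := ∫ s, w s with hWd
  obtain ⟨C1, p1, m1⟩ := mean_S hw hs hf.continuous ha (haa.trans ha1)
  obtain ⟨C2, p2, m2⟩ := mean_S hw hs hbc ha' ha1
  obtain ⟨C3, p3, m3⟩ := mean_SS hw hs hf.continuous hbc ha ha' (haa.trans ha1) ha1 hfa hba
  obtain ⟨C4, p4, m4⟩ := mean_SS hw hs hf.continuous hf.continuous ha ha (haa.trans ha1) (haa.trans ha1) hfa hfa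
  obtain ⟨C5, p5, m5⟩ := mean_SS hw hs hbc hbc ha' ha' ha1 ha1 hba hba
  obtain ⟨D3, d3, u3⟩ := diag_upper hf ha haa ha1 hfa hf0 hb
  obtain ⟨D4, d4, u4⟩ := diag_sq hf.continuous ha
  obtain ⟨D5, d5, u5⟩ := diag_sq hbc ha'
  refine ⟨1/2 * |f 0| * C2 + 1/2 * C1 + C3 + 1/2 * W * D3 + K * W + K * (C4 + 1/2 * W * D4) + K * (C5 + 1/2 * W * D5), by positivity, fun T hT => ?_⟩
  have hT0 : 0 < T := by linarith
  have hL := log_three hT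
  set L := lg T with hLd
  have hL0 : 0 < L := by linarith
  set S1 := SS f a T with hS1
  set S2 := SS b a' T with hS2
  have c1 : Continuous S1 := SS_cont _ _ _
  have c2 : Continuous S2 := SS_cont _ _ _
  have hi : ∀ g : ℝ → ℝ, Continuous g → Integrable fun t => w (t / T) * g t := fun g hg =>
    w_comp_integrable hw.continuous hs hT0 hg
  have i0 : Integrable fun t => (1/4 * f 0 * L ^ 2 + K * L) * (w (t / T) * 1) := (hi _ continuous_const).const_mul _
  have i1 : Integrable fun t => (-(1/2) * L) * (w (t / T) * S1 t) := (hi _ c1).const_mul _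
  have i2 : Integrable fun t => (-(1/2) * f 0 * L) * (w (t / T) * S2 t) := (hi _ c2).const_mul _
  have i3 : Integrable fun t => w (t / T) * (S1 t * S2 t) := hi _ (c1.mul c2)
  have i4 : Integrable fun t => (K / L) * (w (t / T) * (S1 t * S1 t)) := (hi _ (c1.mul c1)).const_mul _
  have i5 : Integrable fun t => (K / L) * (w (t / T) * (S2 t * S2 t)) := (hi _ (c2.mul c2)).const_mul _
  have e : ∀ t, w (t / T) * ((1/2 * f 0 * L - S1 t) * (1/2 * L - S2 t) + K * (L + S1 t ^ 2 / L + S2 t ^ 2 / L)) =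
      (1/4 * f 0 * L ^ 2 + K * L) * (w (t / T) * 1) + (-(1/2) * L) * (w (t / T) * S1 t) + (-(1/2) * f 0 * L) * (w (t / T) * S2 t)
      + w (t / T) * (S1 t * S2 t) + (K / L) * (w (t / T) * (S1 t * S1 t)) + (K / L) * (w (t / T) * (S2 t * S2 t)) := fun t => by ring
  have hI := integral_add ((((i0.add i1).add i2).add i3).add i4) i5
  have hI4 := integral_add (((i0.add i1).add i2).add i3) i4
  have hI3 := integral_add ((i0.add i1).add i2) i3
  have hI2 := integral_add (i0.add i1) i2
  have hI1 := integral_add i0 i1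
  simp only [Pi.add_apply] at hI hI4 hI3 hI2
  have hW : ∫ t, w (t / T) * 1 = T * W := by
    simp only [mul_one]
    have h := Measure.integral_comp_div w T
    rwa [abs_of_pos hT0, smul_eq_mul] at h
  simp only [e]
  rw [hI, hI4, hI3, hI2, hI1]
  simp only [integral_const_mul]
  rw [hW]
  have q1 := m1 T hT
  have q2 := m2 T hT
  have q3 := (abs_le.1 (m3 T hT)).2
  have q4 := (abs_le.1 (m4 T hT)).2
  have q5 := (abs_le.1 (m5 T hT)).2
  have v3 := u3 T hT
  have v4 := u4 T hT
  have v5 := u5 T hT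
  have hTW : 0 ≤ 1/2 * T * W := by positivity
  have v3' := mul_le_mul_of_nonneg_left v3 hTW
  have v4' := mul_le_mul_of_nonneg_left v4 hTW
  have v5' := mul_le_mul_of_nonneg_left v5 hTW
  have hTL : 1 ≤ T * L := one_le_mul_of_one_le_of_one_le (by linarith) hL
  have hLTL : L ≤ T * L := le_mul_of_one_le_left hL0.le (by linarith)
  have b1 : (-(1/2) * L) * (∫ t, w (t / T) * S1 t) ≤ 1/2 * C1 * (T * L) := by
    calc _ ≤ |(-(1/2) * L) * (∫ t, w (t / T) * S1 t)| := le_abs_self _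
      _ = 1/2 * L * |∫ t, w (t / T) * S1 t| := by rw [abs_mul, abs_mul, abs_of_pos hL0]; norm_num
      _ ≤ 1/2 * L * C1 := by gcongr
      _ = 1/2 * C1 * L := by ring
      _ ≤ _ := by gcongr
  have b2 : (-(1/2) * f 0 * L) * (∫ t, w (t / T) * S2 t) ≤ 1/2 * |f 0| * C2 * (T * L) := by
    calc _ ≤ |(-(1/2) * f 0 * L) * (∫ t, w (t / T) * S2 t)| := le_abs_self _
      _ = 1/2 * |f 0| * L * |∫ t, w (t / T) * S2 t| := by rw [abs_mul, abs_mul, abs_mul, abs_of_pos hL0]; norm_num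
      _ ≤ 1/2 * |f 0| * L * C2 := by gcongr
      _ = 1/2 * |f 0| * C2 * L := by ring
      _ ≤ _ := by gcongr
  have b3 : ∫ t, w (t / T) * (S1 t * S2 t) ≤ 1/2 * T * W * (L ^ 2 * ∫ α in (0:ℝ)..a, α * f α) + (C3 + 1/2 * W * D3) * (T * L) := by
    have : C3 ≤ C3 * (T * L) := le_mul_of_one_le_right p3.le hTL
    linarith
  have bsq : ∀ X C D : ℝ, 0 < C → X ≤ C + 1/2 * T * W * (D * L ^ 2) → K / L * X ≤ K * (C + 1/2 * W * D) * (T * L) := by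
    intro X C D hC hX
    calc K / L * X ≤ K / L * (C + 1/2 * T * W * (D * L ^ 2)) := by gcongr
      _ = K * (C / L) + K * (1/2 * W * D) * (T * L) := by field_simp
      _ ≤ K * (C * (T * L)) + K * (1/2 * W * D) * (T * L) := by
          gcongr
          exact (div_le_self hC.le hL).trans (le_mul_of_one_le_right hC.le hTL)
      _ = _ := by ring
  have b4 := bsq _ C4 D4 p4 (by linarith : ∫ t, w (t / T) * (S1 t * S1 t) ≤ C4 + 1/2 * T * W * (D4 * L ^ 2))
  have b5 := bsq _ C5 D5 p5 (by linarith : ∫ t, w (t / T) * (S2 t * S2 t) ≤ C5 + 1/2 * T * W * (D5 * L ^ 2))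
  linarith

/-- cosh factor -/
noncomputable def ch (c α : ℝ) : ℝ := kc (c * α)

lemma ch_cd (c : ℝ) : ContDiff ℝ 2 (ch c) := by unfold ch; fun_prop

lemma cosh_le_exp_abs' (x : ℝ) : kc x ≤ ep |x| := by
  rw [Real.cosh_eq]
  have h1 := Real.exp_le_exp.2 (le_abs_self x)
  have h2 := Real.exp_le_exp.2 (neg_le_abs x)
  linarith

lemma abs_sinh_le (x : ℝ) : |Real.sinh x| ≤ kc x := by
  rw [Real.abs_sinh, ← Real.cosh_abs x]; exact (Real.sinh_lt_cosh _).le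

lemma PH_eq (q : ℝ → ℝ) (A L : ℝ) (ρ : ℂ) (t : ℝ) :
    PH q A L ρ t = L * EE (fun α => q α * ch ((ρ.re - 1/2) * L) α) A (L * (t - ρ.im)) := by
  unfold PH EE ch
  congr 1
  refine intervalIntegral.integral_congr fun α _ => ?_
  simp only []
  rw [mul_comm α]

lemma PH_cont {q : ℝ → ℝ} (hq : Continuous q) (A L : ℝ) (ρ : ℂ) : Continuous (PH q A L ρ) := by
  have : PH q A L ρ = fun t => L * EE (fun α => q α * ch ((ρ.re - 1/2) * L) α) A (L * (t - ρ.im)) := funext (PH_eq q A L ρ)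
  rw [this]
  have h := EE_cont (hq.mul (ch_cd ((ρ.re - 1/2) * L)).continuous) A
  exact continuous_const.mul (h.comp (by fun_prop))

lemma PH_bound {q : ℝ → ℝ} (hq : ContDiff ℝ 2 q) {A : ℝ} (hA : 0 ≤ A) (hA1 : A ≤ 1) (hqA : q A = 0) :
    ∃ C, 0 < C ∧ ∀ (L D : ℝ) (ρ : ℂ), 1 ≤ L → |ρ.re - 1/2| * L ≤ D → ∀ t,
      |PH q A L ρ t| ≤ C * L * (1 + D) ^ 2 * ep D / (1 + (t - ρ.im) ^ 2) := by
  obtain ⟨C, hC, h⟩ := EE_prod_bound hq hA hqA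
  refine ⟨C, hC, fun L D ρ hL hD t => ?_⟩
  set c := (ρ.re - 1/2) * L with hc
  have hca : |c| ≤ D := by rw [hc, abs_mul, abs_of_pos (by linarith : 0 < L)]; exact hD
  have hd1 : deriv (ch c) = fun α => c * Real.sinh (c * α) := by
    funext α
    have := ((hasDerivAt_id' α).const_mul c).cosh
    exact (this.congr_deriv (by ring)).deriv
  have hd2 : deriv (deriv (ch c)) = fun α => c ^ 2 * kc (c * α) := by
    rw [hd1]; funext α
    have := (((hasDerivAt_id' α).const_mul c).sinh).const_mul c
    exact (this.congr_deriv (by ring)).deriv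
  have hcosh : ∀ α ∈ Icc 0 A, kc (c * α) ≤ ep |c| := fun α hα => by
    refine (cosh_le_exp_abs' _).trans (Real.exp_le_exp.2 ?_)
    rw [abs_mul, abs_of_nonneg hα.1]
    exact mul_le_of_le_one_right (abs_nonneg _) (hα.2.trans hA1)
  have h1 := h (ch c) |c| (ep |c|) (ch_cd c) (abs_nonneg _)
    (fun α hα => by rw [ch, abs_of_pos (Real.cosh_pos _)]; exact hcosh α hα)
    (fun α hα => by rw [hd1, abs_mul]; exact mul_le_mul_of_nonneg_left ((abs_sinh_le _).trans (hcosh α hα)) (abs_nonneg _))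
    (fun α hα => by
      rw [hd2, abs_mul, abs_pow, abs_of_pos (Real.cosh_pos _)]
      exact mul_le_mul_of_nonneg_left (hcosh α hα) (by positivity)) (L * (t - ρ.im))
  rw [PH_eq, abs_mul, abs_of_pos (by linarith : 0 < L)]
  calc _ ≤ L * (C * (1 + |c|) ^ 2 * ep |c| / (1 + (L * (t - ρ.im)) ^ 2)) := by gcongr
    _ ≤ L * (C * (1 + D) ^ 2 * ep D / (1 + (t - ρ.im) ^ 2)) := by
        have : (t - ρ.im) ^ 2 ≤ (L * (t - ρ.im)) ^ 2 := by
          rw [mul_pow]; exact le_mul_of_one_le_left (sq_nonneg _) (one_le_pow₀ hL)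
        have hD0 := (abs_nonneg _).trans hca
        gcongr ?_ * (?_ / (1 + ?_))
        gcongr
    _ = _ := by ring

lemma PH_integrable {q : ℝ → ℝ} (hq : ContDiff ℝ 2 q) {A : ℝ} (hA : 0 ≤ A) (hqA : q A = 0) {L : ℝ} (hL : 0 < L) (ρ : ℂ) :
    Integrable (PH q A L ρ) := by
  have h := EE_integrable (hq.mul (ch_cd ((ρ.re - 1/2) * L))) hA (by simp [hqA])
  have h2 := ((h.comp_mul_left' hL.ne').comp_sub_right ρ.im).const_mul L
  exact h2.congr (Eventually.of_forall fun t => (PH_eq q A L ρ t).symm)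

lemma PH_mul_integrable {q b : ℝ → ℝ} (hq : ContDiff ℝ 2 q) (hb : ContDiff ℝ 2 b) {A A' : ℝ} (hA : 0 ≤ A) (hA' : 0 ≤ A') (hA1 : A ≤ 1)
    (hqA : q A = 0) (hbA : b A' = 0) {L : ℝ} (hL : 1 ≤ L) (ρ ρ' : ℂ) :
    Integrable fun t => PH q A L ρ t * PH b A' L ρ' t := by
  obtain ⟨C, hC, h⟩ := PH_bound hq hA hA1 hqA
  refine (PH_integrable hb hA' hbA (by linarith) ρ').bdd_mul (c := C * L * (1 + |ρ.re - 1/2| * L) ^ 2 * ep (|ρ.re - 1/2| * L))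
    (PH_cont hq.continuous A L ρ).aestronglyMeasurable (Eventually.of_forall fun t => ?_)
  refine (h L _ ρ hL le_rfl t).trans (div_le_self (by positivity) (by nlinarith [sq_nonneg (t - ρ.im)]))

lemma PH_prod {q b : ℝ → ℝ} (hq : ContDiff ℝ 2 q) (hb : ContDiff ℝ 2 b) {A A' : ℝ} (hA : 0 ≤ A) (hAA : A ≤ A')
    (hqA : q A = 0) (hb1 : ∀ α ∈ Icc 0 A, b α = 1) {L : ℝ} (hL : 0 < L) (ρ ρ' : ℂ) :
    ∫ t, PH q A L ρ t * PH b A' L ρ' t = pI * L * ∫ α in (0:ℝ)..A, q α *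
      (kc ((ρ.re - 1/2) * L * α) * kc ((ρ'.re - 1/2) * L * α)) * cs (L * (ρ.im - ρ'.im) * α) := by
  set Q := fun α => q α * ch ((ρ.re - 1/2) * L) α with hQ
  set Q' := fun α => b α * ch ((ρ'.re - 1/2) * L) α with hQ'
  have hQ'c : Continuous Q' := (hb.mul (ch_cd _)).continuous
  set h := (Ioc 0 A').indicator Q' with hh
  have hint : IntegrableOn h (Ioi 0) := by
    apply Integrable.integrableOn
    rw [hh, integrable_indicator_iff measurableSet_Ioc]
    exact (hQ'c.integrableOn_Icc (a := 0) (b := A')).mono_set Ioc_subset_Icc_self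
  set x := L * (ρ'.im - ρ.im) with hx
  have key := EE_conv (hq.mul (ch_cd ((ρ.re - 1/2) * L))) hA (by simp [hqA]) hint x
  have e1 : ∀ y, ∫ v in Ioi (0:ℝ), h v * cs (v * (x - y)) = EE Q' A' (y - x) := by
    intro y
    rw [← EE_neg, neg_sub, EE, intervalIntegral.integral_of_le (hA.trans hAA)]
    have : ∀ v, h v * cs (v * (x - y)) = (Ioc 0 A').indicator (fun v => Q' v * cs ((x - y) * v)) v := by
      intro v; rw [hh]; by_cases hv : v ∈ Ioc 0 A'
      · rw [indicator_of_mem hv, indicator_of_mem hv, mul_comm v]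
      · rw [indicator_of_notMem hv, indicator_of_notMem hv, zero_mul]
    simp only [this]
    rw [setIntegral_indicator measurableSet_Ioc, inter_eq_right.2 (fun v hv => hv.1)]
  simp only [e1] at key
  have e2 : ∀ t, PH q A L ρ t * PH b A' L ρ' t = (fun s => L ^ 2 * (EE Q A (L * s) * EE Q' A' (L * s - x))) (t - ρ.im) := by
    intro t
    rw [PH_eq, PH_eq]
    simp only []
    rw [show L * (t - ρ.im) - x = L * (t - ρ'.im) by rw [hx]; ring]; ring
  simp only [e2]
  rw [integral_sub_right_eq_self (fun s => L ^ 2 * (EE Q A (L * s) * EE Q' A' (L * s - x))) ρ.im, integral_const_mul]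
  have e3 := Measure.integral_comp_mul_left (fun y => EE Q A y * EE Q' A' (y - x)) L
  rw [abs_of_pos (by positivity), smul_eq_mul] at e3
  rw [e3]
  have e4 : ∫ y, EE Q A y * EE Q' A' (y - x) = _ := key
  rw [e4]
  have e5 : ∫ v in (0:ℝ)..A, (fun α => q α * ch ((ρ.re - 1/2) * L) α) v * h v * cs (v * x) = ∫ α in (0:ℝ)..A, q α *
      (kc ((ρ.re - 1/2) * L * α) * kc ((ρ'.re - 1/2) * L * α)) * cs (L * (ρ.im - ρ'.im) * α) := by
    refine intervalIntegral.integral_congr_ae (Eventually.of_forall fun v hv => ?_)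
    rw [uIoc_of_le hA] at hv
    have hv' : v ∈ Ioc 0 A' := ⟨hv.1, hv.2.trans hAA⟩
    rw [hh, indicator_of_mem hv', hQ']
    simp only [ch]
    rw [hb1 v ⟨hv.1.le, hv.2⟩, ← Real.cos_neg (v * x), show -(v * x) = L * (ρ.im - ρ'.im) * v by rw [hx]; ring]
    ring
  refine (congrArg (fun z => L ^ 2 * (L⁻¹ * (pI * z))) e5).trans ?_
  generalize (∫ α in (0:ℝ)..A, q α *
      (kc ((ρ.re - 1/2) * L * α) * kc ((ρ'.re - 1/2) * L * α)) * cs (L * (ρ.im - ρ'.im) * α)) = J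
  field_simp

structure Om (om : ℝ → ℝ) : Prop where
  smooth : ContDiff ℝ ∞ om
  supp : ∀ x, om x ≠ 0 → 9/10 ≤ x ∧ x ≤ 21/10
  nn : ∀ x, 0 ≤ om x
  le1 : ∀ x, om x ≤ 1
  one : ∀ x ∈ Icc (1:ℝ) 2, om x = 1

lemma Om.cpt {om : ℝ → ℝ} (h : Om om) : HasCompactSupport om :=
  HasCompactSupport.of_support_subset_isCompact isCompact_Icc (fun x hx => ⟨(h.supp x hx).1, (h.supp x hx).2⟩)

lemma Om.lip {om : ℝ → ℝ} (h : Om om) : ∃ C, 0 < C ∧ ∀ x y, |om x - om y| ≤ C * |x - y| := by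
  obtain ⟨C, hC⟩ := ContDiff.lipschitzWith_of_hasCompactSupport h.cpt h.smooth (by simp)
  refine ⟨C + 1, by positivity, fun x y => ?_⟩
  have := hC.dist_le_mul x y
  rw [Real.dist_eq, Real.dist_eq] at this
  nlinarith [abs_nonneg (x - y)]

/-- zeros near height `T` are close to the critical line -/
def ZB (T : ℝ) : Prop := ∀ ρ, XX ρ = 0 → T / 2 < ρ.im → ρ.im ≤ 4 * T → |ρ.re - 1/2| * lg T ≤ 0.0005005

noncomputable def Psi (q : ℝ → ℝ) (A : ℝ) (om : ℝ → ℝ) (T t : ℝ) : ℝ :=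
  ∑ ρ ∈ Bd (T / 2) (4 * T), mm ρ * om (ρ.im / T) * PH q A (lg T) ρ t

noncomputable def VV (q : ℝ → ℝ) (A T t : ℝ) : ℝ := ∑' ρ : ℂ, mm ρ * PH q A (lg T) ρ t

lemma N_bound : ∃ C, 0 < C ∧ ∀ T : ℝ, 3 ≤ T → ∑ ρ ∈ Bd (T / 2) (4 * T), mm ρ ≤ C * T ^ eA := by
  refine ⟨(5:ℝ) ^ eA * (Hs + 1), by have := Hs_nonneg; positivity, fun T hT => ?_⟩
  have hT0 : 0 < T := by linarith
  have h1 : ∑ ρ ∈ Bd (T / 2) (4 * T), mm ρ ≤ ∑ ρ ∈ Bd (T / 2) (4 * T), (5 * T) ^ eA * (mm ρ * (1 + ‖ρ‖) ^ neA) := by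
    refine Finset.sum_le_sum fun ρ hρ => ?_
    obtain ⟨hz, h1, h2⟩ := mem_Bd.1 hρ
    obtain ⟨-, hr0, hr1⟩ := (XX_zero_iff ρ).1 hz
    have hn : 1 + ‖ρ‖ ≤ 5 * T := by
      have := Complex.norm_le_abs_re_add_abs_im ρ
      rw [abs_of_pos hr0, abs_of_pos (by linarith : 0 < ρ.im)] at this
      linarith
    have h3 : (5 * T) ^ neA ≤ (1 + ‖ρ‖) ^ neA := Real.rpow_le_rpow_of_nonpos (by positivity) hn (by norm_num)
    have h4 : (5 * T) ^ eA * (5 * T) ^ neA = 1 := by rw [← Real.rpow_add (by positivity)]; norm_num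
    calc mm ρ = ((5 * T) ^ eA * (5 * T) ^ neA) * mm ρ := by rw [h4, one_mul]
      _ ≤ ((5 * T) ^ eA * (1 + ‖ρ‖) ^ neA) * mm ρ := by have := mm_nonneg ρ; gcongr
      _ = _ := by ring
  rw [← Finset.mul_sum] at h1
  have h2 : ∑ ρ ∈ Bd (T / 2) (4 * T), mm ρ * (1 + ‖ρ‖) ^ neA ≤ Hs :=
    Hs_summable.sum_le_tsum _ (fun ρ _ => mul_nonneg (mm_nonneg ρ) (by positivity))
  refine h1.trans ?_
  rw [Real.mul_rpow (by norm_num) hT0.le]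
  calc _ ≤ (5:ℝ) ^ eA * T ^ eA * (Hs + 1) := by gcongr; linarith
    _ = _ := by ring

lemma log_band {T t : ℝ} (hT : 3 ≤ T) (ht : |t| ≤ 3 * T) : lg (3 + |t|) ≤ 3 * lg T := by
  have h : 3 + |t| ≤ T ^ 3 := by
    have : 9 * T ≤ T ^ 3 := by nlinarith [mul_pos (by linarith : 0 < T) (by linarith : 0 < T)]
    linarith
  calc _ ≤ lg (T ^ 3) := Real.log_le_log (by positivity) h
    _ = _ := by rw [Real.log_pow]; norm_num

lemma Psi_near {q : ℝ → ℝ} (hq : ContDiff ℝ 2 q) {A : ℝ} (hA : 0 ≤ A) (hA1 : A ≤ 1) (hqA : q A = 0) {om : ℝ → ℝ} (hom : Om om) :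
    ∃ C, 0 < C ∧ ∀ T : ℝ, 3 ≤ T → ZB T → ∀ t, |t| ≤ 3 * T → |Psi q A om T t| ≤ C * lg T ^ 2 := by
  obtain ⟨C, hC, hP⟩ := PH_bound hq hA hA1 hqA
  obtain ⟨D, hD, hd⟩ := density
  refine ⟨C * (1 + 1) ^ 2 * ep 1 * (D * 3), by positivity, fun T hT hZ t ht => ?_⟩
  have hL := log_three hT
  set L := lg T with hLd
  have h1 : |Psi q A om T t| ≤ ∑ ρ ∈ Bd (T / 2) (4 * T), C * L * (1 + 1) ^ 2 * ep 1 * (mm ρ / (1 + (t - ρ.im) ^ 2)) := by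
    refine (Finset.abs_sum_le_sum_abs _ _).trans (Finset.sum_le_sum fun ρ hρ => ?_)
    obtain ⟨hz, h1, h2⟩ := mem_Bd.1 hρ
    have hp := hP L 1 ρ hL (by have := hZ ρ hz h1 h2; linarith) t
    have hm := mm_nonneg ρ
    rw [abs_mul, abs_mul, abs_of_nonneg hm, abs_of_nonneg (hom.nn _)]
    calc _ ≤ mm ρ * 1 * (C * L * (1 + 1) ^ 2 * ep 1 / (1 + (t - ρ.im) ^ 2)) := by
          gcongr; exact hom.le1 _
      _ = _ := by ring
  rw [← Finset.mul_sum] at h1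
  have h2 := ((hd t).1.sum_le_tsum (Bd (T / 2) (4 * T)) (fun ρ _ => div_nonneg (mm_nonneg ρ) (by positivity))).trans (hd t).2
  have h3 := log_band hT ht
  calc _ ≤ _ := h1
    _ ≤ C * L * (1 + 1) ^ 2 * ep 1 * (D * (3 * L)) := by gcongr; exact h2.trans (by gcongr)
    _ = _ := by ring

lemma Psi_far {q : ℝ → ℝ} (hq : ContDiff ℝ 2 q) {A : ℝ} (hA : 0 ≤ A) (hA1 : A ≤ 1) (hqA : q A = 0) {om : ℝ → ℝ} (hom : Om om) :
    ∃ C, 0 < C ∧ ∀ T : ℝ, 3 ≤ T → ZB T → ∀ t, 3 * T ≤ |t| → |Psi q A om T t| ≤ C * lg T * T ^ eA / t ^ 2 := by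
  obtain ⟨C, hC, hP⟩ := PH_bound hq hA hA1 hqA
  obtain ⟨D, hD, hd⟩ := N_bound
  refine ⟨C * (1 + 1) ^ 2 * ep 1 * 16 * D, by positivity, fun T hT hZ t ht => ?_⟩
  have hL := log_three hT
  have hT0 : 0 < T := by linarith
  set L := lg T with hLd
  have ht0 : 0 < |t| := by linarith
  have ht2 : 0 < t ^ 2 := by rw [← sq_abs]; positivity
  have h1 : |Psi q A om T t| ≤ ∑ ρ ∈ Bd (T / 2) (4 * T), C * L * (1 + 1) ^ 2 * ep 1 * 16 / t ^ 2 * mm ρ := by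
    refine (Finset.abs_sum_le_sum_abs _ _).trans (Finset.sum_le_sum fun ρ hρ => ?_)
    obtain ⟨hz, h1, h2⟩ := mem_Bd.1 hρ
    have hp := hP L 1 ρ hL (by have := hZ ρ hz h1 h2; linarith) t
    have hm := mm_nonneg ρ
    by_cases h0 : om (ρ.im / T) = 0
    · rw [h0]; simp; positivity
    obtain ⟨-, h4⟩ := hom.supp _ h0
    rw [div_le_iff₀ hT0] at h4
    have hx : t ^ 2 / 16 ≤ 1 + (t - ρ.im) ^ 2 := by
      have hx1 : |t| / 4 ≤ |t - ρ.im| := by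
        have := abs_sub_abs_le_abs_sub t ρ.im
        rw [abs_of_pos (by linarith : 0 < ρ.im)] at this
        linarith
      have := pow_le_pow_left₀ (by positivity) hx1 2
      rw [div_pow, sq_abs, sq_abs] at this
      linarith
    rw [abs_mul, abs_mul, abs_of_nonneg hm, abs_of_nonneg (hom.nn _)]
    calc _ ≤ mm ρ * 1 * (C * L * (1 + 1) ^ 2 * ep 1 / (t ^ 2 / 16)) := by
          gcongr
          · exact hom.le1 _
          · exact hp.trans (by gcongr)
      _ = _ := by field_simp
  rw [← Finset.mul_sum] at h1
  calc _ ≤ _ := h1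
    _ ≤ C * L * (1 + 1) ^ 2 * ep 1 * 16 / t ^ 2 * (D * T ^ eA) := by gcongr; exact hd T hT
    _ = _ := by ring

set_option maxHeartbeats 800000 in
open Classical in
lemma D_bound {q : ℝ → ℝ} (hq : ContDiff ℝ 2 q) {A : ℝ} (hA : 0 < A) (hA1 : A < 1) (hqA : q A = 0) {om : ℝ → ℝ} (hom : Om om) :
    ∃ C, 0 < C ∧ ∀ T : ℝ, 3 ≤ T → ZB T → ∀ t, |t| ≤ 3 * T →
      |Psi q A om T t - om (t / T) * VV q A T t| ≤ C * lg T ^ 3 * T ^ neD := by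
  obtain ⟨C, hC, hP⟩ := PH_bound hq hA.le hA1.le hqA
  obtain ⟨Cv, hCv, hV⟩ := conv_main hq hA hA1 hqA
  obtain ⟨D, hD, hd⟩ := density
  obtain ⟨N, hN, hn⟩ := N_bound
  obtain ⟨K, hK, hl⟩ := hom.lip
  have hHs := Hs_nonneg
  obtain ⟨c1, hc1⟩ : ∃ c, c = K * (C * (1 + 1) ^ 2 * ep 1) := ⟨_, rfl⟩
  obtain ⟨c2, hc2⟩ : ∃ c, c = C * 4 * ((2/5:ℝ) ^ neF * 9 ^ eA) := ⟨_, rfl⟩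
  have p1 : 0 < c1 := by rw [hc1]; positivity
  have p2 : 0 < c2 := by rw [hc2]; positivity
  refine ⟨c1 * (D * 3) + c1 * N + c2 * Hs, by positivity, fun T hT hZ t ht => ?_⟩
  have hL := log_three hT
  have hT0 : 0 < T := by linarith
  have hVs := (hV T hT t).1
  set L := lg T with hLd
  have hL22 : (1 + L / 2) ^ 2 ≤ 4 * L ^ 2 := by nlinarith
  set B := Bd (T / 2) (4 * T) with hB
  set lam := T ^ (5/8:ℝ) with hlam
  have hlam0 : 0 < lam := by positivity
  have s1 := hasSum_ite_fin B (fun ρ => mm ρ * om (ρ.im / T) * PH q A L ρ t)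
  have s2 := hVs.hasSum.mul_left (om (t / T))
  have s3 := s1.sub s2
  have g1 := (hd t).1.hasSum.mul_left (c1 * L / T * lam)
  have g2 := (hasSum_ite_fin B (fun ρ => mm ρ)).mul_left (c1 * L / T / lam)
  have g3 := Hs_summable.hasSum.mul_left (c2 * L ^ 3 * T ^ neD)
  have g := (g1.add g2).add g3
  have hpt : ∀ ρ : ℂ, ‖(if ρ ∈ B then mm ρ * om (ρ.im / T) * PH q A L ρ t else 0) - om (t / T) * (mm ρ * PH q A L ρ t)‖ ≤
      c1 * L / T * lam * (mm ρ / (1 + (t - ρ.im) ^ 2)) + c1 * L / T / lam * (if ρ ∈ B then mm ρ else 0) +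
        c2 * L ^ 3 * T ^ neD * (mm ρ * (1 + ‖ρ‖) ^ neA) := by
    intro ρ
    have hm := mm_nonneg ρ
    by_cases hm0 : mm ρ = 0
    · simp [hm0]
    obtain ⟨hz, hr0, hr1⟩ := mm_pos_re hm0
    have n3 : 0 ≤ c2 * L ^ 3 * T ^ neD * (mm ρ * (1 + ‖ρ‖) ^ neA) := by positivity
    have n1 : 0 ≤ c1 * L / T * lam * (mm ρ / (1 + (t - ρ.im) ^ 2)) := by positivity
    rw [Real.norm_eq_abs]
    by_cases hρ : ρ ∈ B
    · rw [if_pos hρ, if_pos hρ]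
      obtain ⟨-, h1, h2⟩ := mem_Bd.1 hρ
      have hp := hP L 1 ρ hL (by have := hZ ρ hz h1 h2; linarith) t
      have hll := hl (ρ.im / T) (t / T)
      rw [← sub_div, abs_div, abs_of_pos hT0, abs_sub_comm ρ.im] at hll
      set x := t - ρ.im with hx
      have e : mm ρ * om (ρ.im / T) * PH q A L ρ t - om (t / T) * (mm ρ * PH q A L ρ t) =
        mm ρ * ((om (ρ.im / T) - om (t / T)) * PH q A L ρ t) := by ring
      have hxl : |x| / (1 + x ^ 2) ≤ lam / (1 + x ^ 2) + 1 / lam := by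
        rw [div_add_div _ _ (by positivity) (by positivity), div_le_div_iff₀ (by positivity) (by positivity)]
        have h5 : |x| * lam ≤ lam * lam + (1 + x ^ 2) * 1 := by nlinarith [sq_abs x, sq_nonneg (|x| - lam), abs_nonneg x]
        nlinarith [sq_nonneg x]
      rw [e, abs_mul, abs_of_nonneg hm, abs_mul]
      calc _ ≤ mm ρ * (K * (|x| / T) * (C * L * (1 + 1) ^ 2 * ep 1 / (1 + x ^ 2))) := by
            gcongr
        _ = mm ρ * (c1 * L / T) * (|x| / (1 + x ^ 2)) := by rw [hc1]; ring
        _ ≤ mm ρ * (c1 * L / T) * (lam / (1 + x ^ 2) + 1 / lam) := by gcongr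
        _ = c1 * L / T * lam * (mm ρ / (1 + x ^ 2)) + c1 * L / T / lam * mm ρ := by ring
        _ ≤ _ := by linarith
    · rw [if_neg hρ, if_neg hρ, zero_sub, abs_neg]
      by_cases h0 : om (t / T) = 0
      · rw [h0, zero_mul, abs_zero]; linarith
      obtain ⟨h4, h5⟩ := hom.supp _ h0
      rw [div_le_iff₀ hT0] at h5
      rw [le_div_iff₀ hT0] at h4
      have hfar : 2/5 * T ≤ |t - ρ.im| := by
        by_contra hc
        push Not at hc
        obtain ⟨h6, h7⟩ := abs_lt.1 hc
        exact hρ (mem_Bd.2 ⟨hz, by linarith, by linarith⟩)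
      have hfp := far_pt hr0 hr1 (t := t) (r := 2/5 * T) (K := 6) (by linarith) (by rw [abs_of_pos (by linarith)]; linarith) (by norm_num) hfar
      have hp := hP L (L / 2) ρ hL (by
        have : |ρ.re - 1/2| ≤ 1/2 := abs_le.2 ⟨by linarith, by linarith⟩
        nlinarith) t
      have he : ep (L / 2) = T ^ eG := by rw [Real.rpow_def_of_pos hT0, ← hLd]; ring_nf
      have hTT : T ^ eG * T ^ neF = T ^ neD := by rw [← Real.rpow_add hT0]; norm_num
      rw [abs_mul, abs_mul, abs_of_nonneg hm, abs_of_nonneg (hom.nn _)]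
      calc _ ≤ 1 * (mm ρ * (C * L * (1 + L / 2) ^ 2 * ep (L / 2) / (1 + (t - ρ.im) ^ 2))) := by
            gcongr; exact hom.le1 _
        _ = mm ρ * (C * L * (1 + L / 2) ^ 2 * T ^ eG) * (1 / (1 + (t - ρ.im) ^ 2)) := by rw [he]; ring
        _ ≤ mm ρ * (C * L * (4 * L ^ 2) * T ^ eG) * ((2/5 * T) ^ neF * (3 + 6) ^ eA * (1 + ‖ρ‖) ^ neA) := by gcongr
        _ = c2 * L ^ 3 * (T ^ eG * T ^ neF) * (mm ρ * (1 + ‖ρ‖) ^ neA) := by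
            rw [Real.mul_rpow (by norm_num) hT0.le, hc2, show (3 + 6 : ℝ) = 9 by norm_num]; ring
        _ ≤ _ := by rw [hTT]; linarith
  have hfin := s3.norm_le_of_bounded g hpt
  have eV : ∑ ρ ∈ B, mm ρ * om (ρ.im / T) * PH q A L ρ t - om (t / T) * ∑' ρ, mm ρ * PH q A L ρ t =
      Psi q A om T t - om (t / T) * VV q A T t := rfl
  rw [Real.norm_eq_abs, eV] at hfin
  refine hfin.trans ?_
  have h1 := (hd t).2.trans (mul_le_mul_of_nonneg_left (log_band hT ht) hD.le)
  have h2 := hn T hT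
  have hle : T ^ (-(3/8):ℝ) ≤ T ^ neD := Real.rpow_le_rpow_of_exponent_le (by linarith) (by norm_num)
  have e1 : lam / T = T ^ (-(3/8):ℝ) := by
    rw [hlam, ← Real.rpow_sub_one hT0.ne']; norm_num
  have e2 : T ^ eA / T / lam = T ^ (-(3/8):ℝ) := by
    rw [hlam, ← Real.rpow_sub_one hT0.ne', ← Real.rpow_sub hT0]; norm_num
  have hL2 : L ^ 2 ≤ L ^ 3 := pow_le_pow_right₀ hL (by norm_num)
  have hL1 : L ≤ L ^ 3 := le_self_pow₀ hL (by norm_num)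
  calc _ ≤ c1 * L / T * lam * (D * (3 * L)) + c1 * L / T / lam * (N * T ^ eA) + c2 * L ^ 3 * T ^ neD * Hs := by
        have : ∑' ρ : ℂ, mm ρ * (1 + ‖ρ‖) ^ neA = Hs := rfl
        rw [this]
        gcongr
    _ = c1 * (D * 3) * (L ^ 2) * (lam / T) + c1 * N * L * (T ^ eA / T / lam) + c2 * Hs * L ^ 3 * T ^ neD := by ring
    _ ≤ c1 * (D * 3) * (L ^ 3) * T ^ neD + c1 * N * L ^ 3 * T ^ neD + c2 * Hs * L ^ 3 * T ^ neD := by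
        rw [e1, e2]; gcongr
    _ = _ := by ring

lemma Psi_prod {f b : ℝ → ℝ} (hf : ContDiff ℝ 2 f) (hb : ContDiff ℝ 2 b) {a a' : ℝ} (ha : 0 < a) (ha1 : a < 1) (ha' : 0 < a') (ha1' : a' < 1)
    (hfa : f a = 0) (hba : b a' = 0) {om : ℝ → ℝ} (hom : Om om) :
    ∃ C, 0 < C ∧ ∀ T : ℝ, 3 ≤ T → ZB T → ∀ t, Psi f a om T t * Psi b a' om T t ≤
      om (t / T) ^ 2 * (VV f a T t * VV b a' T t) + C * (lg T ^ 6 * T ^ neD) * (1 + (t / T) ^ 2)⁻¹ := by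
  obtain ⟨C1, p1, n1⟩ := Psi_near hf ha.le ha1.le hfa hom
  obtain ⟨C2, p2, n2⟩ := Psi_near hb ha'.le ha1'.le hba hom
  obtain ⟨E1, s1, f1⟩ := Psi_far hf ha.le ha1.le hfa hom
  obtain ⟨E2, s2, f2⟩ := Psi_far hb ha'.le ha1'.le hba hom
  obtain ⟨D1, r1, d1⟩ := D_bound hf ha ha1 hfa hom
  obtain ⟨D2, r2, d2⟩ := D_bound hb ha' ha1' hba hom
  refine ⟨10 * (C1 * D2 + D1 * C2 + D1 * D2) + E1 * E2, by positivity, fun T hT hZ t => ?_⟩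
  have hL := log_three hT
  have hT0 : 0 < T := by linarith
  set L := lg T with hLd
  have hL0 : 0 < L := by linarith
  have hE : 0 ≤ L ^ 6 * T ^ neD * (1 + (t / T) ^ 2)⁻¹ := by positivity
  rcases le_total |t| (3 * T) with ht | ht
  · have x1 := n1 T hT hZ t ht
    have x2 := n2 T hT hZ t ht
    have y1 := d1 T hT hZ t ht
    have y2 := d2 T hT hZ t ht
    have hT4 : T ^ neD ≤ 1 := Real.rpow_le_one_of_one_le_of_nonpos (by linarith) (by norm_num)
    have hT4' : 0 < T ^ neD := by positivity
    generalize T ^ neD = τ at *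
    generalize Psi f a om T t = P1 at *
    generalize Psi b a' om T t = P2 at *
    set G1 := P1 - om (t / T) * VV f a T t with hG1
    set G2 := P2 - om (t / T) * VV b a' T t with hG2
    have e : P1 * P2 - om (t / T) ^ 2 * (VV f a T t * VV b a' T t) = P1 * G2 + G1 * P2 - G1 * G2 := by rw [hG1, hG2]; ring
    have z1 : P1 * G2 ≤ (C1 * L ^ 2) * (D2 * L ^ 3 * τ) := by
      refine (le_abs_self _).trans ?_; rw [abs_mul]; exact mul_le_mul x1 y2 (abs_nonneg _) (by positivity)
    have z2 : G1 * P2 ≤ (D1 * L ^ 3 * τ) * (C2 * L ^ 2) := by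
      refine (le_abs_self _).trans ?_; rw [abs_mul]; exact mul_le_mul y1 x2 (abs_nonneg _) (by positivity)
    have z3 : -(G1 * G2) ≤ (D1 * L ^ 3 * τ) * (D2 * L ^ 3 * τ) := by
      refine (neg_le_abs _).trans ?_; rw [abs_mul]; exact mul_le_mul y1 y2 (abs_nonneg _) (by positivity)
    have h56 : L ^ 5 ≤ L ^ 6 := pow_le_pow_right₀ hL (by norm_num)
    have w1 : (C1 * L ^ 2) * (D2 * L ^ 3 * τ) ≤ C1 * D2 * (L ^ 6 * τ) := by
      calc _ = C1 * D2 * (L ^ 5 * τ) := by ring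
        _ ≤ _ := by gcongr
    have w2 : (D1 * L ^ 3 * τ) * (C2 * L ^ 2) ≤ D1 * C2 * (L ^ 6 * τ) := by
      calc _ = D1 * C2 * (L ^ 5 * τ) := by ring
        _ ≤ _ := by gcongr
    have w3 : (D1 * L ^ 3 * τ) * (D2 * L ^ 3 * τ) ≤ D1 * D2 * (L ^ 6 * τ) := by
      calc _ = D1 * D2 * (L ^ 6 * τ) * τ := by ring
        _ ≤ _ := mul_le_of_le_one_right (by positivity) hT4
    have hinv : 1 ≤ 10 * (1 + (t / T) ^ 2)⁻¹ := by
      rw [← div_eq_mul_inv, le_div_iff₀ (by positivity)]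
      have : (t / T) ^ 2 ≤ 9 := by
        rw [div_pow, div_le_iff₀ (by positivity), ← sq_abs]
        calc |t| ^ 2 ≤ (3 * T) ^ 2 := by gcongr
          _ = _ := by ring
      linarith
    have hfin : P1 * P2 - om (t / T) ^ 2 * (VV f a T t * VV b a' T t) ≤ (C1 * D2 + D1 * C2 + D1 * D2) * (L ^ 6 * τ) := by
      rw [e]; linarith
    have hfin2 : (C1 * D2 + D1 * C2 + D1 * D2) * (L ^ 6 * τ) ≤ (C1 * D2 + D1 * C2 + D1 * D2) * (L ^ 6 * τ) * (10 * (1 + (t / T) ^ 2)⁻¹) :=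
      le_mul_of_one_le_right (by positivity) hinv
    have : 0 ≤ E1 * E2 * (L ^ 6 * τ * (1 + (t / T) ^ 2)⁻¹) := by positivity
    linarith
  · have ho : om (t / T) = 0 := by
      by_contra h
      obtain ⟨h1, h2⟩ := hom.supp _ h
      rw [le_div_iff₀ hT0] at h1
      rw [div_le_iff₀ hT0] at h2
      rw [abs_of_pos (by linarith)] at ht
      linarith
    have x1 := f1 T hT hZ t ht
    have x2 := f2 T hT hZ t ht
    rw [← hLd] at x1 x2
    have ht2 : 9 * T ^ 2 ≤ t ^ 2 := by
      rw [← sq_abs t]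
      calc 9 * T ^ 2 = (3 * T) ^ 2 := by ring
        _ ≤ _ := by gcongr
    have ht0 : 0 < t ^ 2 := lt_of_lt_of_le (by positivity) ht2
    have z : Psi f a om T t * Psi b a' om T t ≤ (E1 * L * T ^ eA / t ^ 2) * (E2 * L * T ^ eA / t ^ 2) := by
      refine (le_abs_self _).trans ?_; rw [abs_mul]; exact mul_le_mul x1 x2 (abs_nonneg _) (by positivity)
    have hTp : T ^ eA * T ^ eA ≤ T ^ neD * T ^ 4 := by
      rw [← Real.rpow_natCast, ← Real.rpow_add hT0, ← Real.rpow_add hT0]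
      exact Real.rpow_le_rpow_of_exponent_le (by linarith) (by norm_num)
    have hinv : T ^ 2 / (2 * t ^ 2) ≤ (1 + (t / T) ^ 2)⁻¹ := by
      rw [inv_eq_one_div, div_le_div_iff₀ (by positivity) (by positivity), div_pow]
      have : T ^ 2 * (1 + t ^ 2 / T ^ 2) = T ^ 2 + t ^ 2 := by field_simp
      rw [this]; nlinarith
    have hL26 : L ^ 2 ≤ L ^ 6 := pow_le_pow_right₀ hL (by norm_num)
    have z2 : (E1 * L * T ^ eA / t ^ 2) * (E2 * L * T ^ eA / t ^ 2) ≤ E1 * E2 * (L ^ 6 * T ^ neD) * (1 + (t / T) ^ 2)⁻¹ := by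
      calc _ = E1 * E2 * L ^ 2 * (T ^ eA * T ^ eA) / (t ^ 2 * t ^ 2) := by ring
        _ ≤ E1 * E2 * L ^ 6 * (T ^ neD * T ^ 4) / (9 * T ^ 2 * t ^ 2) := by gcongr
        _ = E1 * E2 * (L ^ 6 * T ^ neD) * (T ^ 2 / (9 * t ^ 2)) := by field_simp
        _ ≤ E1 * E2 * (L ^ 6 * T ^ neD) * (T ^ 2 / (2 * t ^ 2)) := by gcongr; norm_num
        _ ≤ _ := by gcongr
    rw [ho]
    have : 0 ≤ 10 * (C1 * D2 + D1 * C2 + D1 * D2) * (L ^ 6 * T ^ neD * (1 + (t / T) ^ 2)⁻¹) := by positivity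
    linarith

lemma log_pow_le (k : ℕ) {s : ℝ} (hs : 0 < s) : ∃ C, 0 < C ∧ ∀ T : ℝ, 3 ≤ T → lg T ^ k * T ^ (-s) ≤ C := by
  refine ⟨((s / (k + 1))⁻¹) ^ k, by positivity, fun T hT => ?_⟩
  have hT0 : 0 < T := by linarith
  have h := Real.log_le_rpow_div hT0.le (div_pos hs (by positivity : (0:ℝ) < k + 1))
  have hL := log_three hT
  calc _ ≤ (T ^ (s / (k + 1)) / (s / (k + 1))) ^ k * T ^ (-s) := by gcongr
    _ = ((s / (k + 1))⁻¹) ^ k * (T ^ (s / (k + 1) * k) * T ^ (-s)) := by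
        rw [div_eq_mul_inv, mul_pow, Real.rpow_mul hT0.le, Real.rpow_natCast]; ring
    _ ≤ ((s / (k + 1))⁻¹) ^ k * 1 := by
        gcongr
        rw [← Real.rpow_add hT0]
        refine Real.rpow_le_one_of_one_le_of_nonpos (by linarith) ?_
        have : s / (k + 1) * k ≤ s := by
          rw [div_mul_eq_mul_div, div_le_iff₀ (by positivity)]; nlinarith
        linarith
    _ = _ := mul_one _

lemma VV_approx {q : ℝ → ℝ} (hq : ContDiff ℝ 2 q) {A : ℝ} (hA : 0 < A) (hA1 : A < 1) (hqA : q A = 0) :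
    ∃ C, 0 < C ∧ ∀ T : ℝ, 3 ≤ T → ∀ t, 9/10 * T ≤ t → t ≤ 21/10 * T →
      |VV q A T t - (1/2 * q 0 * lg T - SS q A T t)| ≤ C := by
  obtain ⟨C, hC, h⟩ := conv_main hq hA hA1 hqA
  obtain ⟨c₀, D, hD, hG⟩ := GG_asymp
  obtain ⟨E, hE, hlog⟩ := log_pow_le 2 (s := 1/20) (by norm_num)
  refine ⟨C * E * eE ^ neC + |q 0| * (D + |c₀| + 1), by positivity, fun T hT t h1 h2 => ?_⟩
  have hT0 : 0 < T := by linarith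
  have hL := log_three hT
  have ha := (h T hT t).2
  have hb := hG t
  have ht0 : 0 < t := by linarith
  rw [abs_of_pos ht0] at ha hb
  have hb' : D * (1 + t) ^ neE ≤ D :=
    mul_le_of_le_one_right hD.le (Real.rpow_le_one_of_one_le_of_nonpos (by linarith) (by norm_num))
  have hl : |lg (1 + t) - lg T| ≤ 2 := by
    rw [← Real.log_div (by positivity) hT0.ne', abs_le]
    have u1 : eE ≤ (1 + t) / T := by rw [le_div_iff₀ hT0]; linarith
    have u2 : (1 + t) / T ≤ 3 := by rw [div_le_iff₀ hT0]; linarith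
    have u3 := Real.one_sub_inv_le_log_of_pos (by positivity : 0 < (1 + t) / T)
    have u4 := Real.log_le_sub_one_of_pos (by positivity : 0 < (1 + t) / T)
    have u5 : ((1 + t) / T)⁻¹ ≤ (9/10:ℝ)⁻¹ := inv_anti₀ (by norm_num) u1
    have u6 : (9/10:ℝ)⁻¹ ≤ 2 := by norm_num
    constructor <;> linarith
  have hg : |GG t - 1/2 * lg T| ≤ D + |c₀| + 1 := by
    have v1 := abs_le.1 (hb.trans hb')
    have v2 := abs_le.1 hl
    have v3 := neg_abs_le c₀
    have v4 := le_abs_self c₀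
    rw [abs_le]; constructor <;> linarith
  have hc : C * lg T ^ 2 * T ^ (3/4 * A) * (1 + t) ^ neC ≤ C * E * eE ^ neC := by
    have w1 : (1 + t) ^ neC ≤ (9/10 * T) ^ neC :=
      Real.rpow_le_rpow_of_nonpos (by positivity) (by linarith) (by norm_num)
    have w2 : T ^ (3/4 * A) ≤ T ^ eF := Real.rpow_le_rpow_of_exponent_le (by linarith) (by linarith)
    have w3 : T ^ eF * T ^ neC = T ^ (-(1/20):ℝ) := by rw [← Real.rpow_add hT0]; norm_num
    calc _ ≤ C * lg T ^ 2 * T ^ eF * (9/10 * T) ^ neC := by gcongr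
      _ = C * (lg T ^ 2 * (T ^ eF * T ^ neC)) * eE ^ neC := by
          rw [Real.mul_rpow (by norm_num) hT0.le]; ring
      _ ≤ _ := by rw [w3]; gcongr; exact hlog T hT
  have e : VV q A T t - (1/2 * q 0 * lg T - SS q A T t) =
      (VV q A T t - q 0 * GG t + SS q A T t) + q 0 * (GG t - 1/2 * lg T) := by ring
  rw [e]
  refine (abs_add_le _ _).trans (add_le_add (ha.trans hc) ?_)
  rw [abs_mul]; gcongr

lemma VV_prod {f b : ℝ → ℝ} (hf : ContDiff ℝ 2 f) (hb : ContDiff ℝ 2 b) {a a' : ℝ} (ha : 0 < a) (ha1 : a < 1) (ha' : 0 < a') (ha1' : a' < 1)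
    (hfa : f a = 0) (hba : b a' = 0) (hb0 : b 0 = 1) :
    ∃ K, 0 ≤ K ∧ ∀ T : ℝ, 3 ≤ T → ∀ t, 9/10 * T ≤ t → t ≤ 21/10 * T →
      VV f a T t * VV b a' T t ≤ (1/2 * f 0 * lg T - SS f a T t) * (1/2 * lg T - SS b a' T t) +
        K * (lg T + SS f a T t ^ 2 / lg T + SS b a' T t ^ 2 / lg T) := by
  obtain ⟨C1, p1, h1⟩ := VV_approx hf ha ha1 hfa
  obtain ⟨C2, p2, h2⟩ := VV_approx hb ha' ha1' hba
  refine ⟨C1 * 2 + C2 * (|f 0| + 1) + C1 * C2, by positivity, fun T hT t ht1 ht2 => ?_⟩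
  have hL := log_three hT
  have x1 := h1 T hT t ht1 ht2
  have x2 := h2 T hT t ht1 ht2
  rw [hb0] at x2
  generalize lg T = L at *
  generalize SS f a T t = S1 at *
  generalize SS b a' T t = S2 at *
  set e1 := VV f a T t - (1/2 * f 0 * L - S1) with he1
  set e2 := VV b a' T t - (1/2 * 1 * L - S2) with he2
  have hL0 : 0 < L := by linarith
  have hS : ∀ S : ℝ, |S| ≤ L + S ^ 2 / L := fun S => by
    have e : S ^ 2 / L = |S| * (|S| / L) := by rw [← sq_abs]; ring
    rcases le_total |S| L with h | h
    · have : 0 ≤ S ^ 2 / L := by positivity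
      linarith
    · rw [e]
      have : |S| ≤ |S| * (|S| / L) := le_mul_of_one_le_right (abs_nonneg _) (by rw [le_div_iff₀ hL0]; linarith)
      linarith
  have hS1 := hS S1
  have hS2 := hS S2
  have n1 : 0 ≤ S1 ^ 2 / L := by positivity
  have n2 : 0 ≤ S2 ^ 2 / L := by positivity
  set Z := L + S1 ^ 2 / L + S2 ^ 2 / L with hZ
  have y1 : |1/2 * f 0 * L - S1| ≤ (|f 0| + 1) * Z := by
    refine (abs_sub _ _).trans ?_
    rw [abs_mul, abs_mul, abs_of_pos hL0]
    norm_num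
    nlinarith [abs_nonneg (f 0)]
  have y2 : |1/2 * L - S2| ≤ 2 * Z := by
    refine (abs_sub _ _).trans ?_
    rw [abs_mul, abs_of_pos hL0]
    norm_num
    nlinarith
  have e : VV f a T t * VV b a' T t = (1/2 * f 0 * L - S1) * (1/2 * L - S2) + e1 * (1/2 * L - S2) + (1/2 * f 0 * L - S1) * e2 + e1 * e2 := by
    rw [he1, he2]; ring
  have z1 : e1 * (1/2 * L - S2) ≤ C1 * (2 * Z) := by
    refine (le_abs_self _).trans ?_; rw [abs_mul]; exact mul_le_mul x1 y2 (abs_nonneg _) p1.le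
  have z2 : (1/2 * f 0 * L - S1) * e2 ≤ ((|f 0| + 1) * Z) * C2 := by
    refine (le_abs_self _).trans ?_; rw [abs_mul]; exact mul_le_mul y1 x2 (abs_nonneg _) (by positivity)
  have z3 : e1 * e2 ≤ C1 * C2 := by
    refine (le_abs_self _).trans ?_; rw [abs_mul]; exact mul_le_mul x1 x2 (abs_nonneg _) p1.le
  have z4 : C1 * C2 ≤ C1 * C2 * Z := le_mul_of_one_le_right (by positivity) (by linarith)
  rw [e]; linarith

lemma pair_upper {f b : ℝ → ℝ} (hf : ContDiff ℝ 2 f) (hb : ContDiff ℝ 2 b) {a a' : ℝ} (ha : 0 < a) (haa : a < a') (ha1 : a' < 1)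
    (hfa : f a = 0) (hba : b a' = 0) (hf0 : ∀ α ∈ Icc 0 a, 0 ≤ f α) (hb1 : ∀ α ∈ Icc 0 a, b α = 1) {om : ℝ → ℝ} (hom : Om om) :
    ∃ C, 0 < C ∧ ∀ T : ℝ, 3 ≤ T → ZB T → ∫ t, Psi f a om T t * Psi b a' om T t ≤
      T * (∫ s, om s ^ 2) * lg T ^ 2 * (1/4 * f 0 + 1/2 * ∫ α in (0:ℝ)..a, α * f α) + C * T * lg T := by
  have ha' : 0 < a' := ha.trans haa
  have hac : a < 1 := haa.trans ha1
  have hb0 : b 0 = 1 := hb1 0 ⟨le_rfl, ha.le⟩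
  have hw : ContDiff ℝ ∞ fun s => om s ^ 2 := hom.smooth.pow 2
  have hws : HasCompactSupport fun s => om s ^ 2 := by
    have := hom.cpt.mul_right (f' := om)
    simp only [sq]; exact this
  obtain ⟨C1, p1, h1⟩ := Psi_prod hf hb ha hac ha' ha1 hfa hba hom
  obtain ⟨K, hK, h2⟩ := VV_prod hf hb ha hac ha' ha1 hfa hba hb0
  obtain ⟨C3, p3, h3⟩ := prime_int hw hws (integral_nonneg fun s => sq_nonneg _) (hf.of_le (by norm_num)) hb.continuous ha haa ha1 hfa hba hf0 hb1 K hK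
  obtain ⟨E, hE, hlog⟩ := log_pow_le 6 (s := 1/4) (by norm_num)
  refine ⟨C3 + C1 * E * pI, by positivity, fun T hT hZ => ?_⟩
  have hT0 : 0 < T := by linarith
  have hL := log_three hT
  have i1 : Integrable fun t => (fun s => om s ^ 2) (t / T) * ((1/2 * f 0 * lg T - SS f a T t) * (1/2 * lg T - SS b a' T t) +
        K * (lg T + SS f a T t ^ 2 / lg T + SS b a' T t ^ 2 / lg T)) := by
    refine w_comp_integrable hw.continuous hws hT0 ?_
    have c1 := SS_cont f a T
    have c2 := SS_cont b a' T
    fun_prop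
  have i2 : Integrable fun t : ℝ => C1 * (lg T ^ 6 * T ^ neD) * (1 + (t / T) ^ 2)⁻¹ :=
    (integrable_inv_one_add_sq.comp_div hT0.ne').const_mul _
  have i0 : Integrable fun t => Psi f a om T t * Psi b a' om T t := by
    have : ∀ t, Psi f a om T t * Psi b a' om T t = ∑ ρ ∈ Bd (T / 2) (4 * T), ∑ ρ' ∈ Bd (T / 2) (4 * T),
        (mm ρ * om (ρ.im / T)) * (mm ρ' * om (ρ'.im / T)) * (PH f a (lg T) ρ t * PH b a' (lg T) ρ' t) := fun t => by
      rw [Psi, Psi, Finset.sum_mul_sum]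
      refine Finset.sum_congr rfl fun ρ _ => Finset.sum_congr rfl fun ρ' _ => by ring
    simp only [this]
    exact integrable_finsetSum _ fun ρ _ => integrable_finsetSum _ fun ρ' _ =>
      (PH_mul_integrable hf hb ha.le ha'.le hac.le hfa hba hL ρ ρ').const_mul _
  have hle : ∫ t, Psi f a om T t * Psi b a' om T t ≤ _ := integral_mono i0 (i1.add i2) (fun t => by
    refine (h1 T hT hZ t).trans ?_
    simp only [Pi.add_apply]
    refine add_le_add ?_ le_rfl
    by_cases ho : om (t / T) = 0
    · rw [ho]; simp
    obtain ⟨g1, g2⟩ := hom.supp _ ho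
    rw [le_div_iff₀ hT0] at g1
    rw [div_le_iff₀ hT0] at g2
    exact mul_le_mul_of_nonneg_left (h2 T hT t g1 g2) (sq_nonneg _))
  have e := integral_add i1 i2
  have e' : ∫ t : ℝ, C1 * (lg T ^ 6 * T ^ neD) * (1 + (t / T) ^ 2)⁻¹ = C1 * (lg T ^ 6 * T ^ neD) * (T * pI) := by
    rw [integral_const_mul]
    have h := Measure.integral_comp_div (fun s : ℝ => (1 + s ^ 2)⁻¹) T
    rw [abs_of_pos hT0, smul_eq_mul, integral_univ_inv_one_add_sq] at h
    rw [h]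
  refine hle.trans ?_
  refine (le_of_eq e).trans ?_
  rw [e']
  have q1 := h3 T hT
  have q2 : C1 * (lg T ^ 6 * T ^ neD) * (T * pI) ≤ C1 * E * pI * (T * lg T) := by
    calc _ ≤ C1 * E * (T * pI) := by gcongr; exact hlog T hT
      _ = C1 * E * pI * (T * 1) := by ring
      _ ≤ _ := by gcongr
  linarith

lemma box_ZB (hbox : ∀ᶠ T in atTop, ∀ ρ ∈ zeroBand T, |ρ.re - 1/2| < 0.001 / (2 * lg T)) : ∀ᶠ T in atTop, ZB T := by
  have hc : ∀ c : ℝ, 1/2 ≤ c → ∀ᶠ T in atTop, ∀ ρ, XX ρ = 0 → c * T < ρ.im → ρ.im ≤ 2 * (c * T) → |ρ.re - 1/2| * lg T ≤ 0.0005005 := by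
    intro c hc
    have h1 := (tendsto_id.const_mul_atTop (by linarith : 0 < c)).eventually hbox
    filter_upwards [h1, Real.tendsto_log_atTop.eventually_ge_atTop 1001, eventually_gt_atTop 0] with T h hL hT ρ hz g1 g2
    have h2 := h ρ ⟨(XX_zero_iff ρ).1 hz, g1, g2⟩
    simp only [id] at h2
    have hl : lg T - 1 ≤ lg (c * T) := by
      rw [Real.log_mul (by linarith) hT.ne']
      have := Real.one_sub_inv_le_log_of_pos (by linarith : 0 < c)
      have h3 : c⁻¹ ≤ (1/2:ℝ)⁻¹ := inv_anti₀ (by norm_num) hc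
      norm_num at h3
      linarith
    rw [lt_div_iff₀ (by linarith)] at h2
    have h0 := abs_nonneg (ρ.re - 1/2)
    nlinarith
  filter_upwards [hc (1/2) le_rfl, hc 1 (by norm_num), hc 2 (by norm_num)] with T h1 h2 h3 ρ hz g1 g2
  rcases le_or_gt ρ.im T with h | h
  · exact h1 ρ hz (by linarith) (by linarith)
  rcases le_or_gt ρ.im (2 * T) with h' | h'
  · exact h2 ρ hz (by linarith) (by linarith)
  · exact h3 ρ hz (by linarith) (by linarith)

lemma PH_pos {f b : ℝ → ℝ} (hf : ContDiff ℝ 2 f) (hb : ContDiff ℝ 2 b) {a a' : ℝ} (ha : 0 ≤ a) (haa : a ≤ a')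
    (hfa : f a = 0) (hf0 : ∀ α ∈ Icc 0 a, 0 ≤ f α) (hb1 : ∀ α ∈ Icc 0 a, b α = 1)
    (hpos : ∀ η x : ℝ, |η| ≤ 0.001001 → 0 ≤ ∫ α in (0:ℝ)..a, f α * kc (η * α) * cs (x * α))
    {L : ℝ} (hL : 0 < L) {ρ ρ' : ℂ} (h1 : |ρ.re - 1/2| * L ≤ 0.0005005) (h2 : |ρ'.re - 1/2| * L ≤ 0.0005005) :
    0 ≤ ∫ t, PH f a L ρ t * PH b a' L ρ' t ∧ (ρ.im = ρ'.im → pI * L * ∫ α in (0:ℝ)..a, f α ≤ ∫ t, PH f a L ρ t * PH b a' L ρ' t) := by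
  have hfc := hf.continuous
  rw [PH_prod hf hb ha haa hfa hb1 hL]
  set c := (ρ.re - 1/2) * L with hc
  set c' := (ρ'.re - 1/2) * L with hc'
  have k1 : |c| ≤ 0.0005005 := by rw [hc, abs_mul, abs_of_pos hL]; exact h1
  have k2 : |c'| ≤ 0.0005005 := by rw [hc', abs_mul, abs_of_pos hL]; exact h2
  constructor
  · refine mul_nonneg (by positivity) ?_
    have e : ∀ α, f α * (kc (c * α) * kc (c' * α)) * cs (L * (ρ.im - ρ'.im) * α) =
        1/2 * (f α * kc ((c + c') * α) * cs (L * (ρ.im - ρ'.im) * α)) +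
        1/2 * (f α * kc ((c - c') * α) * cs (L * (ρ.im - ρ'.im) * α)) := fun α => by
      rw [add_mul c, sub_mul c, Real.cosh_add, Real.cosh_sub]; ring
    simp only [e]
    rw [intervalIntegral.integral_add (by apply Continuous.intervalIntegrable; fun_prop) (by apply Continuous.intervalIntegrable; fun_prop),
      intervalIntegral.integral_const_mul, intervalIntegral.integral_const_mul]
    have p1 := hpos (c + c') (L * (ρ.im - ρ'.im)) ((abs_add_le _ _).trans (by linarith))
    have p2 := hpos (c - c') (L * (ρ.im - ρ'.im)) ((abs_sub _ _).trans (by linarith))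
    linarith
  · intro hg
    refine mul_le_mul_of_nonneg_left ?_ (by positivity)
    refine intervalIntegral.integral_mono_on ha (by apply Continuous.intervalIntegrable; fun_prop)
      (by apply Continuous.intervalIntegrable; fun_prop) fun α hα => ?_
    rw [hg, sub_self, mul_zero, zero_mul, Real.cos_zero, mul_one]
    refine le_mul_of_one_le_right (hf0 α hα) ?_
    exact one_le_mul_of_one_le_of_one_le (Real.one_le_cosh _) (Real.one_le_cosh _)

lemma pair_sum {f b : ℝ → ℝ} (hf : ContDiff ℝ 2 f) (hb : ContDiff ℝ 2 b) {a a' : ℝ} (ha : 0 < a) (haa : a < a') (ha1 : a' < 1)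
    (hfa : f a = 0) (hba : b a' = 0) (hf0 : ∀ α ∈ Icc 0 a, 0 ≤ f α) (hb1 : ∀ α ∈ Icc 0 a, b α = 1)
    (hpos : ∀ η x : ℝ, |η| ≤ 0.001001 → 0 ≤ ∫ α in (0:ℝ)..a, f α * kc (η * α) * cs (x * α)) {om : ℝ → ℝ} (hom : Om om) :
    ∃ C, 0 < C ∧ ∀ T : ℝ, 3 ≤ T → ZB T →
      (∑ ρ ∈ Bd T (2 * T), ∑ ρ' ∈ Bd T (2 * T), if ρ.im = ρ'.im then mm ρ * mm ρ' else 0) * (pI * ∫ α in (0:ℝ)..a, f α) ≤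
      T * (∫ s, om s ^ 2) * lg T * (1/4 * f 0 + 1/2 * ∫ α in (0:ℝ)..a, α * f α) + C * T := by
  obtain ⟨C, hC, h⟩ := pair_upper hf hb ha haa ha1 hfa hba hf0 hb1 hom
  refine ⟨C, hC, fun T hT hZ => ?_⟩
  have hT0 : 0 < T := by linarith
  have hL := log_three hT
  have h1 := h T hT hZ
  set L := lg T with hLd
  have hL0 : 0 < L := by linarith
  have e : ∀ t, Psi f a om T t * Psi b a' om T t = ∑ ρ ∈ Bd (T / 2) (4 * T), ∑ ρ' ∈ Bd (T / 2) (4 * T),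
      (mm ρ * om (ρ.im / T)) * (mm ρ' * om (ρ'.im / T)) * (PH f a L ρ t * PH b a' L ρ' t) := fun t => by
    rw [Psi, Psi, Finset.sum_mul_sum]
    refine Finset.sum_congr rfl fun ρ _ => Finset.sum_congr rfl fun ρ' _ => by ring
  have hi : ∀ ρ ρ' : ℂ, Integrable fun t => (mm ρ * om (ρ.im / T)) * (mm ρ' * om (ρ'.im / T)) * (PH f a L ρ t * PH b a' L ρ' t) :=
    fun ρ ρ' => (PH_mul_integrable hf hb ha.le (ha.trans haa).le (haa.trans ha1).le hfa hba hL ρ ρ').const_mul _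
  have e2 : ∫ t, Psi f a om T t * Psi b a' om T t = ∑ ρ ∈ Bd (T / 2) (4 * T), ∑ ρ' ∈ Bd (T / 2) (4 * T),
      (mm ρ * om (ρ.im / T)) * (mm ρ' * om (ρ'.im / T)) * ∫ t, PH f a L ρ t * PH b a' L ρ' t := by
    simp only [e]
    rw [integral_finsetSum _ fun ρ _ => integrable_finsetSum _ fun ρ' _ => hi ρ ρ']
    refine Finset.sum_congr rfl fun ρ _ => ?_
    rw [integral_finsetSum _ fun ρ' _ => hi ρ ρ']
    exact Finset.sum_congr rfl fun ρ' _ => integral_const_mul _ _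
  have hP : ∀ ρ ∈ Bd (T / 2) (4 * T), ∀ ρ' ∈ Bd (T / 2) (4 * T), _ := fun ρ hρ ρ' hρ' => by
    obtain ⟨z1, g1, g2⟩ := mem_Bd.1 hρ
    obtain ⟨z1', g1', g2'⟩ := mem_Bd.1 hρ'
    exact PH_pos hf hb ha.le haa.le hfa hf0 hb1 hpos hL0 (hZ ρ z1 g1 g2) (hZ ρ' z1' g1' g2')
  have hw : ∀ ρ, 0 ≤ mm ρ * om (ρ.im / T) := fun ρ => mul_nonneg (mm_nonneg _) (hom.nn _)
  have hsub : Bd T (2 * T) ⊆ Bd (T / 2) (4 * T) := fun ρ hρ => by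
    obtain ⟨z1, g1, g2⟩ := mem_Bd.1 hρ
    exact mem_Bd.2 ⟨z1, by linarith, by linarith⟩
  have ho1 : ∀ ρ ∈ Bd T (2 * T), om (ρ.im / T) = 1 := fun ρ hρ => by
    obtain ⟨z1, g1, g2⟩ := mem_Bd.1 hρ
    exact hom.one _ ⟨by rw [le_div_iff₀ hT0]; linarith, by rw [div_le_iff₀ hT0]; linarith⟩
  set J := ∫ α in (0:ℝ)..a, f α with hJ
  have h2 : (∑ ρ ∈ Bd T (2 * T), ∑ ρ' ∈ Bd T (2 * T), if ρ.im = ρ'.im then mm ρ * mm ρ' else 0) * (pI * L * J) ≤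
      ∫ t, Psi f a om T t * Psi b a' om T t := by
    rw [e2, Finset.sum_mul]
    refine le_trans (Finset.sum_le_sum fun ρ hρ => ?_) (Finset.sum_le_sum_of_subset_of_nonneg hsub fun ρ hρ _ =>
      Finset.sum_nonneg fun ρ' hρ' => mul_nonneg (mul_nonneg (hw ρ) (hw ρ')) (hP ρ hρ ρ' hρ').1)
    rw [Finset.sum_mul]
    refine le_trans (Finset.sum_le_sum fun ρ' hρ' => ?_) (Finset.sum_le_sum_of_subset_of_nonneg hsub fun ρ' hρ' _ =>
      mul_nonneg (mul_nonneg (hw ρ) (hw ρ')) (hP ρ (hsub hρ) ρ' hρ').1)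
    obtain ⟨q1, q2⟩ := hP ρ (hsub hρ) ρ' (hsub hρ')
    rw [ho1 ρ hρ, ho1 ρ' hρ', mul_one, mul_one]
    have hmm : 0 ≤ mm ρ * mm ρ' := mul_nonneg (mm_nonneg _) (mm_nonneg _)
    split_ifs with hg
    · exact mul_le_mul_of_nonneg_left (q2 hg) hmm
    · rw [zero_mul]; exact mul_nonneg hmm q1
  have h3 := h2.trans h1
  refine le_of_mul_le_mul_right ?_ hL0
  calc _ = _ := by rw [mul_assoc, show pI * J * L = pI * L * J by ring]
    _ ≤ _ := h3
    _ = _ := by ring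

open Classical in
noncomputable def Al (T : ℝ) : Finset ℂ := (Bd T (2 * T)).filter fun ρ => mm ρ = 1 ∧ ∀ ρ' ∈ Bd T (2 * T), ρ'.im = ρ.im → ρ' = ρ

lemma mm_ge_one {ρ : ℂ} (h : XX ρ = 0) : 1 ≤ mm ρ := by
  have := order_pos_of_zero XX_diff XX_zero h
  unfold mm; exact_mod_cast this

lemma alone_lower (T : ℝ) : 2 * (∑ ρ ∈ Bd T (2 * T), mm ρ) -
    (∑ ρ ∈ Bd T (2 * T), ∑ ρ' ∈ Bd T (2 * T), if ρ.im = ρ'.im then mm ρ * mm ρ' else 0) ≤ ((Al T).card : ℝ) := by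
  classical
  have h : ((Al T).card : ℝ) = ∑ ρ ∈ Bd T (2 * T), if (mm ρ = 1 ∧ ∀ ρ' ∈ Bd T (2 * T), ρ'.im = ρ.im → ρ' = ρ) then (1:ℝ) else 0 := by
    rw [Al, Finset.card_filter]; push_cast
    refine Finset.sum_congr rfl fun ρ _ => ?_
    congr
  rw [h, Finset.mul_sum, ← Finset.sum_sub_distrib]
  refine Finset.sum_le_sum fun ρ hρ => ?_
  set B := Bd T (2 * T) with hB
  have hz := (mem_Bd.1 hρ).1
  have hm := mm_ge_one hz
  have hnn : ∀ ρ' ∈ B, 0 ≤ (if ρ.im = ρ'.im then mm ρ * mm ρ' else 0) := fun ρ' _ => by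
    split_ifs
    · exact mul_nonneg (mm_nonneg _) (mm_nonneg _)
    · exact le_rfl
  have h1 : mm ρ * mm ρ ≤ ∑ ρ' ∈ B, if ρ.im = ρ'.im then mm ρ * mm ρ' else 0 := by
    have := Finset.single_le_sum hnn hρ
    rwa [if_pos rfl] at this
  split_ifs with hal
  · rw [hal.1] at h1 ⊢; linarith
  · by_cases hm1 : mm ρ = 1
    · have : ∃ ρ' ∈ B, ρ'.im = ρ.im ∧ ρ' ≠ ρ := by
        by_contra hc; push Not at hc; exact hal ⟨hm1, hc⟩
      obtain ⟨ρ', hρ', hi, hne⟩ := this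
      have h2 : ∑ x ∈ {ρ, ρ'}, (if ρ.im = x.im then mm ρ * mm x else 0) ≤ ∑ x ∈ B, if ρ.im = x.im then mm ρ * mm x else 0 :=
        Finset.sum_le_sum_of_subset_of_nonneg (fun x hx => by
          rcases Finset.mem_insert.1 hx with rfl | hx
          · exact hρ
          · rw [Finset.mem_singleton.1 hx]; exact hρ') (fun x hx _ => hnn x hx)
      rw [Finset.sum_pair hne.symm, if_pos rfl, if_pos hi.symm, hm1] at h2
      have := mm_ge_one (mem_Bd.1 hρ').1
      rw [hm1]; linarith
    · have h2 : 2 ≤ mm ρ := by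
        unfold mm at hm hm1 ⊢
        have a1 : 1 ≤ aon XX ρ := by exact_mod_cast hm
        have a2 : aon XX ρ ≠ 1 := by exact_mod_cast hm1
        exact_mod_cast (by omega : 2 ≤ aon XX ρ)
      nlinarith

lemma Al_prop {T : ℝ} {ρ : ℂ} (h : ρ ∈ Al T) : ρ ∈ zeroBand T ∧ zetaMult ρ = 1 ∧ ρ.re = 1/2 := by
  simp only [Al, Finset.mem_filter] at h
  obtain ⟨hB, hm, hu⟩ := h
  obtain ⟨hz, h1, h2⟩ := mem_Bd.1 hB
  refine ⟨⟨(XX_zero_iff ρ).1 hz, h1, h2⟩, zetaMult_one_of_order hz (by unfold mm at hm; exact_mod_cast hm), ?_⟩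
  have hr := XX_reflect hz
  have := hu (1 - (starRingEnd ℂ) ρ) (mem_Bd.2 ⟨hr, by simpa using h1, by simpa using h2⟩) (by simp)
  have h3 := congrArg Complex.re this
  simp at h3
  linarith

lemma zeroBand_finite (T : ℝ) : (zeroBand T).Finite :=
  (band_finite T (2 * T)).subset fun ρ h => ⟨(XX_zero_iff ρ).2 h.1, h.2.1, h.2.2⟩

lemma finsum_lower (s : Set ℂ) (hs : s.Finite) (g : ℂ → ℝ) (hg : ∀ ρ, 0 ≤ g ρ) (F : Finset ℂ) (hF : ∀ ρ ∈ F, ρ ∈ s ∧ g ρ = 1) :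
    (F.card : ℝ) ≤ ∑ᶠ ρ ∈ s, g ρ := by
  rw [finsum_mem_eq_finite_toFinset_sum _ hs]
  calc (F.card : ℝ) = ∑ ρ ∈ F, g ρ := by rw [Finset.sum_congr rfl fun ρ h => (hF ρ h).2]; simp
    _ ≤ _ := Finset.sum_le_sum_of_subset_of_nonneg (fun ρ h => hs.mem_toFinset.2 (hF ρ h).1) fun ρ _ _ => hg ρ

lemma Al_bounds (T : ℝ) : ((Al T).card : ℝ) ≤ Nsimple T ∧ ((Al T).card : ℝ) ≤ Nline T := by
  constructor
  · refine finsum_lower _ ((zeroBand_finite T).subset fun ρ h => h.1) (fun _ => 1) (fun _ => zero_le_one) _ fun ρ h => ?_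
    exact ⟨⟨(Al_prop h).1, (Al_prop h).2.1⟩, rfl⟩
  · refine finsum_lower _ ((zeroBand_finite T).subset fun ρ h => h.1) (fun ρ => (zetaMult ρ : ℝ)) (fun _ => Nat.cast_nonneg _) _ fun ρ h => ?_
    exact ⟨⟨(Al_prop h).1, (Al_prop h).2.2⟩, by simp [(Al_prop h).2.1]⟩

lemma final_step {f b : ℝ → ℝ} (hf : ContDiff ℝ 2 f) (hb : ContDiff ℝ 2 b) {a a' : ℝ} (ha : 0 < a) (haa : a < a') (ha1 : a' < 1)
    (hfa : f a = 0) (hba : b a' = 0) (hf0 : ∀ α ∈ Icc 0 a, 0 ≤ f α) (hb1 : ∀ α ∈ Icc 0 a, b α = 1)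
    (hpos : ∀ η x : ℝ, |η| ≤ 0.001001 → 0 ≤ ∫ α in (0:ℝ)..a, f α * kc (η * α) * cs (x * α)) {om : ℝ → ℝ} (hom : Om om)
    (hJ : 0 < ∫ α in (0:ℝ)..a, f α) {c : ℝ} (hc : (∫ s, om s ^ 2) * (1/2 * f 0 + ∫ α in (0:ℝ)..a, α * f α) ≤ c * ∫ α in (0:ℝ)..a, f α)
    (hc1 : c < 2 - 0.67250064)
    (hbox : ∀ᶠ T in atTop, ∀ ρ ∈ zeroBand T, |ρ.re - 1/2| < 0.001 / (2 * lg T)) :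
    ∀ᶠ T in atTop, 0.67250064 * (T / (2 * pI)) * lg T ≤ ((Al T).card : ℝ) := by
  obtain ⟨C, hC, h⟩ := pair_sum hf hb ha haa ha1 hfa hba hf0 hb1 hpos hom
  set J := ∫ α in (0:ℝ)..a, f α with hJd
  set d := 2 - 0.67250064 - c with hd
  have hd0 : 0 < d := by linarith
  set η := min (1/8) (d / 12) with hη
  have hη0 : 0 < η := by positivity
  filter_upwards [box_ZB hbox, count_lower hη0 (lt_of_le_of_lt (min_le_left _ _) (by norm_num)), eventually_ge_atTop 3,
    Real.tendsto_log_atTop.eventually_ge_atTop (2 * C * 2 / (J * d))] with T hZ hN hT hLL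
  have hT0 : 0 < T := by linarith
  have hL := log_three hT
  have hp := h T hT hZ
  have hal := alone_lower T
  set P := ∑ ρ ∈ Bd T (2 * T), ∑ ρ' ∈ Bd T (2 * T), if ρ.im = ρ'.im then mm ρ * mm ρ' else 0 with hP
  set L := lg T with hLd
  have hpi := Real.pi_pos
  set Y := T * L / (2 * pI) with hY
  have hY0 : 0 < Y := by positivity
  have hLL' : C * T ≤ pI * J * (d / 2 * Y) := by
    rw [div_le_iff₀ (by positivity)] at hLL
    have e : pI * J * (d / 2 * Y) = T * (L * (J * d)) / 4 := by rw [hY]; field_simp; ring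
    rw [e]; nlinarith
  have hcY : T * (∫ s, om s ^ 2) * L * (1/4 * f 0 + 1/2 * ∫ α in (0:ℝ)..a, α * f α) ≤ pI * J * (c * Y) := by
    have e : pI * J * (c * Y) = T * L / 2 * (c * J) := by rw [hY]; field_simp
    rw [e]
    calc _ = T * L / 2 * ((∫ s, om s ^ 2) * (1/2 * f 0 + ∫ α in (0:ℝ)..a, α * f α)) := by ring
      _ ≤ _ := by gcongr
  have hPY : P ≤ (c + d / 2) * Y := by
    have hpJ : 0 < pI * J := by positivity
    refine le_of_mul_le_mul_right ?_ hpJ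
    linarith
  have hη1 : η ≤ d / 12 := min_le_right _ _
  have hN' : (1 - d / 4) * Y ≤ ∑ ρ ∈ Bd T (2 * T), mm ρ := le_trans (by gcongr; linarith) hN
  have e : 0.67250064 * (T / (2 * pI)) * L = 0.67250064 * Y := by rw [hY]; ring
  rw [e]
  have : (2 - d / 2 - (c + d / 2)) * Y = 0.67250064 * Y := by rw [hd]; ring
  linarith

lemma auto_pos {p : ℝ → ℝ} (hp : Continuous p) (x : ℝ) :
    0 ≤ ∫ u in (0:ℝ)..1, (∫ s in u..1, p s * p (s - u)) * cs (x * u) := by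
  classical
  set G : ℝ → ℝ → ℝ := fun u s => p s * p (s - u) * cs (x * u) with hG
  have hGc : Continuous (Function.uncurry G) := by simp only [hG, Function.uncurry_def]; fun_prop
  set H : ℝ → ℝ → ℝ := fun u s => {q : ℝ × ℝ | q.1 ≤ q.2}.indicator (Function.uncurry G) (u, s) with hH
  have hm : MeasurableSet {q : ℝ × ℝ | q.1 ≤ q.2} := measurableSet_le measurable_fst measurable_snd
  have hint : Integrable (Function.uncurry H) ((volume.restrict (uIoc (0:ℝ) 1)).prod (volume.restrict (uIoc (0:ℝ) 1))) := by
    have : Function.uncurry H = {q : ℝ × ℝ | q.1 ≤ q.2}.indicator (Function.uncurry G) := by ext ⟨u, s⟩; rfl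
    rw [this]
    refine Integrable.indicator ?_ hm
    rw [Measure.prod_restrict]
    have h1 := hGc.continuousOn.integrableOn_compact (μ := (volume : Measure ℝ).prod volume) ((isCompact_Icc (a := (0:ℝ)) (b := 1)).prod (isCompact_Icc (a := (0:ℝ)) (b := 1)))
    refine h1.mono_set ?_
    rw [uIoc_of_le zero_le_one]
    exact prod_mono Ioc_subset_Icc_self Ioc_subset_Icc_self
  have e1 : ∀ u ∈ uIcc (0:ℝ) 1, (∫ s in u..1, p s * p (s - u)) * cs (x * u) = ∫ s in (uIoc (0:ℝ) 1), H u s := by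
    intro u hu
    rw [uIcc_of_le zero_le_one] at hu
    rw [← intervalIntegral.integral_mul_const, intervalIntegral.integral_of_le hu.2, ← integral_Icc_eq_integral_Ioc,
      uIoc_of_le zero_le_one, ← integral_Icc_eq_integral_Ioc]
    have : (H u) = (Ici u).indicator (G u) := by
      ext s; simp only [hH, indicator, mem_Ici, Set.mem_ofPred_eq, Function.uncurry]
    rw [this, setIntegral_indicator measurableSet_Ici]
    congr 2
    ext s; simp only [mem_Icc, mem_inter_iff, mem_Ici]; constructor
    · rintro ⟨h1, h2⟩; exact ⟨⟨hu.1.trans h1, h2⟩, h1⟩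
    · rintro ⟨⟨_, h2⟩, h1⟩; exact ⟨h1, h2⟩
  rw [intervalIntegral.integral_congr e1, intervalIntegral_integral_swap hint, ]
  have e2 : ∀ s ∈ uIoc (0:ℝ) 1, (∫ u in (0:ℝ)..1, H u s) = p s * (cs (x * s) * (∫ t in (0:ℝ)..s, p t * cs (x * t)) +
      sn (x * s) * ∫ t in (0:ℝ)..s, p t * sn (x * t)) := by
    intro s hs
    rw [uIoc_of_le zero_le_one] at hs
    have h1 : (∫ u in (0:ℝ)..1, H u s) = ∫ u in (0:ℝ)..s, G u s := by
      rw [intervalIntegral.integral_of_le zero_le_one, intervalIntegral.integral_of_le hs.1.le]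
      have : (fun u => H u s) = (Iic s).indicator (fun u => G u s) := by
        ext u; simp only [hH, indicator, mem_Iic, Set.mem_ofPred_eq, Function.uncurry]
      rw [this, setIntegral_indicator measurableSet_Iic]
      congr 2
      ext u; simp only [mem_Ioc, mem_inter_iff, mem_Iic]; constructor
      · rintro ⟨⟨h1, _⟩, h2⟩; exact ⟨h1, h2⟩
      · rintro ⟨h1, h2⟩; exact ⟨⟨h1, h2.trans hs.2⟩, h2⟩
    rw [h1]
    have h2 : (∫ u in (0:ℝ)..s, G u s) = ∫ t in (0:ℝ)..s, G (s - t) s := by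
      rw [intervalIntegral.integral_comp_sub_left (fun u => G u s)]; simp
    rw [h2, ← intervalIntegral.integral_const_mul, ← intervalIntegral.integral_const_mul, ← intervalIntegral.integral_add
      ci ci, ← intervalIntegral.integral_const_mul]
    congr 1; ext t
    simp only [hG]
    rw [show s - (s - t) = t by ring, mul_sub, Real.cos_sub]; ring
  rw [setIntegral_congr_fun measurableSet_uIoc e2, uIoc_of_le zero_le_one, ← intervalIntegral.integral_of_le zero_le_one]
  have hd : ∀ {q : ℝ → ℝ}, Continuous q → ∀ s, HasDerivAt (fun s => ∫ t in (0:ℝ)..s, q t) (q s) s := fun hq s =>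
    hq.integral_hasStrictDerivAt 0 s |>.hasDerivAt
  have h3 : ∀ s ∈ uIcc (0:ℝ) 1, HasDerivAt (fun s => 1/2 * ((∫ t in (0:ℝ)..s, p t * cs (x * t)) ^ 2 + (∫ t in (0:ℝ)..s, p t * sn (x * t)) ^ 2))
      (p s * (cs (x * s) * (∫ t in (0:ℝ)..s, p t * cs (x * t)) +
      sn (x * s) * ∫ t in (0:ℝ)..s, p t * sn (x * t))) s := fun s _ => by
    have a1 := (hd (q := fun t => p t * cs (x * t)) (by fun_prop) s).pow 2
    have a2 := (hd (q := fun t => p t * sn (x * t)) (by fun_prop) s).pow 2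
    refine ((a1.add a2).const_mul (1/2)).congr_deriv ?_
    simp; ring
  have hc : ∀ {q : ℝ → ℝ}, Continuous q → Continuous (fun s => ∫ t in (0:ℝ)..s, q t) := fun hq =>
    continuous_iff_continuousAt.2 fun s => (hd hq s).continuousAt
  have c1 := hc (q := fun t => p t * cs (x * t)) (by fun_prop)
  have c2 := hc (q := fun t => p t * sn (x * t)) (by fun_prop)
  rw [intervalIntegral.integral_eq_sub_of_hasDerivAt h3 ci]
  simp; positivity

lemma strip_pos {f : ℝ → ℝ} (hf : Continuous f) {a B : ℝ} (ha : 0 ≤ a) (hB : 0 < B)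
    (h : ∀ x : ℝ, 0 ≤ ∫ α in (0:ℝ)..a, f α * kc (B * α) * cs (x * α)) (η x : ℝ) (hη : |η| ≤ B) :
    0 ≤ ∫ α in (0:ℝ)..a, f α * kc (η * α) * cs (x * α) := by
  set F : ℂ → ℂ := fun z => ∫ α in (0:ℝ)..a, (f α : ℂ) * Complex.cos (α * z) with hF
  have hre : ∀ z : ℂ, (F z).re = ∫ α in (0:ℝ)..a, f α * kc (z.im * α) * cs (z.re * α) := by
    intro z
    have := Complex.reCLM.intervalIntegral_comp_comm (μ := volume) (a := 0) (b := a) (f := fun α : ℝ => (f α : ℂ) * Complex.cos (α * z))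
      ci
    rw [hF]; simp only [Complex.reCLM_apply] at this
    rw [← this]
    congr 1; ext α
    rw [Complex.re_ofReal_mul, Complex.cos_eq]
    have : ((α:ℂ) * z).re = z.re * α := by simp [mul_comm]
    rw [this]
    have : ((α:ℂ) * z).im = z.im * α := by simp [mul_comm]
    rw [this]
    simp only [← Complex.ofReal_cos, ← Complex.ofReal_sin, ← Complex.ofReal_cosh, ← Complex.ofReal_sinh, ← Complex.ofReal_mul]
    rw [Complex.sub_re, Complex.ofReal_re, Complex.re_ofReal_mul, Complex.I_re]; ring
  have hdF : Differentiable ℂ F := by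
    intro z₀
    obtain ⟨K, hK⟩ := ((isCompact_closedBall z₀ 1).prod (isCompact_Icc (a := (0:ℝ)) (b := a))).exists_bound_of_continuousOn
      (f := fun q : ℂ × ℝ => (f q.2 : ℂ) * (-Complex.sin (q.2 * q.1) * q.2)) (by fun_prop)
    refine (intervalIntegral.hasDerivAt_integral_of_dominated_loc_of_deriv_le (μ := volume) (a := 0) (b := a)
      (F := fun z α => (f α : ℂ) * Complex.cos (α * z)) (F' := fun z α => (f α : ℂ) * (-Complex.sin (α * z) * α)) (bound := fun _ => K)
      (Metric.closedBall_mem_nhds z₀ one_pos) (Eventually.of_forall fun z => Continuous.aestronglyMeasurable (by fun_prop))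
      ci (Continuous.aestronglyMeasurable (by fun_prop))
      (Eventually.of_forall fun α hα z hz => hK (z, α) ⟨hz, ?_⟩) (by simp) (Eventually.of_forall fun α _ z _ => ?_)).2.differentiableAt
    · rw [uIoc_of_le ha] at hα; exact ⟨hα.1.le, hα.2⟩
    · refine HasDerivAt.const_mul _ ?_
      simpa using ((hasDerivAt_id z).const_mul (α:ℂ)).ccos
  have hlow : ∃ M, ∀ z : ℂ, |z.im| ≤ B → -M ≤ (F z).re := by
    obtain ⟨K, hK⟩ := (isCompact_Icc (a := (0:ℝ)) (b := a)).exists_bound_of_continuousOn (f := fun α => f α * kc (B * α)) (by fun_prop)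
    refine ⟨K * |a - 0|, fun z hz => ?_⟩
    rw [hre]
    refine neg_le_of_abs_le ?_
    rw [← Real.norm_eq_abs]
    refine intervalIntegral.norm_integral_le_of_norm_le_const fun α hα => ?_
    rw [uIoc_of_le ha] at hα
    have h1 := hK α ⟨hα.1.le, hα.2⟩
    have h2 : kc (z.im * α) ≤ kc (B * α) := by
      rw [Real.cosh_le_cosh, abs_mul, abs_mul, abs_of_pos hB]
      exact mul_le_mul_of_nonneg_right hz (abs_nonneg _)
    simp only [norm_mul, Real.norm_eq_abs, abs_of_pos (Real.cosh_pos _)] at h1 ⊢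
    calc |f α| * kc (z.im * α) * |cs (z.re * α)| ≤ |f α| * kc (B * α) * 1 := by
          gcongr
          exact Real.abs_cos_le_one _
      _ ≤ K := by linarith
  obtain ⟨M, hM⟩ := hlow
  have key := PhragmenLindelof.horizontal_strip (a := -B) (b := B) (C := 1) (f := fun z => cE (-F z)) (z := ⟨x, η⟩)
    (by exact (Differentiable.diffContOnCl (by fun_prop)))
    ⟨0, div_pos Real.pi_pos (by linarith), M, by
      refine Asymptotics.IsBigO.of_bound 1 ?_
      rw [eventually_inf_principal]
      refine Eventually.of_forall fun z hz => ?_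
      have := hM z (abs_le.2 ⟨hz.1.le, hz.2.le⟩)
      rw [Complex.norm_exp, Real.norm_of_nonneg (Real.exp_pos _).le]
      simp; linarith⟩
    (fun z hz => by
      rw [Complex.norm_exp, Real.exp_le_one_iff, Complex.neg_re, hre, hz]
      have := h z.re
      simp only [neg_mul, Real.cosh_neg]; linarith)
    (fun z hz => by
      rw [Complex.norm_exp, Real.exp_le_one_iff, Complex.neg_re, hre, hz]
      have := h z.re
      linarith) (abs_le.1 hη).1 (abs_le.1 hη).2
  rw [Complex.norm_exp, Real.exp_le_one_iff, Complex.neg_re, hre] at key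
  simpa using key

noncomputable def pe : List ℝ → ℝ → ℝ
  | [], _ => 0
  | c :: l, u => c + u * pe l u

noncomputable def pint : ℕ → List ℝ → ℝ
  | _, [] => 0
  | k, c :: l => c / (k + 1) + pint (k + 1) l

lemma pe_cd (l : List ℝ) : ContDiff ℝ 2 (pe l) := by
  induction l with
  | nil => exact contDiff_const
  | cons c l ih => exact contDiff_const.add (contDiff_id.mul ih)

lemma pe_int (l : List ℝ) : ∀ k : ℕ, (∫ u in (0:ℝ)..1, u ^ k * pe l u) = pint k l := by
  induction l with
  | nil => intro k; simp [pe, pint]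
  | cons c l ih =>
    intro k
    have hc := (pe_cd l).continuous
    have : ∀ u : ℝ, u ^ k * pe (c :: l) u = c * u ^ k + u ^ (k + 1) * pe l u := fun u => by rw [pe]; ring
    simp only [this]
    rw [intervalIntegral.integral_add ci ci,
      ih, intervalIntegral.integral_const_mul, integral_pow, pint]
    simp [div_eq_mul_inv]

noncomputable def Ql : List ℝ := [2465459/2903040, -5329/9216, -3797/4480, 899/1728, 49/320, -1/10, 0, 1/315, 0, -1/22680]

noncomputable def pq (t : ℝ) : ℝ := 1 - (t - 1/2) ^ 2 + (t - 1/2) ^ 4 / 6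

lemma Q_auto (u : ℝ) : (∫ s in u..1, pq s * pq (s - u)) = pe Ql u := by
  have h : ∀ s ∈ uIcc u 1, HasDerivAt (fun s : ℝ =>
      (1 - 2*(u/2)^2 + 4/3*(u/2)^4 - 1/3*(u/2)^6 + 1/36*(u/2)^8) * (s - (u/2 + 1/2))
      + (-2 + 1/3*(u/2)^4 - 1/9*(u/2)^6) / 3 * (s - (u/2 + 1/2)) ^ 3
      + (4/3 + 1/3*(u/2)^2 + 1/6*(u/2)^4) / 5 * (s - (u/2 + 1/2)) ^ 5
      + (-1/3 - 1/9*(u/2)^2) / 7 * (s - (u/2 + 1/2)) ^ 7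
      + (1/36) / 9 * (s - (u/2 + 1/2)) ^ 9) (pq s * pq (s - u)) s := fun s _ => by
    have d := (hasDerivAt_id s).sub_const (u/2 + 1/2)
    refine (((((d.const_mul _).add ((d.pow 3).const_mul _)).add ((d.pow 5).const_mul _)).add ((d.pow 7).const_mul _)).add
      ((d.pow 9).const_mul _)).congr_deriv ?_
    simp only [pq, id]; push_cast; ring
  rw [intervalIntegral.integral_eq_sub_of_hasDerivAt h (Continuous.intervalIntegrable (by unfold pq; fun_prop) _ _)]
  simp only [pe, Ql]; ring

lemma pq_nonneg {t : ℝ} (h0 : 0 ≤ t) (h1 : t ≤ 1) : 0 ≤ pq t := by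
  unfold pq
  nlinarith [sq_nonneg ((t - 1/2) ^ 2), mul_nonneg h0 (sub_nonneg.2 h1)]

lemma Q_nonneg {u : ℝ} (h0 : 0 ≤ u) (h1 : u ≤ 1) : 0 ≤ pe Ql u := by
  rw [← Q_auto]
  refine intervalIntegral.integral_nonneg h1 fun s hs => mul_nonneg (pq_nonneg (h0.trans hs.1) hs.2)
    (pq_nonneg (by linarith [hs.1]) (by linarith [hs.2]))

lemma cosh_inv_bd (x : ℝ) : 1 - x ^ 2 / 2 ≤ (kc x)⁻¹ ∧ (kc x)⁻¹ ≤ 1 - x ^ 2 / 2 + x ^ 4 / 4 := by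
  have hp := Real.cosh_pos x
  constructor
  · have h1 := Real.cosh_le_exp_half_sq x
    calc 1 - x ^ 2 / 2 ≤ ep (-(x ^ 2 / 2)) := by linarith [Real.add_one_le_exp (-(x ^ 2 / 2))]
      _ = (ep (x ^ 2 / 2))⁻¹ := Real.exp_neg _
      _ ≤ _ := inv_anti₀ hp h1
  · have h2 : 1 + x ^ 2 / 2 ≤ kc x := by
      have h3 : (x / 2) ^ 2 ≤ Real.sinh (x / 2) ^ 2 := by
        rw [sq_le_sq, Real.abs_sinh]; exact Real.self_le_sinh_iff.2 (abs_nonneg _)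
      have h4 := Real.cosh_two_mul (x / 2)
      rw [Real.cosh_sq, show 2 * (x / 2) = x by ring] at h4
      rw [h4]; linarith
    have h3 : 0 < 1 - x ^ 2 / 2 + x ^ 4 / 4 := by nlinarith [sq_nonneg (x ^ 2 / 2 - 1/2)]
    rw [inv_le_iff_one_le_mul₀ hp]
    nlinarith [mul_le_mul_of_nonneg_left h2 h3.le, sq_nonneg (x ^ 3)]

noncomputable def gg (u : ℝ) : ℝ := pe Ql u * (kc (1001/1000000 * u))⁻¹

lemma gg_cd : ContDiff ℝ 2 gg := by
  unfold gg
  exact (pe_cd Ql).mul (ContDiff.inv (by fun_prop) fun u => (Real.cosh_pos _).ne')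

lemma gg_int0 : 42205074847/100000000000 ≤ ∫ u in (0:ℝ)..1, gg u := by
  have hc := (pe_cd Ql).continuous
  calc (42205074847/100000000000 : ℝ) ≤ pint 0 Ql - (1001/1000000) ^ 2 / 2 * pint 2 Ql := by norm_num [Ql, pint]
    _ = ∫ u in (0:ℝ)..1, (u ^ 0 * pe Ql u - (1001/1000000) ^ 2 / 2 * (u ^ 2 * pe Ql u)) := by
      rw [intervalIntegral.integral_sub ci ci,
        intervalIntegral.integral_const_mul, pe_int, pe_int]
    _ ≤ _ := by
      refine intervalIntegral.integral_mono_on zero_le_one ci (gg_cd.continuous.intervalIntegrable _ _) fun u hu => ?_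
      have := mul_le_mul_of_nonneg_left (cosh_inv_bd (1001/1000000 * u)).1 (Q_nonneg hu.1 hu.2)
      unfold gg; linarith

lemma gg_int1 : (∫ u in (0:ℝ)..1, u * gg u) ≤ 13563809259/100000000000 := by
  have hc := (pe_cd Ql).continuous
  have hg := gg_cd.continuous
  calc
    _ ≤ ∫ u in (0:ℝ)..1, (u ^ 1 * pe Ql u - (1001/1000000) ^ 2 / 2 * (u ^ 3 * pe Ql u) + (1001/1000000) ^ 4 / 4 * (u ^ 5 * pe Ql u)) := by
      refine intervalIntegral.integral_mono_on zero_le_one ci ci fun u hu => ?_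
      have := mul_le_mul_of_nonneg_left (mul_le_mul_of_nonneg_left (cosh_inv_bd (1001/1000000 * u)).2 (Q_nonneg hu.1 hu.2)) hu.1
      unfold gg; linarith
    _ = pint 1 Ql - (1001/1000000) ^ 2 / 2 * pint 3 Ql + (1001/1000000) ^ 4 / 4 * pint 5 Ql := by
      rw [intervalIntegral.integral_add ci ci,
        intervalIntegral.integral_sub ci ci,
        intervalIntegral.integral_const_mul, intervalIntegral.integral_const_mul, pe_int, pe_int, pe_int]
    _ ≤ _ := by norm_num [Ql, pint]

lemma om_exists : ∃ om : ℝ → ℝ, Om om ∧ (∫ s, om s ^ 2) ≤ 1 + 4/10000000000 := by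
  set ob : ContDiffBump (3/2 : ℝ) := ⟨1/2, 1/2 + 2/10000000000, by norm_num, by norm_num⟩ with hob
  have hs : ∀ x, ob x ≠ 0 → |x - 3/2| < 1/2 + 2/10000000000 := fun x hx => by
    have : x ∈ Function.support ob := hx
    rw [ob.support_eq, Metric.mem_ball, Real.dist_eq] at this
    exact this
  refine ⟨ob, ⟨ob.contDiff, fun x hx => ?_, fun x => ob.nonneg, fun x => ob.le_one, fun x hx => ?_⟩, ?_⟩
  · have := abs_lt.1 (hs x hx)
    constructor <;> linarith [this.1, this.2]
  · refine ob.one_of_mem_closedBall ?_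
    rw [Metric.mem_closedBall, Real.dist_eq, abs_le]
    constructor <;> simp only [hob] <;> linarith [hx.1, hx.2]
  · have hi : IntegrableOn (fun _ : ℝ => (1:ℝ)) (Metric.ball (3/2 : ℝ) (1/2 + 2/10000000000)) := by
      rw [integrableOn_const_iff]; right; exact measure_ball_lt_top
    calc (∫ s, ob s ^ 2) ≤ ∫ s, (Metric.ball (3/2 : ℝ) (1/2 + 2/10000000000)).indicator (fun _ => (1:ℝ)) s := by
          refine integral_mono_of_nonneg (Eventually.of_forall fun s => sq_nonneg _) (hi.integrable_indicator measurableSet_ball)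
            (Eventually.of_forall fun s => ?_)
          by_cases h : ob s = 0
          · simp only [h]
            refine le_trans (by norm_num) (indicator_nonneg (fun _ _ => zero_le_one) s)
          · rw [indicator_of_mem (by rw [Metric.mem_ball, Real.dist_eq]; exact hs s h)]
            exact pow_le_one₀ ob.nonneg ob.le_one
      _ = _ := by
          rw [integral_indicator measurableSet_ball, setIntegral_const, Measure.real, Real.volume_ball]
          rw [ENNReal.toReal_ofReal (by norm_num)]; norm_num

lemma conclude (hbox : ∀ᶠ T in atTop, ∀ ρ ∈ zeroBand T, |ρ.re - 1/2| < 0.001 / (2 * lg T)) :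
    ∀ᶠ T in atTop, 0.67250064 * (T / (2 * pI)) * lg T ≤ ((Al T).card : ℝ) := by
  obtain ⟨om, hom, homi⟩ := om_exists
  obtain ⟨a, ha⟩ : ∃ a : ℝ, a = 999999999/1000000000 := ⟨_, rfl⟩
  have ha0 : 0 < a := by rw [ha]; norm_num
  set bb : ContDiffBump (0 : ℝ) := ⟨a, 9999999995/10000000000, ha0, by rw [ha]; norm_num⟩ with hbb
  have hsub : ∀ F : ℝ → ℝ, (∫ α in (0:ℝ)..a, F (α / a)) = a * ∫ u in (0:ℝ)..1, F u := fun F => by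
    rw [intervalIntegral.integral_comp_div F ha0.ne', zero_div, div_self ha0.ne']; rfl
  have i0 : (∫ α in (0:ℝ)..a, gg (α / a)) = a * ∫ u in (0:ℝ)..1, gg u := hsub gg
  have i1 : (∫ α in (0:ℝ)..a, α * gg (α / a)) = a ^ 2 * ∫ u in (0:ℝ)..1, u * gg u := by
    rw [show a ^ 2 * (∫ u in (0:ℝ)..1, u * gg u) = a * ∫ u in (0:ℝ)..1, a * (u * gg u) by
      rw [intervalIntegral.integral_const_mul]; ring, ← hsub]
    congr 1; ext α; field_simp
  have g0 := gg_int0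
  have g1 := gg_int1
  have hI1 : 0 ≤ ∫ u in (0:ℝ)..1, u * gg u := intervalIntegral.integral_nonneg zero_le_one fun u hu =>
    mul_nonneg hu.1 (mul_nonneg (Q_nonneg hu.1 hu.2) (inv_nonneg.2 (Real.cosh_pos _).le))
  have hgc := gg_cd
  have hf : ContDiff ℝ 2 (fun α => gg (α / a)) := hgc.comp (contDiff_id.div_const a)
  refine final_step (f := fun α => gg (α / a)) (b := bb) (a := a) (a' := 9999999995/10000000000) (om := om) (c := 1327499359/1000000000)
    hf bb.contDiff ha0 (by rw [ha]; norm_num) (by norm_num) ?_ ?_ ?_ ?_ ?_ hom ?_ ?_ (by norm_num) hbox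
  · simp only [div_self ha0.ne', gg]
    norm_num [Ql, pe]
  · refine bb.zero_of_le_dist ?_
    rw [Real.dist_eq, sub_zero, abs_of_pos (by norm_num)]
  · intro α hα
    exact mul_nonneg (Q_nonneg (div_nonneg hα.1 ha0.le) ((div_le_one ha0).2 hα.2)) (inv_nonneg.2 (Real.cosh_pos _).le)
  · intro α hα
    refine bb.one_of_mem_closedBall ?_
    rw [Metric.mem_closedBall, Real.dist_eq, sub_zero, abs_of_nonneg hα.1]; exact hα.2
  · intro η x hη
    refine strip_pos (B := 1001/1000000 / a) hf.continuous ha0.le (by positivity) (fun y => ?_) η x (hη.trans ?_)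
    · have e : ∀ α, gg (α / a) * kc (1001/1000000 / a * α) * cs (y * α) = (fun u => (∫ s in u..1, pq s * pq (s - u)) * cs ((y * a) * u)) (α / a) := fun α => by
        have h1 : (1001/1000000 : ℝ) / a * α = 1001/1000000 * (α / a) := by ring
        have h2 : y * a * (α / a) = y * α := by field_simp
        simp only [Q_auto, gg, h1, h2]
        rw [inv_mul_cancel_right₀ (Real.cosh_pos _).ne']
      rw [intervalIntegral.integral_congr fun α _ => e α, hsub (fun u => (∫ s in u..1, pq s * pq (s - u)) * cs ((y * a) * u))]
      exact mul_nonneg ha0.le (auto_pos (by unfold pq; fun_prop) _)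
    · rw [ha]; norm_num
  · rw [i0]; exact mul_pos ha0 (by linarith)
  · rw [i0, i1]
    have q0 : gg (0 / a) = 2465459/2903040 := by simp [gg, pe, Ql]
    simp only [q0]
    calc _ ≤ (1 + 4/10000000000) * (1/2 * (2465459/2903040) + 1 * (13563809259/100000000000)) := by
          gcongr
          rw [ha]; norm_num
      _ ≤ 1327499359/1000000000 * (a * (42205074847/100000000000)) := by rw [ha]; norm_num
      _ ≤ _ := by gcongr

/-- If all nontrivial zeros with `T < γ ≤ 2T` lie in the box of width `0.001 / log T`
centered at the critical line, then both the number of simple zeros and the number of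
critical-line zeros with `T < γ ≤ 2T` are at least `(0.67250064 + o(1)) (T/2π) log T`. -/
theorem simple_and_critical_bound_b_point001
    (hbox : ∀ᶠ T in atTop, ∀ ρ ∈ zeroBand T, |ρ.re - 1/2| < 0.001 / (2 * Real.log T)) :
    ∃ ε : ℝ → ℝ, Tendsto ε atTop (nhds 0) ∧
      ∀ᶠ T in atTop,
        (0.67250064 + ε T) * (T / (2 * Real.pi)) * Real.log T ≤ Nsimple T ∧
        (0.67250064 + ε T) * (T / (2 * Real.pi)) * Real.log T ≤ Nline T := by
  refine ⟨fun _ => 0, tendsto_const_nhds, ?_⟩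
  filter_upwards [conclude hbox] with T hT
  rw [add_zero]
  exact ⟨hT.trans (Al_bounds T).1, hT.trans (Al_bounds T).2⟩
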